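/- arXiv:math/0208138 — 2 statements merged into one kernel-verified Lean document; each statement's English description precedes it below -/
import Mathlib

section
/- Let W be a finite complex reflection group of rank ℓ with degrees d_1,…,d_ℓ, and let fix(w) denote the dimension of the fixed space of w on h. Then for any r, Σ_{w∈W} r^{fix(w)} = Π_{i=1}^ℓ (r + d_i − 1). -/
open Module

section CompoundMatrix
open Set Set.powersetCard

variable {n : ℕ} {R : Type*} [CommRing R]

/-- The `p`-th compound matrix, whose entries are the `p × p` minors. -/
def compoundMatrix (p : ℕ) (N : Matrix (Fin n) (Fin n) R) :
    Matrix (powersetCard (Fin n) p) (powersetCard (Fin n) p) R :=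
  fun I A => (N.submatrix (ofFinEmbEquiv.symm I) (ofFinEmbEquiv.symm A)).det

theorem compoundMatrix_eq_toMatrix (p : ℕ) (N : Matrix (Fin n) (Fin n) R) :
    compoundMatrix p N = LinearMap.toMatrix ((Pi.basisFun R (Fin n)).exteriorPower p)
      ((Pi.basisFun R (Fin n)).exteriorPower p) (exteriorPower.map p (Matrix.toLin' N)) := by
  ext I A
  rw [LinearMap.toMatrix_apply, exteriorPower.basis_apply, exteriorPower.map_apply_ιMulti_family,
    exteriorPower.basis_repr_apply, exteriorPower.ιMulti_family,
    exteriorPower.ιMultiDual_apply_ιMulti, compoundMatrix, ← Matrix.det_transpose]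
  congr 1
  ext i j
  simp

theorem compoundMatrix_mul (p : ℕ) (N N' : Matrix (Fin n) (Fin n) R) :
    compoundMatrix p (N * N') = compoundMatrix p N * compoundMatrix p N' := by
  simp only [compoundMatrix_eq_toMatrix, ← LinearMap.toMatrix_mul, Matrix.toLin'_mul]
  rw [Module.End.mul_eq_comp, exteriorPower.map_comp]

theorem compoundMatrix_one (p : ℕ) :
    compoundMatrix p (1 : Matrix (Fin n) (Fin n) R) = 1 := by
  rw [compoundMatrix_eq_toMatrix, Matrix.toLin'_one, exteriorPower.map_id, LinearMap.toMatrix_id]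

theorem compoundMatrix_map {S : Type*} [CommRing S] (f : R →+* S) (p : ℕ)
    (N : Matrix (Fin n) (Fin n) R) :
    compoundMatrix p (N.map f) = (compoundMatrix p N).map f := by
  ext I A
  simp [compoundMatrix, RingHom.map_det, Matrix.submatrix_map]

theorem compoundMatrix_diagonal_apply (p : ℕ) (c : Fin n → R) (I : powersetCard (Fin n) p) :
    compoundMatrix p (Matrix.diagonal c) I I = ∏ i ∈ (I : Finset (Fin n)), c i := by
  have : (Matrix.diagonal c).submatrix (ofFinEmbEquiv.symm I) (ofFinEmbEquiv.symm I) =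
      Matrix.diagonal (c ∘ ofFinEmbEquiv.symm I) :=
    Matrix.submatrix_diagonal _ _ (ofFinEmbEquiv.symm I).injective
  rw [compoundMatrix, this, Matrix.det_diagonal]
  have h := Finset.prod_map Finset.univ
    ((I : Finset (Fin n)).orderEmbOfFin (card_eq I)).toEmbedding c
  rw [Finset.map_orderEmbOfFin_univ] at h
  exact h.symm

/-- Complementary minors: `det N` times a minor of `N⁻¹` lies in the base ring. -/
theorem exists_compoundMatrix_mul_eq_det [IsDomain R] (p : ℕ) (N : Matrix (Fin n) (Fin n) R)
    (hN : N.det ≠ 0) :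
    ∃ C : Matrix (powersetCard (Fin n) p) (powersetCard (Fin n) p) R,
      compoundMatrix p N * C = N.det • 1 ∧ C * compoundMatrix p N = N.det • 1 := by
  classical
  let K := FractionRing R
  let φ : R →+* K := algebraMap R K
  have hφ : Function.Injective φ := IsFractionRing.injective R K
  let NK := N.map φ
  have hdet : NK.det = φ N.det := (RingHom.map_det φ N).symm
  have hu : IsUnit NK.det := by
    rw [hdet]; exact (map_ne_zero_iff φ hφ |>.mpr hN).isUnit
  have key : ∀ A I, ∃ c : R, φ c = φ N.det * compoundMatrix p NK⁻¹ A I := by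
    intro A I
    let eA := finSumEquivOfFinset (s := (A : Finset (Fin n))) A.2 rfl
    let eI := finSumEquivOfFinset (s := (I : Finset (Fin n))) I.2 rfl
    have hcard : (I : Finset (Fin n))ᶜ.card = (A : Finset (Fin n))ᶜ.card := by
      rw [Finset.card_compl, Finset.card_compl, A.2, I.2]
    let eI' : Fin p ⊕ Fin ((A : Finset (Fin n))ᶜ.card) ≃ Fin n :=
      finSumEquivOfFinset (s := (I : Finset (Fin n))) I.2 hcard
    let J := NK.submatrix eI' eA
    let J' := NK⁻¹.submatrix eA eI'
    have hJJ : J * J' = 1 := by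
      simp only [J, J', Matrix.submatrix_mul_equiv]
      rw [Matrix.mul_nonsing_inv _ hu, Matrix.submatrix_one_equiv]
    have hsign : ∃ u : ℤˣ, J.det = u * NK.det := by
      refine ⟨Equiv.Perm.sign (eA.symm.trans eI'), ?_⟩
      have : J = (NK.submatrix (eA.symm.trans eI') id).submatrix eA eA := by
        ext; simp [J]
      rw [this, Matrix.det_submatrix_equiv_self, Matrix.det_permute]
    obtain ⟨u, hu'⟩ := hsign
    have hminor : compoundMatrix p NK⁻¹ A I = J'.toBlocks₁₁.det := by
      rw [compoundMatrix]
      congr 1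
    have hmul : J * Matrix.fromBlocks J'.toBlocks₁₁ 0 J'.toBlocks₂₁ 1 =
        Matrix.fromBlocks 1 J.toBlocks₁₂ 0 J.toBlocks₂₂ := by
      have h := hJJ
      rw [← Matrix.fromBlocks_toBlocks J, ← Matrix.fromBlocks_toBlocks J',
        Matrix.fromBlocks_multiply, ← Matrix.fromBlocks_one, Matrix.fromBlocks_inj] at h
      conv_lhs => rw [← Matrix.fromBlocks_toBlocks J]
      rw [Matrix.fromBlocks_multiply, h.1, h.2.2.1]
      simp
    have hd := congrArg Matrix.det hmul
    rw [Matrix.det_mul, Matrix.det_fromBlocks_zero₁₂, Matrix.det_fromBlocks_zero₂₁,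
      Matrix.det_one, Matrix.det_one, one_mul, mul_one, hu', hdet, ← hminor] at hd
    have hJ22 : J.toBlocks₂₂ = (N.submatrix (eI' ∘ Sum.inr) (eA ∘ Sum.inr)).map φ := by
      ext; rfl
    refine ⟨(u : ℤ) * (N.submatrix (eI' ∘ Sum.inr) (eA ∘ Sum.inr)).det, ?_⟩
    rw [map_mul, RingHom.map_det, RingHom.mapMatrix_apply, ← hJ22, ← hd, map_intCast, ← mul_assoc,
      ← mul_assoc, ← Int.cast_mul, ← Units.val_mul, Int.units_mul_self]
    simp
  choose c hc using key
  have hC : (Matrix.of c).map φ = φ N.det • compoundMatrix p NK⁻¹ := by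
    ext A I; simp [hc]
  have hinj : Function.Injective
      (fun X : Matrix (powersetCard (Fin n) p) (powersetCard (Fin n) p) R => X.map φ) :=
    Matrix.map_injective hφ
  have hsm : (N.det • (1 : Matrix (powersetCard (Fin n) p) (powersetCard (Fin n) p) R)).map φ =
      φ N.det • 1 := by
    ext i j; by_cases h : i = j <;> simp [h]
  refine ⟨Matrix.of c, hinj ?_, hinj ?_⟩
  · change (compoundMatrix p N * Matrix.of c).map φ = _
    simp only [hsm]
    rw [Matrix.map_mul, hC, ← compoundMatrix_map, Matrix.mul_smul, ← compoundMatrix_mul,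
      Matrix.mul_nonsing_inv _ hu, compoundMatrix_one]
  · change (Matrix.of c * compoundMatrix p N).map φ = _
    simp only [hsm]
    rw [Matrix.map_mul, hC, ← compoundMatrix_map, Matrix.smul_mul, ← compoundMatrix_mul,
      Matrix.nonsing_inv_mul _ hu, compoundMatrix_one]

end CompoundMatrix

/-- A complex matrix of finite multiplicative order is diagonalizable. -/
theorem exists_diagonalization_of_pow_eq_one {n : ℕ} (M : Matrix (Fin n) (Fin n) ℂ) (k : ℕ)
    (hk : k ≠ 0) (hM : M ^ k = 1) :
    ∃ (P Q : Matrix (Fin n) (Fin n) ℂ) (c : Fin n → ℂ),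
      P * Q = 1 ∧ Q * P = 1 ∧ M = P * Matrix.diagonal c * Q := by
  classical
  let f : Module.End ℂ (Fin n → ℂ) := Matrix.toLin' M
  have hf : f ^ k = 1 := by
    simp only [f, ← Matrix.toLin'_pow, hM, Matrix.toLin'_one]; rfl
  have hss : f.IsSemisimple := by
    refine Module.End.isSemisimple_of_squarefree_aeval_eq_zero (p := Polynomial.X ^ k - 1) ?_ ?_
    · exact ((Polynomial.separable_X_pow_sub_C (1 : ℂ) (n := k) (by exact_mod_cast hk)
        one_ne_zero)).squarefree
    · simp [hf]
  have htop := hss.iSup_eigenspace_eq_top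
  have hInternal : DirectSum.IsInternal f.eigenspace :=
    DirectSum.isInternal_submodule_of_iSupIndep_of_iSup_eq_top f.eigenspaces_iSupIndep htop
  let b₀ := hInternal.collectedBasis (fun μ => Module.finBasis ℂ (f.eigenspace μ))
  have : Fintype ((μ : ℂ) × Fin (finrank ℂ (f.eigenspace μ))) :=
    FiniteDimensional.fintypeBasisIndex b₀
  have hcard : Fintype.card ((μ : ℂ) × Fin (finrank ℂ (f.eigenspace μ))) = n := by
    rw [← Module.finrank_eq_card_basis b₀]; simp
  let e := Fintype.equivFinOfCardEq hcard
  let b := b₀.reindex e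
  let c : Fin n → ℂ := fun i => (e.symm i).1
  have hb : ∀ i, f (b i) = c i • b i := by
    intro i
    have := hInternal.collectedBasis_mem (fun μ => Module.finBasis ℂ (f.eigenspace μ)) (e.symm i)
    rw [Module.End.mem_eigenspace_iff] at this
    simpa only [b, c, Basis.reindex_apply] using this
  let s := Pi.basisFun ℂ (Fin n)
  refine ⟨s.toMatrix b, b.toMatrix s, c, s.toMatrix_mul_toMatrix_flip b,
    b.toMatrix_mul_toMatrix_flip s, ?_⟩
  have h1 : LinearMap.toMatrix b b f = Matrix.diagonal c := by
    ext i j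
    rw [LinearMap.toMatrix_apply, hb, map_smul, Basis.repr_self, Matrix.diagonal_apply]
    by_cases h : i = j
    · subst h; simp
    · simp [h]
  rw [← h1, basis_toMatrix_mul_linearMap_toMatrix_mul_basis_toMatrix]
  simp [s, f, LinearMap.toMatrix_eq_toMatrix', LinearMap.toMatrix'_toLin']

section LinearSubstitution
open MvPolynomial

variable {n : ℕ}

theorem MvPolynomial.homogeneousComponent_mul_of_isHomogeneous {σ R : Type*} [CommSemiring R]
    {f : MvPolynomial σ R} {e : ℕ} (hf : f.IsHomogeneous e) (p : MvPolynomial σ R) (k : ℕ) :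
    homogeneousComponent k (p * f) =
      if e ≤ k then homogeneousComponent (k - e) p * f else 0 := by
  have hp : p * f = ∑ i ∈ Finset.range (p.totalDegree + 1), homogeneousComponent i p * f := by
    rw [← Finset.sum_mul, sum_homogeneousComponent]
  have hc : ∀ i, homogeneousComponent k (homogeneousComponent i p * f) =
      if k = i + e then homogeneousComponent i p * f else 0 := fun i =>
    homogeneousComponent_of_mem ((homogeneousComponent_isHomogeneous i p).mul hf)
  rw [hp, map_sum]
  simp only [hc]
  split_ifs with h
  · obtain ⟨j, rfl⟩ := Nat.exists_eq_add_of_le h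
    rw [Nat.add_sub_cancel_left]
    have : ∀ i, (e + j = i + e) ↔ j = i := fun i => by omega
    simp only [this, Finset.sum_ite_eq, Finset.mem_range]
    split_ifs with h'
    · rfl
    · rw [homogeneousComponent_eq_zero _ _ (by omega), zero_mul]
  · exact Finset.sum_eq_zero fun i _ => if_neg (by omega)

/-- The substitution `p ↦ p ∘ A` of a matrix into a polynomial. -/
noncomputable def linSubst (A : Matrix (Fin n) (Fin n) ℂ) :
    MvPolynomial (Fin n) ℂ →ₐ[ℂ] MvPolynomial (Fin n) ℂ :=
  aeval fun i => ∑ j, C (A i j) * X j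

theorem linSubst_X (A : Matrix (Fin n) (Fin n) ℂ) (i : Fin n) :
    linSubst A (X i) = ∑ j, C (A i j) * X j := by
  simp [linSubst]

theorem linSubst_linSubst (A B : Matrix (Fin n) (Fin n) ℂ) (p : MvPolynomial (Fin n) ℂ) :
    linSubst A (linSubst B p) = linSubst (B * A) p := by
  have : (linSubst A).comp (linSubst B) = linSubst (B * A) := by
    ext1 i
    simp only [AlgHom.comp_apply, linSubst_X, map_sum, map_mul, algHom_C, algebraMap_eq,
      Finset.mul_sum, Matrix.mul_apply, Finset.sum_mul]
    rw [Finset.sum_comm]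
    simp only [mul_assoc]
  exact DFunLike.congr_fun this p

theorem linSubst_one (p : MvPolynomial (Fin n) ℂ) : linSubst 1 p = p := by
  have : linSubst (1 : Matrix (Fin n) (Fin n) ℂ) = AlgHom.id ℂ _ := by
    ext1 i
    simp [linSubst_X, Matrix.one_apply]
  rw [this, AlgHom.id_apply]

theorem MvPolynomial.IsHomogeneous.linSubst {p : MvPolynomial (Fin n) ℂ} {k : ℕ}
    (hp : p.IsHomogeneous k) (A : Matrix (Fin n) (Fin n) ℂ) : (linSubst A p).IsHomogeneous k := by
  have := hp.aeval (fun i => ∑ j, C (A i j) * X j) (n := 1)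
    fun i => IsHomogeneous.sum _ _ _ fun j _ => isHomogeneous_C_mul_X _ _
  rwa [one_mul] at this

theorem homogeneousComponent_linSubst (A : Matrix (Fin n) (Fin n) ℂ) (k : ℕ)
    (p : MvPolynomial (Fin n) ℂ) :
    homogeneousComponent k (linSubst A p) = linSubst A (homogeneousComponent k p) := by
  conv_lhs => rw [← sum_homogeneousComponent p]
  rw [map_sum, map_sum]
  have hc : ∀ i, homogeneousComponent k (linSubst A (homogeneousComponent i p)) =
      if k = i then linSubst A (homogeneousComponent i p) else 0 := fun i =>
    homogeneousComponent_of_mem ((homogeneousComponent_isHomogeneous i p).linSubst A)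
  simp only [hc, Finset.sum_ite_eq, Finset.mem_range]
  split_ifs with h
  · rfl
  · rw [homogeneousComponent_eq_zero _ _ (by omega), map_zero]

theorem totalDegree_linSubst_le (A : Matrix (Fin n) (Fin n) ℂ) (p : MvPolynomial (Fin n) ℂ) :
    (linSubst A p).totalDegree ≤ p.totalDegree := by
  conv_lhs => rw [← sum_homogeneousComponent p]
  rw [map_sum]
  refine totalDegree_finsetSum_le fun i hi => ?_
  exact ((homogeneousComponent_isHomogeneous i p).linSubst A).totalDegree_le.trans
    (by simpa [Nat.lt_succ_iff] using hi)

theorem pderiv_linSubst (A : Matrix (Fin n) (Fin n) ℂ) (k : Fin n) (p : MvPolynomial (Fin n) ℂ) :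
    pderiv k (linSubst A p) = ∑ m, C (A m k) * linSubst A (pderiv m p) := by
  classical
  induction p using MvPolynomial.induction_on with
  | C a => simp [algHom_C]
  | add p q hp hq => simp [hp, hq, mul_add, Finset.sum_add_distrib]
  | mul_X p i hp =>
    have hX : pderiv k (linSubst A (X i)) = C (A i k) := by
      simp [linSubst_X, Derivation.leibniz, pderiv_X, Pi.single_apply]
    rw [map_mul, Derivation.leibniz, hp, hX]
    simp only [Derivation.leibniz, pderiv_X, map_add, smul_eq_mul, map_mul, mul_add,
      Finset.sum_add_distrib, Pi.single_apply, apply_ite (linSubst A), map_one, map_zero,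
      Finset.mul_sum]
    congr 1
    · simp [mul_comm]
    · exact Finset.sum_congr rfl fun m _ => by ring

/-- Linear substitution on homogeneous polynomials of degree `k`. -/
noncomputable def homogSubst (k : ℕ) (A : Matrix (Fin n) (Fin n) ℂ) :
    Module.End ℂ (homogeneousSubmodule (Fin n) ℂ k) :=
  (linSubst A).toLinearMap.restrict fun _ hp => IsHomogeneous.linSubst hp A

theorem coe_homogSubst (k : ℕ) (A : Matrix (Fin n) (Fin n) ℂ)
    (p : homogeneousSubmodule (Fin n) ℂ k) :
    (homogSubst k A p : MvPolynomial (Fin n) ℂ) = linSubst A p := rfl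

theorem homogSubst_mul (k : ℕ) (A B : Matrix (Fin n) (Fin n) ℂ) :
    homogSubst k (B * A) = homogSubst k A * homogSubst k B := by
  ext1 p
  exact Subtype.ext (linSubst_linSubst A B p).symm

theorem homogSubst_one (k : ℕ) : homogSubst k (1 : Matrix (Fin n) (Fin n) ℂ) = 1 := by
  ext1 p
  exact Subtype.ext (linSubst_one _)

instance (k : ℕ) : FiniteDimensional ℂ (homogeneousSubmodule (Fin n) ℂ k) :=
  Module.Finite.of_fg (homogeneousSubmodule_fg _ _ k)

theorem trace_homogSubst_diagonal (k : ℕ) (c : Fin n → ℂ) :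
    LinearMap.trace ℂ _ (homogSubst k (Matrix.diagonal c)) =
      PowerSeries.coeff k (∏ i, PowerSeries.mk fun m => c i ^ m) := by
  classical
  let s : Set (Fin n →₀ ℕ) := {d | d.degree = k}
  have : Fintype s := (Finsupp.finite_of_degree_eq k).fintype
  let b : Basis s ℂ (homogeneousSubmodule (Fin n) ℂ k) :=
    (basisRestrictSupport ℂ s).map
      (LinearEquiv.ofEq _ _ (homogeneousSubmodule_eq_finsupp_supported _ _ k).symm)
  have hb : ∀ d : s, (b d : MvPolynomial (Fin n) ℂ) = monomial d 1 := fun d => by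
    have hd : (monomial (d : Fin n →₀ ℕ) (1 : ℂ)) ∈ homogeneousSubmodule (Fin n) ℂ k :=
      isHomogeneous_monomial _ d.2
    suffices b d = ⟨monomial (d : Fin n →₀ ℕ) 1, hd⟩ by rw [this]
    rw [Basis.apply_eq_iff]
    ext e
    change coeff (e : Fin n →₀ ℕ) (monomial (d : Fin n →₀ ℕ) (1 : ℂ)) = _
    rw [coeff_monomial, Finsupp.single_apply]
    simp only [Subtype.ext_iff]
  have hmon : ∀ d : s, homogSubst k (Matrix.diagonal c) (b d) =
      (∏ i, c i ^ (d : Fin n →₀ ℕ) i) • b d := by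
    intro d
    apply Subtype.ext
    rw [coe_homogSubst, hb, Submodule.coe_smul, hb]
    rw [linSubst, aeval_monomial, Finsupp.prod_fintype _ _ (by simp), smul_monomial]
    have hsum : ∀ i, ∑ j, C (Matrix.diagonal c i j) * X j = C (c i) * X i := fun i => by
      rw [Finset.sum_eq_single i (fun j _ hj => by simp [Matrix.diagonal_apply_ne c hj.symm])
        (by simp), Matrix.diagonal_apply_eq]
    simp only [hsum, mul_pow, Finset.prod_mul_distrib, map_one, one_mul, smul_eq_mul, mul_one]
    rw [monomial_eq, Finsupp.prod_fintype _ _ (by simp)]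
    simp
  rw [LinearMap.trace_eq_matrix_trace ℂ b, Matrix.trace, PowerSeries.coeff_prod]
  simp only [Matrix.diag_apply, LinearMap.toMatrix_apply, hmon, map_smul, Basis.repr_self]
  simp only [Finsupp.smul_apply, Finsupp.single_eq_same, smul_eq_mul, mul_one,
    PowerSeries.coeff_mk]
  rw [← Finset.sum_coe_sort (Finset.finsuppAntidiag Finset.univ k)]
  refine Fintype.sum_equiv (Equiv.subtypeEquivRight fun d => ?_) _ _ fun d => rfl
  simp [s, Finset.mem_finsuppAntidiag, Finsupp.degree_eq_sum]

theorem trace_homogSubst_of_diagonalization (k : ℕ) {A P Q : Matrix (Fin n) (Fin n) ℂ}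
    {c : Fin n → ℂ} (hQP : Q * P = 1) (hA : A = P * Matrix.diagonal c * Q) :
    LinearMap.trace ℂ _ (homogSubst k A) =
      PowerSeries.coeff k (∏ i, PowerSeries.mk fun m => c i ^ m) := by
  rw [← trace_homogSubst_diagonal, hA, homogSubst_mul, homogSubst_mul, ← mul_assoc,
    LinearMap.trace_mul_cycle, ← homogSubst_mul, hQP, homogSubst_one, one_mul]

end LinearSubstitution

section Counting
open MvPolynomial

variable {n : ℕ} {G : Type*} [Group G] (M : G →* Matrix (Fin n) (Fin n) ℂ)

/-- The action of the group on homogeneous polynomials of degree `k`. -/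
noncomputable def homogRep (k : ℕ) :
    Representation ℂ G (homogeneousSubmodule (Fin n) ℂ k) where
  toFun g := homogSubst k (M g⁻¹)
  map_one' := by rw [inv_one, map_one, homogSubst_one]
  map_mul' g h := by rw [mul_inv_rev, map_mul, homogSubst_mul]

/-- Tuples `w` of homogeneous polynomials of degree `k` on which every group element `g` acts
through the matrix `D g`. -/
noncomputable def equivariantTuples {m : Type*} [Fintype m] [DecidableEq m]
    (D : G →* Matrix m m ℂ) (k : ℕ) :
    Submodule ℂ (m → homogeneousSubmodule (Fin n) ℂ k) where
  carrier := {w | ∀ g a, homogSubst k (M g⁻¹) (w a) = ∑ b, D g b a • w b}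
  add_mem' hv hw g a := by
    simp only [Pi.add_apply, map_add, hv g a, hw g a, smul_add, Finset.sum_add_distrib]
  zero_mem' g a := by simp
  smul_mem' r w hw g a := by
    simp only [Pi.smul_apply, map_smul, hw g a, Finset.smul_sum]
    exact Finset.sum_congr rfl fun b _ => smul_comm _ _ _

theorem mem_equivariantTuples {m : Type*} [Fintype m] [DecidableEq m]
    (D : G →* Matrix m m ℂ) (k : ℕ) (w : m → homogeneousSubmodule (Fin n) ℂ k) :
    w ∈ equivariantTuples M D k ↔
      ∀ g a, homogSubst k (M g⁻¹) (w a) = ∑ b, D g b a • w b := Iff.rfl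

theorem card_mul_finrank_equivariantTuples [Fintype G] {m : Type*} [Fintype m] [DecidableEq m]
    (D : G →* Matrix m m ℂ) (k : ℕ) :
    (Fintype.card G : ℂ) * finrank ℂ (equivariantTuples M D k) =
      ∑ g, (D g).trace * LinearMap.trace ℂ _ (homogSubst k (M g)) := by
  let τ : Representation ℂ G (m → ℂ) :=
    (Matrix.toLinAlgEquiv' : Matrix m m ℂ ≃ₐ[ℂ] _).toMonoidHom.comp D
  have hτ : ∀ g, τ g = Matrix.toLin' (D g) := fun g => rfl
  have hcard : (Fintype.card G : ℂ) ≠ 0 := by exact_mod_cast Fintype.card_ne_zero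
  have : Invertible (Nat.card G : ℂ) := invertibleOfNonzero (by simp)
  have h1 := Representation.card_inv_mul_sum_char_mul_char_eq_finrank τ (homogRep M k)
  have hsum : ∀ (T : (m → ℂ) →ₗ[ℂ] homogeneousSubmodule (Fin n) ℂ k) g a,
      T (τ g (Pi.single a 1)) = ∑ b, D g b a • T (Pi.single b 1) := by
    intro T g a
    rw [hτ, Matrix.toLin'_apply, Matrix.mulVec_single_one]
    conv_lhs => rw [← (Pi.basisFun ℂ m).sum_repr ((D g).col a)]
    simp
  let L : Representation.IntertwiningMap τ (homogRep M k) →ₗ[ℂ]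
      (m → homogeneousSubmodule (Fin n) ℂ k) :=
    { toFun := fun f a => f.toLinearMap (Pi.single a 1)
      map_add' := fun f g => rfl
      map_smul' := fun c f => rfl }
  have hL : Function.Injective L := by
    intro f g hfg
    have : f.toLinearMap = g.toLinearMap :=
      (Pi.basisFun ℂ m).ext fun a => by simpa [L] using congr_fun hfg a
    exact Representation.IntertwiningMap.ext_iff.mpr this
  have hrange : LinearMap.range L = equivariantTuples M D k := by
    ext w
    rw [mem_equivariantTuples]
    constructor
    · rintro ⟨f, rfl⟩ g a
      exact (Representation.IntertwiningMap.isIntertwining _ _ f g (Pi.single a 1)).symm.trans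
        (hsum f.toLinearMap g a)
    · intro hw
      let T := (Pi.basisFun ℂ m).constr ℂ w
      have hT : ∀ a, T (Pi.single a 1) = w a := fun a => by
        rw [← Pi.basisFun_apply, Basis.constr_basis]
      refine ⟨T.intertwiningMap_of_isIntertwiningMap τ (homogRep M k) fun g v => ?_, funext hT⟩
      refine DFunLike.congr_fun (f := T ∘ₗ τ g) (g := homogRep M k g ∘ₗ T) ?_ v
      refine (Pi.basisFun ℂ m).ext fun a => ?_
      rw [LinearMap.comp_apply, LinearMap.comp_apply, Pi.basisFun_apply, hsum, hT]
      simp only [hT]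
      exact (hw g a).symm
  rw [← hrange, LinearMap.finrank_range_of_inj hL, ← h1, Nat.card_eq_fintype_card,
    mul_inv_cancel_left₀ hcard]
  refine Fintype.sum_equiv (Equiv.inv G) _ _ fun g => ?_
  rw [mul_comm]
  simp [Representation.character, hτ, homogRep, Matrix.trace_toLin'_eq]

end Counting

section Chevalley
open MvPolynomial

variable {n : ℕ} {G : Type*} [Group G] (M : G →* Matrix (Fin n) (Fin n) ℂ)

theorem linSubst_map_mul (g h : G) (p : MvPolynomial (Fin n) ℂ) :
    linSubst (M (g * h)) p = linSubst (M h) (linSubst (M g) p) := by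
  rw [map_mul, linSubst_linSubst]

/-- The algebra of polynomial invariants of a matrix group. -/
noncomputable def polyInvariants : Subalgebra ℂ (MvPolynomial (Fin n) ℂ) where
  carrier := {p | ∀ g, linSubst (M g) p = p}
  mul_mem' hp hq g := by rw [map_mul, hp g, hq g]
  add_mem' hp hq g := by rw [map_add, hp g, hq g]
  algebraMap_mem' c g := by rw [AlgHom.commutes]

theorem homogeneousComponent_mem_polyInvariants {p : MvPolynomial (Fin n) ℂ}
    (hp : p ∈ polyInvariants M) (k : ℕ) : homogeneousComponent k p ∈ polyInvariants M := fun g => by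
  rw [← homogeneousComponent_linSubst, hp g]

/-- The ideal generated by the homogeneous invariants of positive degree. -/
noncomputable def hilbertIdeal : Ideal (MvPolynomial (Fin n) ℂ) :=
  Ideal.span {p | p ∈ polyInvariants M ∧ ∃ e, 0 < e ∧ p.IsHomogeneous e}

theorem linSubst_mem_hilbertIdeal {p : MvPolynomial (Fin n) ℂ} (hp : p ∈ hilbertIdeal M) (g : G) :
    linSubst (M g) p ∈ hilbertIdeal M := by
  suffices hilbertIdeal M ≤ (hilbertIdeal M).comap (linSubst (M g)) from this hp
  refine Ideal.span_le.mpr fun q hq => ?_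
  change linSubst (M g) q ∈ hilbertIdeal M
  rw [hq.1 g]
  exact Ideal.subset_span hq

theorem mem_hilbertIdeal_of_constantCoeff_eq_zero {p : MvPolynomial (Fin n) ℂ}
    (hp : p ∈ polyInvariants M) (h0 : constantCoeff p = 0) : p ∈ hilbertIdeal M := by
  rw [← sum_homogeneousComponent p]
  refine Ideal.sum_mem _ fun i _ => ?_
  rcases Nat.eq_zero_or_pos i with rfl | hi
  · rw [homogeneousComponent_zero, ← constantCoeff_eq, h0, C_0]
    exact Ideal.zero_mem _
  · exact Ideal.subset_span ⟨homogeneousComponent_mem_polyInvariants M hp i, i, hi,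
      homogeneousComponent_isHomogeneous i p⟩

theorem linSubst_sub_mem_of_closure {T : Set G} (hT : Subgroup.closure T = ⊤)
    {x : MvPolynomial (Fin n) ℂ} (hx : ∀ s ∈ T, linSubst (M s) x - x ∈ hilbertIdeal M) (g : G) :
    linSubst (M g) x - x ∈ hilbertIdeal M := by
  have hg : g ∈ Subgroup.closure T := hT ▸ Subgroup.mem_top g
  induction hg using Subgroup.closure_induction with
  | mem s hs => exact hx s hs
  | one => simp [linSubst_one]
  | mul g h _ _ hg hh =>
    have : linSubst (M (g * h)) x - x =
        linSubst (M h) (linSubst (M g) x - x) + (linSubst (M h) x - x) := by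
      rw [linSubst_map_mul, map_sub]; ring
    rw [this]
    exact Ideal.add_mem _ (linSubst_mem_hilbertIdeal M hg h) hh
  | inv g _ hg =>
    have : linSubst (M g⁻¹) x - x = -linSubst (M g⁻¹) (linSubst (M g) x - x) := by
      rw [map_sub, ← linSubst_map_mul, mul_inv_cancel, map_one, linSubst_one]; ring
    rw [this]
    exact neg_mem (linSubst_mem_hilbertIdeal M hg _)

variable [Fintype G]

/-- The average of a polynomial over the group. -/
noncomputable def polyAverage : MvPolynomial (Fin n) ℂ →ₗ[ℂ] MvPolynomial (Fin n) ℂ :=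
  (Fintype.card G : ℂ)⁻¹ • ∑ g, (linSubst (M g)).toLinearMap

theorem polyAverage_apply (p : MvPolynomial (Fin n) ℂ) :
    polyAverage M p = (Fintype.card G : ℂ)⁻¹ • ∑ g, linSubst (M g) p := by
  simp [polyAverage]

theorem polyAverage_mem (p : MvPolynomial (Fin n) ℂ) : polyAverage M p ∈ polyInvariants M := by
  intro g
  have hsum : ∑ h, linSubst (M g) (linSubst (M h) p) = ∑ h, linSubst (M h) p := by
    simp only [← linSubst_map_mul]
    exact Equiv.sum_comp (Equiv.mulRight g) fun h => linSubst (M h) p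
  rw [polyAverage_apply, map_smul, map_sum, hsum]

theorem polyAverage_mul {h : MvPolynomial (Fin n) ℂ} (hh : h ∈ polyInvariants M)
    (p : MvPolynomial (Fin n) ℂ) : polyAverage M (h * p) = h * polyAverage M p := by
  simp only [polyAverage_apply, map_mul, hh _, ← Finset.mul_sum, mul_smul_comm]

theorem polyAverage_eq_self {h : MvPolynomial (Fin n) ℂ} (hh : h ∈ polyInvariants M) :
    polyAverage M h = h := by
  have := polyAverage_mul M hh 1
  rw [mul_one] at this
  rw [this, polyAverage_apply]
  simp only [map_one, Finset.sum_const, Finset.card_univ]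
  rw [← Nat.cast_smul_eq_nsmul ℂ, smul_smul, inv_mul_cancel₀, one_smul, mul_one]
  exact_mod_cast Fintype.card_ne_zero

/-- `g` acts as a reflection on polynomials: `g p - p` is always divisible by one fixed linear
form. -/
def ActsAsReflection (A : Matrix (Fin n) (Fin n) ℂ) : Prop :=
  ∃ α : MvPolynomial (Fin n) ℂ, α ≠ 0 ∧ α.IsHomogeneous 1 ∧ ∀ p, α ∣ linSubst A p - p

theorem coeff_mul_of_coeff_eq_zero_of_degree_lt {σ R : Type*} [CommSemiring R]
    {h : MvPolynomial σ R} {μ : σ →₀ ℕ} (hh : ∀ ν, ν.degree < μ.degree → coeff ν h = 0)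
    (a : MvPolynomial σ R) : coeff μ (h * a) = coeff μ h * constantCoeff a := by
  classical
  rw [coeff_mul, Finset.sum_eq_single (μ, 0)]
  · rfl
  · rintro ⟨ν, ν'⟩ hν hne
    rw [Finset.HasAntidiagonal.mem_antidiagonal] at hν
    dsimp only at hν ⊢
    rw [hh ν, zero_mul]
    have hν' : ν' ≠ 0 := by
      rintro rfl
      rw [add_zero] at hν
      exact hne (by rw [hν])
    have : ν'.degree ≠ 0 := fun h => hν' ((Finsupp.degree_eq_zero_iff _).mp h)
    rw [← hν, map_add]
    omega
  · intro hn
    exact absurd (Finset.HasAntidiagonal.mem_antidiagonal.mpr (add_zero μ)) hn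

/-- Chevalley's lemma on relations with invariant coefficients. -/
theorem sum_coeff_mul_mem_hilbertIdeal {T : Set G} (hT : Subgroup.closure T = ⊤)
    (hrefl : ∀ s ∈ T, ActsAsReflection (M s)) {ι : Type*} [Fintype ι]
    {h : ι → MvPolynomial (Fin n) ℂ} (hh : ∀ i, h i ∈ polyInvariants M) (μ : Fin n →₀ ℕ)
    (hμ : ∀ i ν, ν.degree < μ.degree → coeff ν (h i) = 0)
    {q : ι → MvPolynomial (Fin n) ℂ} (hq : ∑ i, h i * q i = 0) :
    ∑ i, C (coeff μ (h i)) * q i ∈ hilbertIdeal M := by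
  suffices H : ∀ (D : ℕ) (q : ι → MvPolynomial (Fin n) ℂ),
      (∀ i, q i = 0 ∨ (q i).totalDegree < D) → ∑ i, h i * q i = 0 →
      ∑ i, C (coeff μ (h i)) * q i ∈ hilbertIdeal M from
    H (Finset.univ.sup (fun i => (q i).totalDegree) + 1) q
      (fun i => Or.inr (Nat.lt_succ_of_le
        (Finset.le_sup (f := fun i => (q i).totalDegree) (Finset.mem_univ i)))) hq
  intro D
  induction D with
  | zero =>
    intro q hqD _
    have : ∀ i, q i = 0 := fun i => (hqD i).resolve_right (Nat.not_lt_zero _)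
    simp [this]
  | succ D ih =>
    intro q hqD hq
    set x := ∑ i, C (coeff μ (h i)) * q i with hx
    have hgx : ∀ g, linSubst (M g) x = ∑ i, C (coeff μ (h i)) * linSubst (M g) (q i) := fun g => by
      simp only [hx, map_sum, map_mul, algHom_C, algebraMap_eq]
    have hinv : ∀ s ∈ T, linSubst (M s) x - x ∈ hilbertIdeal M := by
      intro s hs
      obtain ⟨α, hα0, hα1, hα⟩ := hrefl s hs
      choose q' hq' using fun i => hα (q i)
      have hsx : linSubst (M s) x - x = α * ∑ i, C (coeff μ (h i)) * q' i := by
        rw [hgx, hx, ← Finset.sum_sub_distrib, Finset.mul_sum]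
        refine Finset.sum_congr rfl fun i _ => ?_
        rw [← mul_sub, hq']; ring
      rw [hsx]
      refine Ideal.mul_mem_left _ _ (ih q' (fun i => ?_) ?_)
      · by_cases h0 : q' i = 0
        · exact Or.inl h0
        right
        have hdeg := congr_arg totalDegree (hq' i)
        rw [totalDegree_mul_of_isDomain hα0 h0, hα1.totalDegree hα0] at hdeg
        rcases hqD i with hqi | hqi
        · have hαq := hq' i
          rw [hqi, map_zero, sub_zero] at hαq
          exact absurd hαq.symm (mul_ne_zero hα0 h0)
        · have := (totalDegree_sub (linSubst (M s) (q i)) (q i)).trans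
            (max_le (totalDegree_linSubst_le (M s) (q i)) le_rfl)
          omega
      · refine (mul_eq_zero.mp (?_ : α * _ = 0)).resolve_left hα0
        rw [Finset.mul_sum]
        calc ∑ i, α * (h i * q' i) = linSubst (M s) (∑ i, h i * q i) - ∑ i, h i * q i := by
              rw [map_sum, ← Finset.sum_sub_distrib]
              refine Finset.sum_congr rfl fun i _ => ?_
              rw [map_mul, hh i s, ← mul_sub, hq']; ring
          _ = 0 := by rw [hq, map_zero, sub_zero]
    have hall := linSubst_sub_mem_of_closure M hT hinv
    have havg : polyAverage M x - x ∈ hilbertIdeal M := by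
      have : polyAverage M x - x =
          C ((Fintype.card G : ℂ)⁻¹) * ∑ g : G, (linSubst (M g) x - x) := by
        have hc : (Fintype.card G : ℂ) ≠ 0 := by exact_mod_cast Fintype.card_ne_zero
        rw [Finset.sum_sub_distrib, mul_sub, polyAverage_apply, ← smul_eq_C_mul, ← smul_eq_C_mul,
          Finset.sum_const, Finset.card_univ, ← Nat.cast_smul_eq_nsmul ℂ, smul_smul,
          inv_mul_cancel₀ hc, one_smul]
      rw [this]
      exact Ideal.mul_mem_left _ _ (Ideal.sum_mem _ fun g _ => hall g)
    have hax : polyAverage M x ∈ hilbertIdeal M := by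
      refine mem_hilbertIdeal_of_constantCoeff_eq_zero M (polyAverage_mem M x) ?_
      have hax' : polyAverage M x = ∑ i, C (coeff μ (h i)) * polyAverage M (q i) := by
        rw [hx, map_sum]
        refine Finset.sum_congr rfl fun i _ => ?_
        rw [← smul_eq_C_mul, map_smul, smul_eq_C_mul]
      have hrel : ∑ i, h i * polyAverage M (q i) = 0 := by
        simp only [← polyAverage_mul M (hh _), ← map_sum, hq, map_zero]
      have := congr_arg (coeff μ) hrel
      simp only [coeff_sum, coeff_zero,
        fun i => coeff_mul_of_coeff_eq_zero_of_degree_lt (hμ i) (polyAverage M (q i))] at this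
      rw [hax', map_sum]
      simpa using this
    have := Ideal.sub_mem _ hax havg
    rwa [sub_sub_cancel] at this

end Chevalley

section BasicInvariants
open MvPolynomial

variable {n : ℕ}

theorem actsAsReflection_one_add_vecMulVec (u v : Fin n → ℂ) (hv : v ≠ 0) :
    ActsAsReflection (1 + Matrix.vecMulVec u v) := by
  have hX : ∀ i, linSubst (1 + Matrix.vecMulVec u v) (X i) =
      X i + C (u i) * ∑ j, C (v j) * X j := by
    intro i
    simp [linSubst_X, Matrix.one_apply, Matrix.vecMulVec_apply, add_mul, Finset.sum_add_distrib,
      Finset.mul_sum, mul_assoc, apply_ite C]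
  refine ⟨∑ j, C (v j) * X j, fun h => hv (funext fun j => ?_),
    IsHomogeneous.sum _ _ _ fun j _ => isHomogeneous_C_mul_X _ _, fun p => ?_⟩
  · have := congr_arg (coeff (Finsupp.single j 1)) h
    simpa [coeff_sum, coeff_C_mul, coeff_X, Finsupp.single_left_inj] using this
  · induction p using MvPolynomial.induction_on with
    | C a => simp [algHom_C]
    | add p q hp hq =>
      rw [map_add, add_sub_add_comm]
      exact dvd_add hp hq
    | mul_X p i hp =>
      have : linSubst (1 + Matrix.vecMulVec u v) (p * X i) - p * X i =
          (linSubst (1 + Matrix.vecMulVec u v) p - p) * X i +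
          (∑ j, C (v j) * X j) * (linSubst (1 + Matrix.vecMulVec u v) p * C (u i)) := by
        rw [map_mul, hX]; ring
      rw [this]
      exact dvd_add (hp.mul_right _) (dvd_mul_right _ _)

variable {G : Type*} [Group G] (M : G →* Matrix (Fin n) (Fin n) ℂ)

/-- An irredundant family of homogeneous invariants generating the Hilbert ideal. -/
structure IsMinimalInvariantSystem {ι : Type*} (f : ι → MvPolynomial (Fin n) ℂ) (e : ι → ℕ) :
    Prop where
  mem : ∀ i, f i ∈ polyInvariants M
  pos : ∀ i, 0 < e i
  homog : ∀ i, (f i).IsHomogeneous (e i)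
  span : Ideal.span (Set.range f) = hilbertIdeal M
  notMem : ∀ i, f i ∉ Ideal.span (f '' {i}ᶜ)

theorem exists_isMinimalInvariantSystem :
    ∃ (t : Finset (MvPolynomial (Fin n) ℂ)) (e : t → ℕ),
      IsMinimalInvariantSystem M (fun p : t => (p : MvPolynomial (Fin n) ℂ)) e := by
  classical
  let s : Set (MvPolynomial (Fin n) ℂ) :=
    {p | p ∈ polyInvariants M ∧ ∃ e, 0 < e ∧ p.IsHomogeneous e}
  have hfg : (Submodule.span (MvPolynomial (Fin n) ℂ) s).FG := IsNoetherian.noetherian _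
  rw [Submodule.fg_span_iff_fg_span_finset_subset] at hfg
  obtain ⟨t, ⟨hts, hspan⟩, hmin⟩ := exists_minimal_of_wellFoundedLT
    (fun t : Finset (MvPolynomial (Fin n) ℂ) =>
      (t : Set _) ⊆ s ∧ Submodule.span (MvPolynomial (Fin n) ℂ) s = Submodule.span _ t) hfg
  choose e he using fun p : t => (hts p.2).2
  refine ⟨t, e, fun p => (hts p.2).1, fun p => (he p).1, fun p => (he p).2, ?_, fun p hp => ?_⟩
  · rw [Subtype.range_coe_subtype]
    exact hspan.symm
  · have himg : (fun q : t => (q : MvPolynomial (Fin n) ℂ)) '' {p}ᶜ =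
        ((t.erase p : Finset _) : Set (MvPolynomial (Fin n) ℂ)) := by
      ext q
      constructor
      · rintro ⟨q, hq, rfl⟩
        exact Finset.mem_coe.mpr (Finset.mem_erase.mpr ⟨fun h => hq (Subtype.ext h), q.2⟩)
      · intro hq
        obtain ⟨hqp, hq⟩ := Finset.mem_erase.mp (Finset.mem_coe.mp hq)
        exact ⟨⟨q, hq⟩, fun h => hqp (congr_arg Subtype.val h), rfl⟩
    rw [himg] at hp
    have hle := hmin (y := t.erase p) ⟨fun q hq => hts (Finset.mem_of_mem_erase hq), ?_⟩
      (Finset.erase_subset _ _)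
    · exact Finset.notMem_erase _ _ (hle p.2)
    · rw [hspan]
      refine le_antisymm (Submodule.span_le.mpr fun q hq => ?_)
        (Submodule.span_mono (by simp))
      by_cases hqp : q = p
      · rw [hqp]; exact hp
      · exact Submodule.subset_span (Finset.mem_coe.mpr (Finset.mem_erase.mpr ⟨hqp, hq⟩))

namespace IsMinimalInvariantSystem

variable {M} {ι : Type*} [Fintype ι] {f : ι → MvPolynomial (Fin n) ℂ} {e : ι → ℕ}

theorem mem_adjoin_of_isHomogeneous [Fintype G] (hf : IsMinimalInvariantSystem M f e) (k : ℕ)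
    {p : MvPolynomial (Fin n) ℂ} (hp : p ∈ polyInvariants M) (hk : p.IsHomogeneous k) :
    p ∈ Algebra.adjoin ℂ (Set.range f) := by
  induction k using Nat.strong_induction_on generalizing p with
  | _ k ih =>
  rcases Nat.eq_zero_or_pos k with rfl | hkpos
  · rw [← totalDegree_zero_iff_isHomogeneous, totalDegree_eq_zero_iff_eq_C] at hk
    rw [hk]
    exact Subalgebra.algebraMap_mem _ _
  have hpI : p ∈ Ideal.span (Set.range f) := by
    rw [hf.span]
    exact Ideal.subset_span ⟨hp, k, hkpos, hk⟩
  obtain ⟨a, ha⟩ := Ideal.mem_span_range_iff_exists_fun.mp hpI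
  have hsum : p = ∑ i, polyAverage M (a i) * f i := by
    rw [← polyAverage_eq_self M hp, ← ha, map_sum]
    refine Finset.sum_congr rfl fun i _ => ?_
    rw [mul_comm, polyAverage_mul M (hf.mem i), mul_comm]
  have hcomp : p = ∑ i, homogeneousComponent k (polyAverage M (a i) * f i) := by
    rw [← map_sum, ← hsum, homogeneousComponent_of_mem hk, if_pos rfl]
  rw [hcomp]
  refine Subalgebra.sum_mem _ fun i _ => ?_
  rw [homogeneousComponent_mul_of_isHomogeneous (hf.homog i)]
  split_ifs with hle
  · refine Subalgebra.mul_mem _ (ih (k - e i) (by have := hf.pos i; omega) ?_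
      (homogeneousComponent_isHomogeneous _ _)) (Algebra.subset_adjoin ⟨i, rfl⟩)
    exact homogeneousComponent_mem_polyInvariants M (polyAverage_mem M _) _
  · exact Subalgebra.zero_mem _

theorem adjoin_eq [Fintype G] (hf : IsMinimalInvariantSystem M f e) :
    Algebra.adjoin ℂ (Set.range f) = polyInvariants M := by
  refine le_antisymm (Algebra.adjoin_le ?_) fun p hp => ?_
  · rintro _ ⟨i, rfl⟩
    exact hf.mem i
  · rw [← sum_homogeneousComponent p]
    exact Subalgebra.sum_mem _ fun i _ => hf.mem_adjoin_of_isHomogeneous i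
      (homogeneousComponent_mem_polyInvariants M hp i) (homogeneousComponent_isHomogeneous i p)

/-- A polynomial relation between the gradients of invariants stays one under the group. -/
theorem sum_linSubst_mul_pderiv (hf : ∀ i, f i ∈ polyInvariants M)
    {a : ι → MvPolynomial (Fin n) ℂ} (ha : ∀ k, ∑ i, a i * pderiv k (f i) = 0) (g : G) (k : Fin n) :
    ∑ i, linSubst (M g) (a i) * pderiv k (f i) = 0 := by
  have hd : ∀ i, pderiv k (f i) = ∑ m, C (M g m k) * linSubst (M g) (pderiv m (f i)) := fun i => by
    rw [← pderiv_linSubst, hf i g]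
  simp only [hd, Finset.mul_sum]
  rw [Finset.sum_comm]
  refine Finset.sum_eq_zero fun m _ => ?_
  have := congr_arg (fun x => C (M g m k) * linSubst (M g) x) (ha m)
  simp only [map_sum, map_mul, map_zero, mul_zero, Finset.mul_sum] at this
  rw [← this]
  exact Finset.sum_congr rfl fun i _ => by ring

theorem exists_invariant_relation [Fintype G] (hf : ∀ i, f i ∈ polyInvariants M)
    {a : ι → MvPolynomial (Fin n) ℂ} (ha : ∀ k, ∑ i, a i * pderiv k (f i) = 0) (ha0 : a ≠ 0) :
    ∃ h : ι → MvPolynomial (Fin n) ℂ, (∀ i, h i ∈ polyInvariants M) ∧ h ≠ 0 ∧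
      ∀ k, ∑ i, h i * pderiv k (f i) = 0 := by
  classical
  obtain ⟨j, hj⟩ := Function.ne_iff.mp ha0
  let c := ∏ g ∈ Finset.univ.erase (1 : G), linSubst (M g) (a j)
  have hc : c * a j = ∏ g, linSubst (M g) (a j) := by
    rw [← Finset.prod_erase_mul _ _ (Finset.mem_univ (1 : G)), map_one, linSubst_one]
  have hinj : ∀ (g : G) p, linSubst (M g) p = 0 → p = 0 := fun g p hp => by
    have := linSubst_map_mul M g g⁻¹ p
    rwa [mul_inv_cancel, map_one, linSubst_one, hp, map_zero] at this
  have hcinv : c * a j ∈ polyInvariants M := by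
    intro g
    rw [hc, map_prod]
    simp only [← linSubst_map_mul]
    exact Equiv.prod_comp (Equiv.mulRight g) fun h => linSubst (M h) (a j)
  refine ⟨fun i => polyAverage M (c * a i), fun i => polyAverage_mem M _, fun h => ?_, fun k => ?_⟩
  · have hprod : ∏ g, linSubst (M g) (a j) = 0 := by
      rw [← hc, ← polyAverage_eq_self M hcinv]
      exact congr_fun h j
    obtain ⟨g, -, hg⟩ := Finset.prod_eq_zero_iff.mp hprod
    exact hj (hinj g _ hg)
  · have hca : ∀ k, ∑ i, (c * a i) * pderiv k (f i) = 0 := fun k => by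
      simp only [mul_assoc, ← Finset.mul_sum, ha, mul_zero]
    simp only [polyAverage_apply, smul_mul_assoc, Finset.sum_mul]
    rw [← Finset.smul_sum, Finset.sum_comm]
    simp only [sum_linSubst_mul_pderiv hf hca, Finset.sum_const_zero, smul_zero]

theorem eq_zero_of_sum_mul_pderiv_eq_zero [Fintype G] (hf : IsMinimalInvariantSystem M f e)
    {T : Set G} (hT : Subgroup.closure T = ⊤) (hrefl : ∀ s ∈ T, ActsAsReflection (M s))
    {a : ι → MvPolynomial (Fin n) ℂ} (ha : ∀ k, ∑ i, a i * pderiv k (f i) = 0) : a = 0 := by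
  classical
  by_contra ha0
  obtain ⟨h, hinv, h0, hrel⟩ := exists_invariant_relation hf.mem ha ha0
  have hex : ∃ D : ℕ, ∃ i ν, Finsupp.degree ν = D ∧ coeff ν (h i) ≠ 0 := by
    obtain ⟨i, hi⟩ := Function.ne_iff.mp h0
    obtain ⟨ν, hν⟩ := ne_zero_iff.mp hi
    exact ⟨_, i, ν, rfl, hν⟩
  obtain ⟨j, μ, hμD, hμ⟩ := Nat.find_spec hex
  have hlow : ∀ i ν, ν.degree < μ.degree → coeff ν (h i) = 0 := fun i ν hν => by
    by_contra hne
    exact Nat.find_min hex (hμD ▸ hν) ⟨i, ν, rfl, hne⟩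
  have hI : ∀ k, ∃ b : ι → MvPolynomial (Fin n) ℂ,
      ∑ i, b i * f i = ∑ i, C (coeff μ (h i)) * pderiv k (f i) := fun k => by
    have := sum_coeff_mul_mem_hilbertIdeal M hT hrefl hinv μ hlow (hrel k)
    rw [← hf.span] at this
    exact Ideal.mem_span_range_iff_exists_fun.mp this
  choose b hb using hI
  have heuler : ∑ i, C (coeff μ (h i) * e i) * f i = ∑ i, (∑ k, X k * b k i) * f i := by
    have h1 : ∀ i, C (coeff μ (h i) * e i) * f i =
        ∑ k, X k * (C (coeff μ (h i)) * pderiv k (f i)) := fun i => by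
      have := (hf.homog i).sum_X_mul_pderiv
      rw [C_mul, mul_assoc]
      calc _ = C (coeff μ (h i)) * (e i • f i) := by rw [nsmul_eq_mul]; simp
        _ = _ := by
          rw [← this, Finset.mul_sum]
          exact Finset.sum_congr rfl fun k _ => by ring
    simp only [h1, Finset.sum_mul]
    rw [Finset.sum_comm, Finset.sum_comm (γ := ι)]
    refine Finset.sum_congr rfl fun k _ => ?_
    simp only [mul_assoc, ← Finset.mul_sum, hb]
  have hcomp := congr_arg (homogeneousComponent (e j)) heuler
  rw [map_sum, map_sum, ← Finset.add_sum_erase _ _ (Finset.mem_univ j),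
    ← Finset.add_sum_erase _ _ (Finset.mem_univ j)] at hcomp
  have hmemK : ∀ q : ι → MvPolynomial (Fin n) ℂ,
      ∑ i ∈ Finset.univ.erase j, homogeneousComponent (e j) (q i * f i) ∈
        Ideal.span (f '' {j}ᶜ) := fun q => by
    refine Ideal.sum_mem _ fun i hi => ?_
    rw [homogeneousComponent_mul_of_isHomogeneous (hf.homog i)]
    split_ifs
    · exact Ideal.mul_mem_left _ _ (Ideal.subset_span ⟨i, by simpa using hi, rfl⟩)
    · exact Ideal.zero_mem _
  have hleft : homogeneousComponent (e j) (C (coeff μ (h j) * e j) * f j) =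
      C (coeff μ (h j) * e j) * f j := by
    rw [homogeneousComponent_C_mul, homogeneousComponent_of_mem (hf.homog j), if_pos rfl]
  have hright : homogeneousComponent (e j) ((∑ k, X k * b k j) * f j) = 0 := by
    rw [homogeneousComponent_mul_of_isHomogeneous (hf.homog j), if_pos le_rfl, Nat.sub_self,
      homogeneousComponent_zero, ← constantCoeff_eq]
    simp
  rw [hleft, hright, zero_add] at hcomp
  have hne : coeff μ (h j) * (e j : ℂ) ≠ 0 :=
    mul_ne_zero hμ (by exact_mod_cast (hf.pos j).ne')
  refine hf.notMem j ?_
  have hmem : C (coeff μ (h j) * (e j : ℂ)) * f j ∈ Ideal.span (f '' {j}ᶜ) := by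
    rw [eq_sub_of_add_eq hcomp]
    exact Ideal.sub_mem _ (hmemK _) (hmemK _)
  have := Ideal.mul_mem_left _ (C (coeff μ (h j) * (e j : ℂ))⁻¹) hmem
  rwa [← mul_assoc, ← C_mul, inv_mul_cancel₀ hne, C_1, one_mul] at this

end IsMinimalInvariantSystem

theorem MvPolynomial.pderiv_aeval {ι σ R : Type*} [Fintype ι] [CommRing R]
    (f : ι → MvPolynomial σ R) (P : MvPolynomial ι R) (k : σ) :
    pderiv k (aeval f P) = ∑ i, aeval f (pderiv i P) * pderiv k (f i) := by
  classical
  induction P using MvPolynomial.induction_on with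
  | C a => simp
  | add p q hp hq => simp only [map_add, hp, hq, add_mul, Finset.sum_add_distrib]
  | mul_X p i hp =>
    simp only [map_mul, aeval_X, Derivation.leibniz, hp, pderiv_X, smul_eq_mul, map_add, add_mul,
      Finset.sum_add_distrib, Finset.mul_sum, Pi.single_apply, apply_ite (aeval f), map_one,
      map_zero]
    congr 1
    · simp
    · exact Finset.sum_congr rfl fun j _ => by ring

/-- The Jacobian criterion for algebraic independence in characteristic zero. -/
theorem MvPolynomial.algebraicIndependent_of_pderiv {ι σ : Type*} [Fintype ι]
    {f : ι → MvPolynomial σ ℂ}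
    (hf : ∀ a : ι → MvPolynomial σ ℂ, (∀ k, ∑ i, a i * pderiv k (f i) = 0) → a = 0) :
    AlgebraicIndependent ℂ f := by
  rw [algebraicIndependent_iff]
  suffices H : ∀ (D : ℕ) (P : MvPolynomial ι ℂ), (∀ ν, D ≤ Finsupp.degree ν → coeff ν P = 0) →
      aeval f P = 0 → P = 0 by
    refine fun P hP => H (P.totalDegree + 1) P (fun ν hν => ?_) hP
    refine coeff_eq_zero_of_totalDegree_lt ?_
    rw [Finsupp.degree_apply] at hν
    omega
  intro D
  induction D with
  | zero =>
    exact fun P hP _ => MvPolynomial.ext _ _ fun ν => by rw [hP ν (Nat.zero_le _), coeff_zero]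
  | succ D ih =>
    intro P hP hPf
    have hd : ∀ i, pderiv i P = 0 := by
      intro i
      refine ih _ (fun ν hν => ?_) (congr_fun (hf (fun i => aeval f (pderiv i P)) fun k => ?_) i)
      · rw [coeff_pderiv, hP _ (by simpa using hν), zero_mul]
      · rw [← pderiv_aeval, hPf, map_zero]
    have hC : P = C (coeff 0 P) := by
      classical
      ext ν
      rw [coeff_C]
      split_ifs with h
      · rw [h]
      · obtain ⟨i, hi⟩ := Finsupp.ne_iff.mp (Ne.symm h)
        have := congr_arg (coeff (ν - Finsupp.single i 1)) (hd i)
        have hle : Finsupp.single i 1 ≤ ν := by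
          rw [Finsupp.single_le_iff]; exact Nat.pos_of_ne_zero hi
        rw [coeff_pderiv, tsub_add_cancel_of_le hle, coeff_zero] at this
        exact (mul_eq_zero.mp this).resolve_right (Nat.cast_add_one_ne_zero _)
    rw [hC, aeval_C, algebraMap_eq, C_eq_zero] at hPf
    rw [hC, hPf, C_0]

end BasicInvariants

section HilbertSeries
open MvPolynomial

/-- The power series `1 + T ^ d + T ^ (2 d) + ⋯`. -/
noncomputable def powGeomSeries (d : ℕ) : PowerSeries ℂ :=
  PowerSeries.mk fun m => if d ∣ m then 1 else 0

theorem one_sub_X_pow_mul_powGeomSeries {d : ℕ} (hd : 0 < d) :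
    (1 - PowerSeries.X ^ d) * powGeomSeries d = 1 := by
  ext m
  rw [sub_mul, one_mul, map_sub, PowerSeries.coeff_X_pow_mul', PowerSeries.coeff_one]
  simp only [powGeomSeries, PowerSeries.coeff_mk]
  rcases Nat.eq_zero_or_pos m with rfl | hm
  · simp [hd.ne']
  · rw [if_neg hm.ne']
    by_cases hdm : d ≤ m
    · have hiff : d ∣ m - d ↔ d ∣ m := (Nat.dvd_sub_iff_left hdm dvd_rfl)
      simp only [if_pos hdm, hiff, sub_self]
    · rw [if_neg hdm, if_neg fun h => hdm (Nat.le_of_dvd hm h), sub_zero]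

theorem coeff_prod_powGeomSeries {ι : Type*} [Fintype ι] {e : ι → ℕ} (he : ∀ i, 0 < e i) (k : ℕ) :
    PowerSeries.coeff k (∏ i, powGeomSeries (e i)) =
      Nat.card {ν : ι →₀ ℕ | Finsupp.weight e ν = k} := by
  classical
  rw [PowerSeries.coeff_prod]
  simp only [powGeomSeries, PowerSeries.coeff_mk, Finset.prod_boole, Finset.mem_univ, true_imp_iff]
  rw [Finset.sum_boole]
  congr 1
  rw [← Nat.card_eq_finsetCard]
  have hw : ∀ ν : ι →₀ ℕ, Finsupp.weight e ν = ∑ i, ν i * e i := fun ν => by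
    rw [Finsupp.weight_apply, Finsupp.sum_fintype _ _ (by simp)]
    simp
  have hmem : ∀ ν : {ν : ι →₀ ℕ | Finsupp.weight e ν = k},
      Finsupp.equivFunOnFinite.symm (fun i => ν.1 i * e i) ∈
        (Finset.univ.finsuppAntidiag k).filter fun l => ∀ i, e i ∣ l i := fun ν => by
    have := ν.2
    rw [Set.mem_ofPred_eq, hw] at this
    simp [Finset.mem_finsuppAntidiag, this]
  refine (Nat.card_congr (Equiv.ofBijective (fun ν => ⟨_, hmem ν⟩) ⟨?_, ?_⟩)).symm
  · rintro ν ν' h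
    refine Subtype.ext (Finsupp.ext fun i => ?_)
    have := DFunLike.congr_fun (congr_arg Subtype.val h) i
    exact Nat.eq_of_mul_eq_mul_right (he i) this
  · rintro ⟨l, hl⟩
    simp only [Finset.mem_filter, Finset.mem_finsuppAntidiag] at hl
    refine ⟨⟨Finsupp.equivFunOnFinite.symm fun i => l i / e i, ?_⟩,
      Subtype.ext (Finsupp.ext fun i => Nat.div_mul_cancel (hl.2 i))⟩
    rw [Set.mem_ofPred_eq, hw, ← hl.1.1]
    exact Finset.sum_congr rfl fun i _ => Nat.div_mul_cancel (hl.2 i)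

theorem homogeneousComponent_aeval {σ ι : Type*} [Fintype ι] {f : ι → MvPolynomial σ ℂ} {e : ι → ℕ}
    (hf : ∀ i, (f i).IsHomogeneous (e i)) (k : ℕ) (P : MvPolynomial ι ℂ) :
    homogeneousComponent k (aeval f P) = aeval f (weightedHomogeneousComponent e k P) := by
  induction P using MvPolynomial.induction_on' with
  | add p q hp hq => simp only [map_add, hp, hq]
  | monomial ν c =>
    have h1 : (aeval f (monomial ν c)).IsHomogeneous (Finsupp.weight e ν) := by
      rw [aeval_monomial, Finsupp.prod_fintype _ _ (by simp), Finsupp.weight_apply,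
        Finsupp.sum_fintype _ _ (by simp), algebraMap_eq]
      refine IsHomogeneous.C_mul (IsHomogeneous.prod _ _ _ fun i _ => ?_) c
      simpa [mul_comm] using (hf i).pow (ν i)
    rw [homogeneousComponent_of_mem h1, weightedHomogeneousComponent_of_mem
      (isWeightedHomogeneous_monomial e ν c rfl)]
    split_ifs <;> simp

variable {n : ℕ} {G : Type*} [Group G] (M : G →* Matrix (Fin n) (Fin n) ℂ)

/-- The homogeneous invariants of degree `k`. -/
noncomputable def homogInvariants (k : ℕ) : Submodule ℂ (MvPolynomial (Fin n) ℂ) :=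
  (polyInvariants M).toSubmodule ⊓ homogeneousSubmodule (Fin n) ℂ k

theorem mem_homogInvariants {k : ℕ} {p : MvPolynomial (Fin n) ℂ} :
    p ∈ homogInvariants M k ↔ p ∈ polyInvariants M ∧ p.IsHomogeneous k := Iff.rfl

instance (k : ℕ) : FiniteDimensional ℂ (homogInvariants M k) :=
  Submodule.finiteDimensional_of_le (inf_le_right : _ ≤ homogeneousSubmodule (Fin n) ℂ k)

variable {M} in
theorem finrank_homogInvariants [Fintype G] {ι : Type*} [Fintype ι]
    {f : ι → MvPolynomial (Fin n) ℂ} {e : ι → ℕ} (hf : IsMinimalInvariantSystem M f e)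
    (halg : AlgebraicIndependent ℂ f) (k : ℕ) :
    (finrank ℂ (homogInvariants M k) : ℂ) = PowerSeries.coeff k (∏ i, powGeomSeries (e i)) := by
  have hmap : homogInvariants M k =
      (weightedHomogeneousSubmodule ℂ e k).map (aeval f).toLinearMap := by
    ext p
    rw [mem_homogInvariants, ← hf.adjoin_eq, Algebra.adjoin_range_eq_range_aeval]
    constructor
    · rintro ⟨⟨P, rfl⟩, hk⟩
      refine ⟨weightedHomogeneousComponent e k P, weightedHomogeneousComponent_mem e P k, ?_⟩
      exact (homogeneousComponent_aeval hf.homog k P).symm.trans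
        ((homogeneousComponent_of_mem hk).trans (if_pos rfl))
    · rintro ⟨P, hP, rfl⟩
      refine ⟨⟨P, rfl⟩, ?_⟩
      have := homogeneousComponent_aeval hf.homog k P
      rw [weightedHomogeneousComponent_of_mem hP, if_pos rfl] at this
      change IsHomogeneous (aeval f P) k
      rw [← this]
      exact homogeneousComponent_isHomogeneous _ _
  rw [coeff_prod_powGeomSeries hf.pos, hmap,
    ← (Submodule.equivMapOfInjective (aeval f).toLinearMap halg _).finrank_eq,
    weightedHomogeneousSubmodule_eq_finsupp_supported,
    ← finrank_eq_nat_card_basis (basisRestrictSupport ℂ {ν | Finsupp.weight e ν = k})]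
  rfl

end HilbertSeries

section Solomon
open MvPolynomial

variable {n : ℕ} {G : Type*} [Group G] (M : G →* Matrix (Fin n) (Fin n) ℂ)

/-- The possible invariant cofactors, in degree `k`, of a homogeneous polynomial of degree `s`. -/
noncomputable def shiftedInvariants (k s : ℕ) : Submodule ℂ (MvPolynomial (Fin n) ℂ) :=
  if s ≤ k then homogInvariants M (k - s) else ⊥

theorem shiftedInvariants_of_le {k s : ℕ} (h : s ≤ k) :
    shiftedInvariants M k s = homogInvariants M (k - s) := if_pos h

theorem shiftedInvariants_of_not_le {k s : ℕ} (h : ¬ s ≤ k) :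
    shiftedInvariants M k s = ⊥ := if_neg h

instance (k s : ℕ) : FiniteDimensional ℂ (shiftedInvariants M k s) := by
  by_cases h : s ≤ k
  · rw [shiftedInvariants_of_le M h]; infer_instance
  · rw [shiftedInvariants_of_not_le M h]; infer_instance

theorem finrank_shiftedInvariants {H : PowerSeries ℂ}
    (hH : ∀ k, (finrank ℂ (homogInvariants M k) : ℂ) = PowerSeries.coeff k H) (k s : ℕ) :
    (finrank ℂ (shiftedInvariants M k s) : ℂ) = PowerSeries.coeff k (PowerSeries.X ^ s * H) := by
  rw [PowerSeries.coeff_X_pow_mul']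
  by_cases h : s ≤ k
  · rw [shiftedInvariants_of_le M h, if_pos h, hH]
  · rw [shiftedInvariants_of_not_le M h, if_neg h, finrank_bot, Nat.cast_zero]

theorem mul_isHomogeneous_of_mem_shiftedInvariants {k s : ℕ} {b q : MvPolynomial (Fin n) ℂ}
    (hb : b ∈ shiftedInvariants M k s) (hq : q.IsHomogeneous s) : (b * q).IsHomogeneous k := by
  rw [shiftedInvariants] at hb
  split_ifs at hb with h
  · simpa [Nat.sub_add_cancel h] using hb.2.mul hq
  · rw [(Submodule.mem_bot ℂ).mp hb, zero_mul]
    exact isHomogeneous_zero _ _ _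

theorem mem_polyInvariants_of_mem_shiftedInvariants {k s : ℕ} {b : MvPolynomial (Fin n) ℂ}
    (hb : b ∈ shiftedInvariants M k s) : b ∈ polyInvariants M := by
  rw [shiftedInvariants] at hb
  split_ifs at hb
  · exact hb.1
  · rw [(Submodule.mem_bot ℂ).mp hb]
    exact Subalgebra.zero_mem _

variable {m : Type*} [Fintype m]

theorem exists_submodule_invariant_combinations {H : PowerSeries ℂ}
    (hH : ∀ k, (finrank ℂ (homogInvariants M k) : ℂ) = PowerSeries.coeff k H)
    {N : Matrix m m (MvPolynomial (Fin n) ℂ)} {s : m → ℕ}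
    (hs : ∀ I a, (N I a).IsHomogeneous (s I)) (hN : ∀ b, Matrix.vecMul b N = 0 → b = 0) (k : ℕ) :
    ∃ U : Submodule ℂ (m → homogeneousSubmodule (Fin n) ℂ k),
      (∀ w, w ∈ U ↔ ∃ b : m → MvPolynomial (Fin n) ℂ, (∀ I, b I ∈ shiftedInvariants M k (s I)) ∧
        ∀ a, (w a : MvPolynomial (Fin n) ℂ) = ∑ I, b I * N I a) ∧
      (finrank ℂ U : ℂ) = ∑ I, PowerSeries.coeff k (PowerSeries.X ^ s I * H) := by
  let Φ : (∀ I, shiftedInvariants M k (s I)) →ₗ[ℂ] (m → homogeneousSubmodule (Fin n) ℂ k) :=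
    { toFun := fun b a => ⟨∑ I, (b I : MvPolynomial (Fin n) ℂ) * N I a,
        IsHomogeneous.sum _ _ _ fun I _ =>
          mul_isHomogeneous_of_mem_shiftedInvariants M (b I).2 (hs I a)⟩
      map_add' := fun b c => by
        ext1 a
        apply Subtype.ext
        simp [add_mul, Finset.sum_add_distrib]
      map_smul' := fun r b => by
        ext1 a
        apply Subtype.ext
        simp [Finset.smul_sum] }
  have hΦ : Function.Injective Φ := by
    rw [← LinearMap.ker_eq_bot, LinearMap.ker_eq_bot']
    intro b hb
    have := hN (fun I => b I) (funext fun a => congr_arg Subtype.val (congr_fun hb a))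
    exact funext fun I => Subtype.ext (congr_fun this I)
  refine ⟨LinearMap.range Φ, fun w => ⟨?_, ?_⟩, ?_⟩
  · rintro ⟨b, rfl⟩
    exact ⟨fun I => b I, fun I => (b I).2, fun a => rfl⟩
  · rintro ⟨b, hb, hw⟩
    exact ⟨fun I => ⟨b I, hb I⟩, funext fun a => Subtype.ext (hw a).symm⟩
  · rw [LinearMap.finrank_range_of_inj hΦ, Module.finrank_pi_fintype, Nat.cast_sum]
    exact Finset.sum_congr rfl fun I _ => finrank_shiftedInvariants M hH k _

theorem linSubst_combination {A : Matrix m m ℂ} {N : Matrix m m (MvPolynomial (Fin n) ℂ)}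
    {g : G} (hN : ∀ I a, linSubst (M g⁻¹) (N I a) = ∑ b, C (A b a) * N I b)
    {b : m → MvPolynomial (Fin n) ℂ} (hb : ∀ I, b I ∈ polyInvariants M) (a : m) :
    linSubst (M g⁻¹) (∑ I, b I * N I a) = ∑ c, C (A c a) * ∑ I, b I * N I c := by
  simp only [map_sum, map_mul, hb _ _, hN, Finset.mul_sum]
  rw [Finset.sum_comm]
  exact Finset.sum_congr rfl fun c _ => Finset.sum_congr rfl fun I _ => by ring

variable [DecidableEq m]

theorem mem_equivariantTuples_iff_linSubst (D : G →* Matrix m m ℂ) (k : ℕ)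
    (w : m → homogeneousSubmodule (Fin n) ℂ k) :
    w ∈ equivariantTuples M D k ↔ ∀ g a, linSubst (M g⁻¹) (w a) =
      ∑ b, C (D g b a) * (w b : MvPolynomial (Fin n) ℂ) := by
  rw [mem_equivariantTuples]
  refine forall₂_congr fun g a => ?_
  rw [Subtype.ext_iff, coe_homogSubst]
  simp [smul_eq_C_mul]

theorem mem_equivariantTuples_of_combination {D : G →* Matrix m m ℂ}
    {N : Matrix m m (MvPolynomial (Fin n) ℂ)}
    (hN : ∀ g I a, linSubst (M g⁻¹) (N I a) = ∑ b, C (D g b a) * N I b) {s : m → ℕ} {k : ℕ}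
    {w : m → homogeneousSubmodule (Fin n) ℂ k} {b : m → MvPolynomial (Fin n) ℂ}
    (hb : ∀ I, b I ∈ shiftedInvariants M k (s I))
    (hw : ∀ a, (w a : MvPolynomial (Fin n) ℂ) = ∑ I, b I * N I a) :
    w ∈ equivariantTuples M D k := by
  rw [mem_equivariantTuples_iff_linSubst]
  intro g a
  simp only [hw]
  exact linSubst_combination M (hN g)
    (fun I => mem_polyInvariants_of_mem_shiftedInvariants M (hb I)) a

/-- If the equivariant tuples are exactly the combinations with invariant coefficients of the rows
of `N`, their Hilbert series is the expected one. -/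
theorem finrank_equivariantTuples_of_generated {H : PowerSeries ℂ}
    (hH : ∀ k, (finrank ℂ (homogInvariants M k) : ℂ) = PowerSeries.coeff k H)
    {D : G →* Matrix m m ℂ} {N : Matrix m m (MvPolynomial (Fin n) ℂ)} {s : m → ℕ}
    (hs : ∀ I a, (N I a).IsHomogeneous (s I)) (hN : ∀ b, Matrix.vecMul b N = 0 → b = 0)
    (hND : ∀ g I a, linSubst (M g⁻¹) (N I a) = ∑ b, C (D g b a) * N I b)
    (hgen : ∀ w : m → MvPolynomial (Fin n) ℂ,
      (∀ g a, linSubst (M g⁻¹) (w a) = ∑ b, C (D g b a) * w b) →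
      ∃ b : m → MvPolynomial (Fin n) ℂ, (∀ I, b I ∈ polyInvariants M) ∧
        ∀ a, w a = ∑ I, b I * N I a) (k : ℕ) :
    (finrank ℂ (equivariantTuples M D k) : ℂ) =
      ∑ I, PowerSeries.coeff k (PowerSeries.X ^ s I * H) := by
  obtain ⟨U, hU, hUdim⟩ := exists_submodule_invariant_combinations M hH hs hN k
  suffices equivariantTuples M D k = U by rw [this, hUdim]
  ext w
  rw [hU]
  constructor
  · intro hw
    rw [mem_equivariantTuples_iff_linSubst] at hw
    obtain ⟨b, hb, hwb⟩ := hgen (fun a => w a) hw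
    refine ⟨fun I => if s I ≤ k then homogeneousComponent (k - s I) (b I) else 0,
      fun I => ?_, fun a => ?_⟩
    · rw [shiftedInvariants]
      dsimp only
      split_ifs
      · exact ⟨homogeneousComponent_mem_polyInvariants M (hb I) _,
          homogeneousComponent_isHomogeneous _ _⟩
      · exact Submodule.zero_mem _
    · have hwk := homogeneousComponent_of_mem (m := k) (w a).2
      rw [if_pos rfl, hwb a, map_sum] at hwk
      rw [hwb a, ← hwk]
      refine Finset.sum_congr rfl fun I _ => ?_
      rw [homogeneousComponent_mul_of_isHomogeneous (hs I a), ite_mul, zero_mul]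
  · rintro ⟨b, hb, hwb⟩
    exact mem_equivariantTuples_of_combination M hND hb hwb

/-- The determinant character as a one-dimensional matrix representation. -/
noncomputable def detRep : G →* Matrix Unit Unit ℂ :=
  (Matrix.scalar Unit : ℂ →+* Matrix Unit Unit ℂ).toMonoidHom.comp (Matrix.detMonoidHom.comp M)

theorem detRep_apply (g : G) (a b : Unit) : detRep M g a b = (M g).det := by
  simp [detRep]

theorem trace_detRep (g : G) : (detRep M g).trace = (M g).det := by
  simp [Matrix.trace, detRep_apply]

/-- Determinantal semi-invariants are multiples of a semi-invariant `Δ` as soon as the dimensions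
of their homogeneous parts are the expected ones. -/
theorem exists_eq_mul_of_semiInvariant {H : PowerSeries ℂ}
    (hH : ∀ k, (finrank ℂ (homogInvariants M k) : ℂ) = PowerSeries.coeff k H)
    {Δ : MvPolynomial (Fin n) ℂ} {δ : ℕ} (hΔ0 : Δ ≠ 0) (hΔ : Δ.IsHomogeneous δ)
    (hΔM : ∀ g, linSubst (M g⁻¹) Δ = C (M g).det * Δ)
    (hdim : ∀ k, (finrank ℂ (equivariantTuples M (detRep M) k) : ℂ) =
      PowerSeries.coeff k (PowerSeries.X ^ δ * H))
    {p : MvPolynomial (Fin n) ℂ} (hp : ∀ g, linSubst (M g⁻¹) p = C (M g).det * p) :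
    ∃ b ∈ polyInvariants M, p = b * Δ := by
  have hhom : ∀ k (q : MvPolynomial (Fin n) ℂ), q.IsHomogeneous k →
      (∀ g, linSubst (M g⁻¹) q = C (M g).det * q) → ∃ b ∈ polyInvariants M, q = b * Δ := by
    intro k q hqk hq
    obtain ⟨U, hU, hUdim⟩ := exists_submodule_invariant_combinations M hH
      (N := fun _ _ : Unit => Δ) (s := fun _ => δ) (fun _ _ => hΔ)
      (fun b hb => funext fun a => by
        have := congr_fun hb a
        simpa [Matrix.vecMul, dotProduct, hΔ0] using this) k
    have hle : U ≤ equivariantTuples M (detRep M) k := fun w hw => by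
      obtain ⟨b, hb, hwb⟩ := (hU w).mp hw
      exact mem_equivariantTuples_of_combination M (N := fun _ _ : Unit => Δ)
        (fun g I a => by simp [hΔM, detRep_apply]) hb hwb
    have hfin : finrank ℂ U = finrank ℂ (equivariantTuples M (detRep M) k) := by
      have : (finrank ℂ U : ℂ) = finrank ℂ (equivariantTuples M (detRep M) k) := by
        rw [hUdim, hdim]
        simp
      exact_mod_cast this
    have heq := Submodule.eq_of_le_of_finrank_eq hle hfin
    have hmem : (fun _ : Unit => (⟨q, hqk⟩ : homogeneousSubmodule (Fin n) ℂ k)) ∈ U := by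
      rw [heq, mem_equivariantTuples_iff_linSubst]
      intro g a
      simp [hq, detRep_apply]
    obtain ⟨b, hb, hqb⟩ := (hU _).mp hmem
    exact ⟨b (), mem_polyInvariants_of_mem_shiftedInvariants M (hb ()), by simpa using hqb ()⟩
  have hcomp : ∀ k, ∃ b ∈ polyInvariants M, homogeneousComponent k p = b * Δ := fun k =>
    hhom k _ (homogeneousComponent_isHomogeneous k p) fun g => by
      rw [← homogeneousComponent_linSubst, hp, homogeneousComponent_C_mul]
  choose b hb hpb using hcomp
  refine ⟨∑ i ∈ Finset.range (p.totalDegree + 1), b i, Subalgebra.sum_mem _ fun i _ => hb i, ?_⟩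
  rw [Finset.sum_mul, ← Finset.sum_congr rfl fun i _ => hpb i, sum_homogeneousComponent]

end Solomon

section SolomonForms
open MvPolynomial Set.powersetCard

theorem Matrix.isHomogeneous_det {σ ι : Type*} [Fintype ι] [DecidableEq ι]
    {A : Matrix ι ι (MvPolynomial σ ℂ)} {t : ι → ℕ} (hA : ∀ i j, (A i j).IsHomogeneous (t i)) :
    A.det.IsHomogeneous (∑ i, t i) := by
  rw [Matrix.det_apply]
  refine IsHomogeneous.sum _ _ _ fun σ _ => ?_
  have h := IsHomogeneous.prod Finset.univ (fun i => A (σ i) i) (fun i => t (σ i))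
    fun i _ => hA _ _
  rw [Equiv.sum_comp σ t] at h
  rcases Int.units_eq_one_or (Equiv.Perm.sign σ) with hσ | hσ
  · rwa [hσ, one_smul]
  · rw [hσ, Units.neg_smul, one_smul]
    exact h.neg

variable {n : ℕ}

theorem isHomogeneous_compoundMatrix {σ : Type*} {J : Matrix (Fin n) (Fin n) (MvPolynomial σ ℂ)}
    {t : Fin n → ℕ} (hJ : ∀ i j, (J i j).IsHomogeneous (t i)) (p : ℕ)
    (I A : Set.powersetCard (Fin n) p) :
    (compoundMatrix p J I A).IsHomogeneous (∑ i ∈ (I : Finset (Fin n)), t i) := by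
  have h := Finset.sum_map Finset.univ
    ((I : Finset (Fin n)).orderEmbOfFin (card_eq I)).toEmbedding t
  rw [Finset.map_orderEmbOfFin_univ] at h
  rw [h]
  exact Matrix.isHomogeneous_det fun i j => hJ _ _

variable {G : Type*} [Group G] (M : G →* Matrix (Fin n) (Fin n) ℂ)

/-- The exterior power of a matrix representation. -/
def compoundRep (p : ℕ) :
    G →* Matrix (Set.powersetCard (Fin n) p) (Set.powersetCard (Fin n) p) ℂ where
  toFun g := compoundMatrix p (M g)
  map_one' := by rw [map_one, compoundMatrix_one]
  map_mul' g h := by rw [map_mul, compoundMatrix_mul]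

theorem linSubst_compoundMatrix {J : Matrix (Fin n) (Fin n) (MvPolynomial (Fin n) ℂ)} {g : G}
    (hJ : J.map (linSubst (M g⁻¹)) = J * (M g).map C) (p : ℕ) :
    (compoundMatrix p J).map (linSubst (M g⁻¹)) =
      compoundMatrix p J * (compoundRep M p g).map C := by
  rw [← AlgHom.coe_toRingHom, ← compoundMatrix_map, AlgHom.coe_toRingHom, hJ, compoundMatrix_mul,
    compoundMatrix_map]
  rfl

theorem linSubst_det {J : Matrix (Fin n) (Fin n) (MvPolynomial (Fin n) ℂ)} {g : G}
    (hJ : J.map (linSubst (M g⁻¹)) = J * (M g).map C) :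
    linSubst (M g⁻¹) J.det = C (M g).det * J.det := by
  have h1 : linSubst (M g⁻¹) J.det = (J.map (linSubst (M g⁻¹))).det :=
    RingHom.map_det (linSubst (M g⁻¹)).toRingHom J
  have h2 : (C (M g).det : MvPolynomial (Fin n) ℂ) = ((M g).map C).det := RingHom.map_det C (M g)
  rw [h1, hJ, Matrix.det_mul, h2, mul_comm]

/-- Solomon's theorem: equivariant tuples for the exterior powers are combinations of the minors
of `J` with invariant coefficients. -/
theorem exists_eq_vecMul_compoundMatrix {J : Matrix (Fin n) (Fin n) (MvPolynomial (Fin n) ℂ)}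
    (hJ : ∀ g, J.map (linSubst (M g⁻¹)) = J * (M g).map C) (hdet : J.det ≠ 0)
    (hsemi : ∀ q : MvPolynomial (Fin n) ℂ, (∀ g, linSubst (M g⁻¹) q = C (M g).det * q) →
      ∃ b ∈ polyInvariants M, q = b * J.det) (p : ℕ)
    {w : Set.powersetCard (Fin n) p → MvPolynomial (Fin n) ℂ}
    (hw : ∀ g, linSubst (M g⁻¹) ∘ w = Matrix.vecMul w ((compoundRep M p g).map C)) :
    ∃ b : Set.powersetCard (Fin n) p → MvPolynomial (Fin n) ℂ,
      (∀ I, b I ∈ polyInvariants M) ∧ w = Matrix.vecMul b (compoundMatrix p J) := by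
  obtain ⟨K, hK, hK'⟩ := exists_compoundMatrix_mul_eq_det p J hdet
  have hdetg := fun g => linSubst_det M (hJ g)
  have hKg : ∀ g, (compoundRep M p g).map C * K.map (linSubst (M g⁻¹)) =
      (C (M g).det : MvPolynomial (Fin n) ℂ) • K := by
    intro g
    have h1 : (compoundMatrix p J).map (linSubst (M g⁻¹)) * K.map (linSubst (M g⁻¹)) =
        (C (M g).det * J.det : MvPolynomial (Fin n) ℂ) • 1 := by
      have := congr_arg (fun A => A.map (linSubst (M g⁻¹))) hK
      rw [Matrix.map_mul] at this
      rw [this, ← hdetg]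
      ext i j
      by_cases h : i = j <;> simp [h]
    rw [linSubst_compoundMatrix M (hJ g), Matrix.mul_assoc] at h1
    have h2 := congr_arg (fun A => K * A) h1
    simp only [← Matrix.mul_assoc, hK', Matrix.smul_mul, Matrix.one_mul, Matrix.mul_smul,
      Matrix.mul_one, mul_comm (C (M g).det), mul_smul] at h2
    exact smul_right_injective _ hdet h2
  have hc : ∀ I g, linSubst (M g⁻¹) (Matrix.vecMul w K I) = C (M g).det * Matrix.vecMul w K I := by
    intro I g
    have h1 : linSubst (M g⁻¹) (Matrix.vecMul w K I) =
        Matrix.vecMul (linSubst (M g⁻¹) ∘ w) (K.map (linSubst (M g⁻¹))) I := by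
      simp [Matrix.vecMul, dotProduct]
    rw [h1, hw, Matrix.vecMul_vecMul, hKg, Matrix.vecMul_smul]
    rfl
  choose b hb hwb using fun I => hsemi _ (hc I)
  refine ⟨b, hb, ?_⟩
  have h1 : Matrix.vecMul (Matrix.vecMul w K) (compoundMatrix p J) = J.det • w := by
    rw [Matrix.vecMul_vecMul, hK', Matrix.vecMul_smul, Matrix.vecMul_one]
  have h2 : Matrix.vecMul w K = J.det • b := funext fun I => by
    rw [hwb, Pi.smul_apply, smul_eq_mul, mul_comm]
  rw [h2, Matrix.smul_vecMul] at h1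
  exact (smul_right_injective _ hdet h1).symm

theorem finrank_equivariantTuples_compoundRep {H : PowerSeries ℂ}
    (hH : ∀ k, (finrank ℂ (homogInvariants M k) : ℂ) = PowerSeries.coeff k H)
    {J : Matrix (Fin n) (Fin n) (MvPolynomial (Fin n) ℂ)} {t : Fin n → ℕ}
    (ht : ∀ i j, (J i j).IsHomogeneous (t i))
    (hJ : ∀ g, J.map (linSubst (M g⁻¹)) = J * (M g).map C) (hdet : J.det ≠ 0)
    (hdim : ∀ k, (finrank ℂ (equivariantTuples M (detRep M) k) : ℂ) =
      PowerSeries.coeff k (PowerSeries.X ^ (∑ i, t i) * H)) (p k : ℕ) :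
    (finrank ℂ (equivariantTuples M (compoundRep M p) k) : ℂ) =
      ∑ I : Set.powersetCard (Fin n) p,
        PowerSeries.coeff k (PowerSeries.X ^ (∑ i ∈ (I : Finset (Fin n)), t i) * H) := by
  have hdetg := fun g => linSubst_det M (hJ g)
  refine finrank_equivariantTuples_of_generated M hH (N := compoundMatrix p J)
    (isHomogeneous_compoundMatrix ht p) (fun b hb => ?_) (fun g I a => ?_) (fun w hw => ?_) k
  · obtain ⟨K, hK, -⟩ := exists_compoundMatrix_mul_eq_det p J hdet
    have h1 : Matrix.vecMul (Matrix.vecMul b (compoundMatrix p J)) K = J.det • b := by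
      rw [Matrix.vecMul_vecMul, hK, Matrix.vecMul_smul, Matrix.vecMul_one]
    rw [hb, Matrix.zero_vecMul] at h1
    exact (smul_eq_zero.mp h1.symm).resolve_left hdet
  · have := congr_fun (congr_fun (linSubst_compoundMatrix M (hJ g) p) I) a
    simpa [Matrix.mul_apply, mul_comm] using this
  · obtain ⟨b, hb, hwb⟩ := exists_eq_vecMul_compoundMatrix M hJ hdet
      (fun q hq => exists_eq_mul_of_semiInvariant M hH hdet (Matrix.isHomogeneous_det ht) hdetg
        hdim hq) p (w := w) fun g => funext fun a => by
          simpa [Matrix.vecMul, dotProduct, mul_comm] using hw g a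
    exact ⟨b, hb, fun a => congr_fun hwb a⟩

end SolomonForms

section RationalFunctions

variable {ι : Type*} [Fintype ι] [DecidableEq ι]

/-- An identity between sums of fractions of polynomials, with denominators cleared. -/
noncomputable def clearedIdentity (a q : ι → Polynomial ℂ) (b c : Polynomial ℂ) : Polynomial ℂ :=
  c * ∑ i, a i * ∏ j ∈ Finset.univ.erase i, q j - b * ∏ j, q j

theorem sum_div_eq_iff_eval_clearedIdentity {a q : ι → Polynomial ℂ} {b c : Polynomial ℂ} {t : ℂ}
    (hq : ∀ i, (q i).eval t ≠ 0) (hc : c.eval t ≠ 0) :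
    ∑ i, (a i).eval t * ((q i).eval t)⁻¹ = b.eval t * (c.eval t)⁻¹ ↔
      (clearedIdentity a q b c).eval t = 0 := by
  have hprod : ∏ j, (q j).eval t ≠ 0 := Finset.prod_ne_zero_iff.mpr fun j _ => hq j
  have h : ∀ i, ∏ j ∈ Finset.univ.erase i, (q j).eval t = (∏ j, (q j).eval t) * ((q i).eval t)⁻¹ :=
    fun i => by
      rw [← Finset.mul_prod_erase _ _ (Finset.mem_univ i), mul_comm ((q i).eval t),
        mul_inv_cancel_right₀ (hq i)]
  have hexp : (clearedIdentity a q b c).eval t =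
      c.eval t * (∏ j, (q j).eval t) *
        (∑ i, (a i).eval t * ((q i).eval t)⁻¹ - b.eval t * (c.eval t)⁻¹) := by
    simp only [clearedIdentity, Polynomial.eval_sub, Polynomial.eval_mul,
      Polynomial.eval_finsetSum, Polynomial.eval_prod, h, mul_sub, Finset.mul_sum]
    congr 1
    · exact Finset.sum_congr rfl fun i _ => by ring
    · field_simp
  rw [hexp, mul_eq_zero, or_iff_right (mul_ne_zero hc hprod), sub_eq_zero]

theorem sum_mul_eq_iff_clearedIdentity {a q : ι → Polynomial ℂ} {b c : Polynomial ℂ}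
    {u : ι → PowerSeries ℂ} {v : PowerSeries ℂ} (hu : ∀ i, (q i : PowerSeries ℂ) * u i = 1)
    (hv : (c : PowerSeries ℂ) * v = 1) :
    ∑ i, (a i : PowerSeries ℂ) * u i = b * v ↔ clearedIdentity a q b c = 0 := by
  have hprod : ∏ j, (q j : PowerSeries ℂ) ≠ 0 :=
    Finset.prod_ne_zero_iff.mpr fun j _ => left_ne_zero_of_mul_eq_one (hu j)
  have h : ∀ i, ∏ j ∈ Finset.univ.erase i, (q j : PowerSeries ℂ) =
      (∏ j, (q j : PowerSeries ℂ)) * u i := fun i => by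
    rw [← Finset.mul_prod_erase _ _ (Finset.mem_univ i), mul_right_comm, hu, one_mul]
  have hexp : (clearedIdentity a q b c : PowerSeries ℂ) =
      c * (∏ j, (q j : PowerSeries ℂ)) *
        (∑ i, (a i : PowerSeries ℂ) * u i - b * v) := by
    have hsum : ((∑ i, a i * ∏ j ∈ Finset.univ.erase i, q j : Polynomial ℂ) : PowerSeries ℂ) =
        ∑ i, (a i : PowerSeries ℂ) * ∏ j ∈ Finset.univ.erase i, (q j : PowerSeries ℂ) := by
      simp only [← Polynomial.coeToPowerSeries.ringHom_apply, map_sum, map_mul, map_prod]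
    have hpr : ((∏ j, q j : Polynomial ℂ) : PowerSeries ℂ) = ∏ j, (q j : PowerSeries ℂ) := by
      simp only [← Polynomial.coeToPowerSeries.ringHom_apply, map_prod]
    rw [clearedIdentity, Polynomial.coe_sub, Polynomial.coe_mul, Polynomial.coe_mul, hsum, hpr]
    simp only [h, mul_sub, Finset.mul_sum]
    congr 1
    · exact Finset.sum_congr rfl fun i _ => by ring
    · linear_combination -(b * ∏ j, (q j : PowerSeries ℂ)) * hv
  rw [← Polynomial.coe_eq_zero_iff, hexp, mul_eq_zero,
    or_iff_right (mul_ne_zero (left_ne_zero_of_mul_eq_one hv) hprod), sub_eq_zero]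

/-- An identity between fractions of polynomials which holds at almost all points holds between
their expansions as power series. -/
theorem sum_mul_eq_of_sum_div_eq {a q : ι → Polynomial ℂ} {b c : Polynomial ℂ}
    {u : ι → PowerSeries ℂ} {v : PowerSeries ℂ} (hu : ∀ i, (q i : PowerSeries ℂ) * u i = 1)
    (hv : (c : PowerSeries ℂ) * v = 1)
    (h : ∀ t : ℂ, t ≠ 0 → (∀ i, (q i).eval t ≠ 0) → c.eval t ≠ 0 →
      ∑ i, (a i).eval t * ((q i).eval t)⁻¹ = b.eval t * (c.eval t)⁻¹) :
    ∑ i, (a i : PowerSeries ℂ) * u i = b * v := by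
  rw [sum_mul_eq_iff_clearedIdentity hu hv]
  have hq : ∀ i, q i ≠ 0 := fun i h0 => by simpa [h0] using hu i
  have hc : c ≠ 0 := fun h0 => by simp [h0] at hv
  have hne : Polynomial.X * c * ∏ i, q i ≠ 0 :=
    mul_ne_zero (mul_ne_zero Polynomial.X_ne_zero hc) (Finset.prod_ne_zero_iff.mpr fun i _ => hq i)
  refine (mul_eq_zero.mp (Polynomial.funext fun t => ?_)).resolve_left hne
  rw [Polynomial.eval_mul, Polynomial.eval_zero, mul_eq_zero, or_iff_not_imp_left]
  intro ht
  simp only [Polynomial.eval_mul, Polynomial.eval_X, Polynomial.eval_prod, mul_eq_zero,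
    Finset.prod_eq_zero_iff, Finset.mem_univ, true_and, not_or, not_exists] at ht
  exact (sum_div_eq_iff_eval_clearedIdentity ht.2 ht.1.2).mp (h t ht.1.1 ht.2 ht.1.2)

theorem sum_div_eq_of_sum_mul_eq {a q : ι → Polynomial ℂ} {b c : Polynomial ℂ}
    {u : ι → PowerSeries ℂ} {v : PowerSeries ℂ} (hu : ∀ i, (q i : PowerSeries ℂ) * u i = 1)
    (hv : (c : PowerSeries ℂ) * v = 1) (h : ∑ i, (a i : PowerSeries ℂ) * u i = b * v) {t : ℂ}
    (hq : ∀ i, (q i).eval t ≠ 0) (hc : c.eval t ≠ 0) :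
    ∑ i, (a i).eval t * ((q i).eval t)⁻¹ = b.eval t * (c.eval t)⁻¹ := by
  rw [sum_div_eq_iff_eval_clearedIdentity hq hc, (sum_mul_eq_iff_clearedIdentity hu hv).mp h,
    Polynomial.eval_zero]

end RationalFunctions

section Eigenvalues
open Set.powersetCard

variable {n : ℕ}

/-- The tuple `c` lists the eigenvalues of the diagonalizable matrix `A`. -/
def IsEigenvalueTuple (A : Matrix (Fin n) (Fin n) ℂ) (c : Fin n → ℂ) : Prop :=
  ∃ P Q, P * Q = 1 ∧ Q * P = 1 ∧ A = P * Matrix.diagonal c * Q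

variable {A : Matrix (Fin n) (Fin n) ℂ} {c : Fin n → ℂ}

namespace IsEigenvalueTuple

theorem det_eq (h : IsEigenvalueTuple A c) : A.det = ∏ i, c i := by
  obtain ⟨P, Q, hPQ, hQP, rfl⟩ := h
  rw [Matrix.det_mul_comm, ← Matrix.mul_assoc, hQP, Matrix.one_mul, Matrix.det_diagonal]

theorem one_sub_smul (h : IsEigenvalueTuple A c) (t : ℂ) :
    IsEigenvalueTuple (1 - t • A) fun i => 1 - t * c i := by
  obtain ⟨P, Q, hPQ, hQP, rfl⟩ := h
  refine ⟨P, Q, hPQ, hQP, ?_⟩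
  have : Matrix.diagonal (fun i => 1 - t * c i) = 1 - t • Matrix.diagonal c := by
    ext i j
    by_cases h : i = j <;> simp [h, Matrix.diagonal]
  rw [this, Matrix.mul_sub, Matrix.sub_mul, Matrix.mul_one, hPQ]
  simp

theorem ne_zero (h : IsEigenvalueTuple A c) (hA : IsUnit A) (i : Fin n) : c i ≠ 0 := by
  rw [Matrix.isUnit_iff_isUnit_det, h.det_eq, isUnit_iff_ne_zero, Finset.prod_ne_zero_iff] at hA
  exact hA i (Finset.mem_univ i)

theorem of_mul_eq_one (h : IsEigenvalueTuple A c) {B : Matrix (Fin n) (Fin n) ℂ}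
    (hAB : A * B = 1) : IsEigenvalueTuple B fun i => (c i)⁻¹ := by
  have hc := h.ne_zero (.of_mul_eq_one B hAB)
  obtain ⟨P, Q, hPQ, hQP, rfl⟩ := h
  refine ⟨P, Q, hPQ, hQP, ?_⟩
  refine (left_inv_eq_right_inv ?_ hAB).symm
  have hd : Matrix.diagonal (fun i => (c i)⁻¹) * Matrix.diagonal c = 1 := by
    rw [Matrix.diagonal_mul_diagonal]
    simp [hc]
  calc P * Matrix.diagonal (fun i => (c i)⁻¹) * Q * (P * Matrix.diagonal c * Q)
      = P * (Matrix.diagonal (fun i => (c i)⁻¹) * ((Q * P) * Matrix.diagonal c)) * Q := by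
        simp only [Matrix.mul_assoc]
    _ = 1 := by rw [hQP, Matrix.one_mul, hd, Matrix.mul_one, hPQ]

theorem trace_homogSubst (h : IsEigenvalueTuple A c) (k : ℕ) :
    LinearMap.trace ℂ _ (homogSubst k A) =
      PowerSeries.coeff k (∏ i, PowerSeries.mk fun m => c i ^ m) := by
  obtain ⟨P, Q, -, hQP, hA⟩ := h
  exact trace_homogSubst_of_diagonalization k hQP hA

theorem trace_compoundMatrix (h : IsEigenvalueTuple A c) (p : ℕ) :
    (compoundMatrix p A).trace =
      ∑ I : Set.powersetCard (Fin n) p, ∏ i ∈ (I : Finset (Fin n)), c i := by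
  obtain ⟨P, Q, hPQ, hQP, rfl⟩ := h
  rw [compoundMatrix_mul, Matrix.trace_mul_comm, compoundMatrix_mul, ← Matrix.mul_assoc,
    ← compoundMatrix_mul, hQP, compoundMatrix_one, Matrix.one_mul, Matrix.trace]
  exact Finset.sum_congr rfl fun I _ => compoundMatrix_diagonal_apply p c I

theorem rank_eq (h : IsEigenvalueTuple A c) : A.rank = Fintype.card {i // c i ≠ 0} := by
  obtain ⟨P, Q, hPQ, hQP, rfl⟩ := h
  rw [Matrix.rank_mul_eq_left_of_isUnit_det _ _
      ((Matrix.isUnit_iff_isUnit_det _).mp (.of_mul_eq_one P hQP)),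
    Matrix.rank_mul_eq_right_of_isUnit_det _ _
      ((Matrix.isUnit_iff_isUnit_det _).mp (.of_mul_eq_one Q hPQ)), Matrix.rank_diagonal]

theorem eq_one (h : IsEigenvalueTuple A c) (hc : ∀ i, c i = 1) : A = 1 := by
  obtain ⟨P, Q, hPQ, hQP, rfl⟩ := h
  rw [funext hc, Matrix.diagonal_one, Matrix.mul_one, hPQ]

end IsEigenvalueTuple

theorem exists_isEigenvalueTuple_of_pow_eq_one {k : ℕ} (hk : k ≠ 0) (hA : A ^ k = 1) :
    ∃ c, IsEigenvalueTuple A c := by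
  obtain ⟨P, Q, c, h⟩ := exists_diagonalization_of_pow_eq_one A k hk hA
  exact ⟨c, P, Q, h⟩

end Eigenvalues

section DegreeMultiset

theorem mem_of_prod_one_sub_X_pow_eq {s t : Multiset ℕ} {m : ℕ} (hm : m ∈ s) (hm0 : 0 < m)
    (ht : ∀ x ∈ t, 0 < x) (hmax : ∀ x ∈ t, x ≤ m)
    (h : (s.map fun x => (1 - Polynomial.X ^ x : Polynomial ℂ)).prod =
      (t.map fun x => (1 - Polynomial.X ^ x : Polynomial ℂ)).prod) : m ∈ t := by
  have hζ := Complex.isPrimitiveRoot_exp m hm0.ne'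
  have heval := congr_arg (Polynomial.eval (Complex.exp (2 * Real.pi * Complex.I / m))) h
  simp only [Polynomial.eval_multiset_prod, Multiset.map_map] at heval
  rw [Multiset.prod_eq_zero (Multiset.mem_map.mpr ⟨m, hm, by simp [hζ.pow_eq_one]⟩), eq_comm,
    Multiset.prod_eq_zero_iff, Multiset.mem_map] at heval
  obtain ⟨x, hx, hx0⟩ := heval
  have hdvd : m ∣ x := hζ.dvd_of_pow_eq_one x (by
    simpa [sub_eq_zero, eq_comm (a := (1 : ℂ))] using hx0)
  rwa [Nat.le_antisymm (Nat.le_of_dvd (ht x hx) hdvd) (hmax x hx)]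

theorem eq_of_prod_one_sub_X_pow_eq {s t : Multiset ℕ} (hs : ∀ x ∈ s, 0 < x) (ht : ∀ x ∈ t, 0 < x)
    (h : (s.map fun x => (1 - Polynomial.X ^ x : Polynomial ℂ)).prod =
      (t.map fun x => (1 - Polynomial.X ^ x : Polynomial ℂ)).prod) : s = t := by
  induction hN : s.card generalizing s t with
  | zero =>
    rw [Multiset.card_eq_zero] at hN
    subst hN
    refine (Multiset.eq_zero_of_forall_notMem fun x hx => ?_).symm
    obtain ⟨m, hm, hmax⟩ := t.toFinset.exists_max_image id ⟨x, Multiset.mem_toFinset.mpr hx⟩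
    simp only [Multiset.mem_toFinset, id] at hm hmax
    exact Multiset.notMem_zero _
      (mem_of_prod_one_sub_X_pow_eq hm (ht m hm) (by simp) (by simp) h.symm)
  | succ N ih =>
    have hne : (s + t).toFinset.Nonempty := by
      obtain ⟨x, hx⟩ := Multiset.card_pos_iff_exists_mem.mp (by omega : 0 < s.card)
      exact ⟨x, by simp [hx]⟩
    obtain ⟨m, hm, hmax⟩ := (s + t).toFinset.exists_max_image id hne
    simp only [Multiset.mem_toFinset, Multiset.mem_add, id] at hm hmax
    have hms : m ∈ s := hm.elim id fun hmt => mem_of_prod_one_sub_X_pow_eq hmt (ht m hmt) hs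
      (fun x hx => hmax x (.inl hx)) h.symm
    have hmt : m ∈ t := hm.elim (fun hms => mem_of_prod_one_sub_X_pow_eq hms (hs m hms) ht
      (fun x hx => hmax x (.inr hx)) h) id
    obtain ⟨s, rfl⟩ := Multiset.exists_cons_of_mem hms
    obtain ⟨t, rfl⟩ := Multiset.exists_cons_of_mem hmt
    rw [Multiset.map_cons, Multiset.map_cons, Multiset.prod_cons, Multiset.prod_cons] at h
    have hne : (1 - Polynomial.X ^ m : Polynomial ℂ) ≠ 0 := fun h0 => by
      have := congr_arg (Polynomial.eval 0) h0
      simp [(hs m hms).ne'] at this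
    rw [ih (fun x hx => hs x (Multiset.mem_cons_of_mem hx))
      (fun x hx => ht x (Multiset.mem_cons_of_mem hx)) (mul_left_cancel₀ hne h) (by simpa using hN)]

theorem prod_one_sub_X_pow_mul_prod_powGeomSeries {ι : Type*} [Fintype ι] {d : ι → ℕ}
    (hd : ∀ i, 0 < d i) :
    ((∏ i, (1 - Polynomial.X ^ d i) : Polynomial ℂ) : PowerSeries ℂ) *
      ∏ i, powGeomSeries (d i) = 1 := by
  rw [← Polynomial.coeToPowerSeries.ringHom_apply, map_prod, ← Finset.prod_mul_distrib]
  refine Finset.prod_eq_one fun i _ => ?_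
  rw [Polynomial.coeToPowerSeries.ringHom_apply, Polynomial.coe_sub, Polynomial.coe_pow,
    Polynomial.coe_one, Polynomial.coe_X, one_sub_X_pow_mul_powGeomSeries (hd i)]

theorem exists_equiv_of_prod_powGeomSeries_eq {ι κ : Type*} [Fintype ι] [Fintype κ] {e : ι → ℕ}
    {d : κ → ℕ} (he : ∀ i, 0 < e i) (hd : ∀ j, 0 < d j)
    (h : ∏ i, powGeomSeries (e i) = ∏ j, powGeomSeries (d j)) :
    ∃ σ : κ ≃ ι, ∀ j, e (σ j) = d j := by
  classical
  have hpoly : ∏ i, (1 - Polynomial.X ^ e i : Polynomial ℂ) = ∏ j, (1 - Polynomial.X ^ d j) := by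
    apply Polynomial.coe_injective ℂ
    refine left_inv_eq_right_inv (prod_one_sub_X_pow_mul_prod_powGeomSeries he) ?_
    rw [h, mul_comm, prod_one_sub_X_pow_mul_prod_powGeomSeries hd]
  have hmul : Finset.univ.val.map e = Finset.univ.val.map d := by
    refine eq_of_prod_one_sub_X_pow_eq (by simpa using he) (by simpa using hd) ?_
    rwa [Multiset.map_map, Multiset.map_map]
  have hfib : ∀ m, Nonempty ({j // d j = m} ≃ {i // e i = m}) := fun m => by
    rw [← Fintype.card_eq]
    have := congr_arg (Multiset.count m) hmul
    simp only [Multiset.count_map] at this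
    rw [Fintype.card_subtype, Fintype.card_subtype]
    simp only [eq_comm (a := m)] at this
    exact this.symm
  exact ⟨Equiv.ofFiberEquiv fun m => (hfib m).some, fun j => Equiv.ofFiberEquiv_map _ j⟩

end DegreeMultiset

section Reflections

theorem IsEigenvalueTuple.actsAsReflection {n : ℕ} {A : Matrix (Fin n) (Fin n) ℂ} {c : Fin n → ℂ}
    (h : IsEigenvalueTuple A c) {i : Fin n} (hi : ∀ j ≠ i, c j = 1) : ActsAsReflection A := by
  obtain ⟨P, Q, hPQ, hQP, rfl⟩ := h
  have hQ : Q i ≠ 0 := fun h0 => by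
    have := congr_fun (congr_fun hQP i) i
    simp [Matrix.mul_apply, h0] at this
  suffices P * Matrix.diagonal c * Q =
      1 + Matrix.vecMulVec (fun a => P a i * (c i - 1)) (Q i) by
    rw [this]
    exact actsAsReflection_one_add_vecMulVec _ _ hQ
  ext a b
  rw [← hPQ]
  rw [Matrix.add_apply, Matrix.vecMulVec_apply, Matrix.mul_apply, Matrix.mul_apply]
  simp only [Matrix.mul_diagonal]
  rw [← Finset.add_sum_erase _ _ (Finset.mem_univ i),
    ← Finset.add_sum_erase _ (fun j => P a j * Q j b) (Finset.mem_univ i)]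
  have : ∑ j ∈ Finset.univ.erase i, P a j * c j * Q j b =
      ∑ j ∈ Finset.univ.erase i, P a j * Q j b :=
    Finset.sum_congr rfl fun j hj => by rw [hi j (Finset.ne_of_mem_erase hj), mul_one]
  rw [this]
  ring

end Reflections

section GeneratingFunctions

variable {n : ℕ}

/-- The reversed characteristic polynomial of a matrix with eigenvalues `c`. -/
noncomputable def eigenPoly (c : Fin n → ℂ) : Polynomial ℂ :=
  ∏ i, (1 - Polynomial.C (c i) * Polynomial.X)

theorem eval_eigenPoly (c : Fin n → ℂ) (t : ℂ) : (eigenPoly c).eval t = ∏ i, (1 - t * c i) := by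
  simp [eigenPoly, Polynomial.eval_prod, mul_comm t]

theorem eigenPoly_mul_prod_mk (c : Fin n → ℂ) :
    (eigenPoly c : PowerSeries ℂ) * ∏ i, (PowerSeries.mk fun m => c i ^ m) = 1 := by
  rw [eigenPoly, ← Polynomial.coeToPowerSeries.ringHom_apply, map_prod, ← Finset.prod_mul_distrib]
  refine Finset.prod_eq_one fun i _ => ?_
  rw [Polynomial.coeToPowerSeries.ringHom_apply]
  ext m
  rcases m with _ | m
  · simp [sub_mul, mul_assoc]
  · simp [sub_mul, mul_assoc, PowerSeries.coeff_succ_X_mul, pow_succ', PowerSeries.coeff_one]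

theorem eval_prod_one_sub_X_pow {ι : Type*} [Fintype ι] (d : ι → ℕ) (t : ℂ) :
    (∏ i, (1 - Polynomial.X ^ d i) : Polynomial ℂ).eval t = ∏ i, (1 - t ^ d i) := by
  simp [Polynomial.eval_prod]

variable {G : Type*} [Group G] [Fintype G] {M : G →* Matrix (Fin n) (Fin n) ℂ}
  {Λ : G → Fin n → ℂ} {d : Fin n → ℕ}

/-- Molien's formula as a property of a tuple of degrees. -/
def HasMolienDegrees (M : G →* Matrix (Fin n) (Fin n) ℂ) (d : Fin n → ℕ) : Prop :=
  ∀ t : ℂ, (∀ g, (1 - t • M g).det ≠ 0) → (∀ i, 1 - t ^ d i ≠ 0) →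
    ∑ g, ((1 - t • M g).det)⁻¹ = Fintype.card G * (∏ i, (1 - t ^ d i))⁻¹

theorem HasMolienDegrees.sum_prod_mk (hM : HasMolienDegrees M d) (hd : ∀ i, 0 < d i)
    (hΛ : ∀ g, IsEigenvalueTuple (M g) (Λ g)) :
    ∑ g, ∏ i, (PowerSeries.mk fun m => Λ g i ^ m) =
      PowerSeries.C (Fintype.card G : ℂ) * ∏ i, powGeomSeries (d i) := by
  classical
  have h := sum_mul_eq_of_sum_div_eq (a := fun _ : G => 1) (b := Polynomial.C (Fintype.card G : ℂ))
    (fun g => eigenPoly_mul_prod_mk (Λ g)) (prod_one_sub_X_pow_mul_prod_powGeomSeries hd) ?_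
  · simpa only [Polynomial.coe_one, one_mul, Polynomial.coe_C] using h
  · intro t _ hq hc
    simp only [eval_eigenPoly, eval_prod_one_sub_X_pow, Polynomial.eval_one, one_mul,
      Polynomial.eval_C, ← ((hΛ _).one_sub_smul t).det_eq] at hq hc ⊢
    exact hM t hq fun i => Finset.prod_ne_zero_iff.mp hc i (Finset.mem_univ i)

theorem HasMolienDegrees.sum_det_mul_prod_mk (hM : HasMolienDegrees M d) (hd : ∀ i, 0 < d i)
    (hΛ : ∀ g, IsEigenvalueTuple (M g) (Λ g)) :
    ∑ g, PowerSeries.C (M g).det * ∏ i, (PowerSeries.mk fun m => Λ g i ^ m) =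
      PowerSeries.C (Fintype.card G : ℂ) *
        (PowerSeries.X ^ (∑ i, (d i - 1)) * ∏ i, powGeomSeries (d i)) := by
  classical
  have h := sum_mul_eq_of_sum_div_eq (a := fun g : G => Polynomial.C (M g).det)
    (b := Polynomial.C (Fintype.card G : ℂ) * Polynomial.X ^ (∑ i, (d i - 1)))
    (fun g => eigenPoly_mul_prod_mk (Λ g)) (prod_one_sub_X_pow_mul_prod_powGeomSeries hd) ?_
  · simpa only [Polynomial.coe_mul, Polynomial.coe_pow, Polynomial.coe_X, Polynomial.coe_C,
      mul_assoc] using h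
  · intro t ht hq hc
    simp only [eval_eigenPoly, eval_prod_one_sub_X_pow, Polynomial.eval_C, Polynomial.eval_mul,
      Polynomial.eval_pow, Polynomial.eval_X] at hq hc ⊢
    have hunit : ∀ g, IsUnit (M g) := fun g => (Group.isUnit g).map M
    have hinv : ∀ g, (1 - t⁻¹ • M g⁻¹).det = ∏ i, (1 - t⁻¹ * (Λ g i)⁻¹) := fun g =>
      (((hΛ g).of_mul_eq_one (by rw [← map_mul, mul_inv_cancel, map_one])).one_sub_smul
        t⁻¹).det_eq
    have hfac : ∀ g i, 1 - t * Λ g i = (-t) * Λ g i * (1 - t⁻¹ * (Λ g i)⁻¹) := fun g i => by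
      have := (hΛ g).ne_zero (hunit g) i
      field_simp
      ring
    have hdet : ∀ g, ∏ i, (1 - t * Λ g i) = (-t) ^ n * (M g).det * (1 - t⁻¹ • M g⁻¹).det :=
      fun g => by
        rw [Finset.prod_congr rfl fun i _ => hfac g i, Finset.prod_mul_distrib,
          Finset.prod_mul_distrib, (hΛ g).det_eq, hinv]
        simp
    have hdeg : ∀ i, 1 - t ^ d i = (-t) * t ^ (d i - 1) * (1 - t⁻¹ ^ d i) := fun i => by
      obtain ⟨m, hm⟩ := Nat.exists_eq_succ_of_ne_zero (hd i).ne'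
      rw [hm, Nat.succ_sub_one, Nat.succ_eq_add_one, inv_pow]
      field_simp
      ring
    have hprod : ∏ i, (1 - t ^ d i) =
        (-t) ^ n * t ^ (∑ i, (d i - 1)) * ∏ i, (1 - t⁻¹ ^ d i) := by
      rw [Finset.prod_congr rfl fun i _ => hdeg i, Finset.prod_mul_distrib,
        Finset.prod_mul_distrib, Finset.prod_pow_eq_pow_sum]
      simp
    have hmol := hM t⁻¹ (fun g => by
        have := hq g⁻¹
        rw [hdet, inv_inv] at this
        exact right_ne_zero_of_mul this) fun i => by
        rw [Finset.prod_ne_zero_iff] at hc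
        have := hc i (Finset.mem_univ i)
        rw [hdeg] at this
        exact right_ne_zero_of_mul this
    rw [hprod]
    calc ∑ g, (M g).det * (∏ i, (1 - t * Λ g i))⁻¹
        = ((-t) ^ n)⁻¹ * ∑ g, ((1 - t⁻¹ • M g⁻¹).det)⁻¹ := by
          rw [Finset.mul_sum]
          refine Finset.sum_congr rfl fun g _ => ?_
          have : (M g).det ≠ 0 := ((Matrix.isUnit_iff_isUnit_det _).mp (hunit g)).ne_zero
          rw [hdet, mul_inv, mul_inv]
          field_simp
      _ = ((-t) ^ n)⁻¹ * (Fintype.card G * (∏ i, (1 - t⁻¹ ^ d i))⁻¹) := by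
          rw [← hmol]
          congr 1
          exact Equiv.sum_comp (Equiv.inv G) fun g => ((1 - t⁻¹ • M g).det)⁻¹
      _ = _ := by
          rw [mul_inv, mul_inv]
          have : t ^ (∑ i, (d i - 1)) ≠ 0 := pow_ne_zero _ ht
          field_simp

end GeneratingFunctions

section SolomonIdentity
open MvPolynomial Set.powersetCard

variable {n : ℕ}

theorem prod_one_add_mul_eq_sum_powersetCard {R : Type*} [CommRing R] (y : R) (c : Fin n → R) :
    ∏ i, (1 + y * c i) = ∑ p ∈ Finset.range (n + 1),
      y ^ p * ∑ I : Set.powersetCard (Fin n) p, ∏ i ∈ (I : Finset (Fin n)), c i := by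
  rw [Finset.prod_one_add, Finset.powerset_univ,
    ← Finset.sum_fiberwise_of_maps_to (t := Finset.range (n + 1)) (g := Finset.card)
      fun s _ => Finset.mem_range_succ_iff.mpr (card_finset_fin_le s)]
  refine Finset.sum_congr rfl fun p _ => ?_
  rw [Finset.mul_sum, Finset.sum_subtype (p := fun s => s ∈ Set.powersetCard (Fin n) p)]
  · refine Finset.sum_congr rfl fun I _ => ?_
    rw [Finset.prod_mul_distrib, Finset.prod_const, card_eq]
  · intro s
    simp [Set.powersetCard.mem_iff]

variable {G : Type*} [Group G] {M : G →* Matrix (Fin n) (Fin n) ℂ}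
  {Λ : G → Fin n → ℂ} {d : Fin n → ℕ}

theorem finrank_equivariantTuples_one {H : PowerSeries ℂ}
    (hH : ∀ k, (finrank ℂ (homogInvariants M k) : ℂ) = PowerSeries.coeff k H) (k : ℕ) :
    (finrank ℂ (equivariantTuples M (1 : G →* Matrix Unit Unit ℂ) k) : ℂ) =
      PowerSeries.coeff k H := by
  have h := finrank_equivariantTuples_of_generated M hH (D := (1 : G →* Matrix Unit Unit ℂ))
    (N := 1) (s := fun _ => 0) (fun I a => by simpa using isHomogeneous_one _ _)
    (fun b hb => by simpa using hb) (fun g I a => by simp)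
    (fun w hw => ⟨w, fun I g => by simpa using hw g⁻¹ I, fun a => by simp⟩) k
  simpa using h

variable [Fintype G]

theorem sum_trace_mul_prod_mk_eq_iff (hΛ : ∀ g, IsEigenvalueTuple (M g) (Λ g)) {m : Type*}
    [Fintype m] [DecidableEq m] (D : G →* Matrix m m ℂ) (F : PowerSeries ℂ) :
    ∑ g, PowerSeries.C (D g).trace * ∏ i, (PowerSeries.mk fun m => Λ g i ^ m) =
        PowerSeries.C (Fintype.card G : ℂ) * F ↔
      ∀ k, (finrank ℂ (equivariantTuples M D k) : ℂ) = PowerSeries.coeff k F := by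
  have hcard : (Fintype.card G : ℂ) ≠ 0 := by exact_mod_cast Fintype.card_ne_zero
  rw [PowerSeries.ext_iff]
  refine forall_congr' fun k => ?_
  have h := card_mul_finrank_equivariantTuples M D k
  rw [Finset.sum_congr rfl fun g _ => by rw [(hΛ g).trace_homogSubst]] at h
  rw [map_sum, Finset.sum_congr rfl fun g _ => PowerSeries.coeff_C_mul _ _ _,
    PowerSeries.coeff_C_mul, ← h, mul_right_inj' hcard]

/-- Chevalley's theorem, with the degrees of the basic invariants read off from Molien's formula. -/
theorem HasMolienDegrees.exists_isMinimalInvariantSystem (hM : HasMolienDegrees M d)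
    (hd : ∀ i, 0 < d i) (hΛ : ∀ g, IsEigenvalueTuple (M g) (Λ g)) {T : Set G}
    (hT : Subgroup.closure T = ⊤) (hrefl : ∀ s ∈ T, ActsAsReflection (M s)) :
    ∃ f, IsMinimalInvariantSystem M f d := by
  obtain ⟨t, e, hf⟩ := _root_.exists_isMinimalInvariantSystem M
  have halg := algebraicIndependent_of_pderiv
    fun a ha => hf.eq_zero_of_sum_mul_pderiv_eq_zero hT hrefl ha
  have h1 := (sum_trace_mul_prod_mk_eq_iff hΛ (1 : G →* Matrix Unit Unit ℂ) _).mpr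
    (finrank_equivariantTuples_one (finrank_homogInvariants hf halg))
  have hcard : PowerSeries.C (Fintype.card G : ℂ) ≠ 0 := fun h => by
    rw [map_eq_zero_iff _ PowerSeries.C_injective] at h
    exact Fintype.card_ne_zero (α := G) (by exact_mod_cast h)
  simp only [MonoidHom.one_apply, Matrix.trace_one, Fintype.card_unit, Nat.cast_one, map_one,
    one_mul] at h1
  have h2 := h1.symm.trans (hM.sum_prod_mk hd hΛ)
  obtain ⟨σ, hσ⟩ := exists_equiv_of_prod_powGeomSeries_eq hf.pos hd (mul_left_cancel₀ hcard h2)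
  refine ⟨fun i => (σ i : MvPolynomial (Fin n) ℂ), fun i => hf.mem _, hd,
    fun i => hσ i ▸ hf.homog _, ?_, fun i hi => hf.notMem (σ i) ?_⟩
  · rw [← hf.span]
    exact congr_arg _ (σ.surjective.range_comp fun p : t => (p : MvPolynomial (Fin n) ℂ))
  · convert hi using 2
    rw [← Set.image_image (fun p : t => (p : MvPolynomial (Fin n) ℂ)) σ,
      Set.image_compl_eq σ.bijective,
      Set.image_singleton]

theorem HasMolienDegrees.sum_trace_compoundMatrix_mul_prod_mk (hM : HasMolienDegrees M d)
    (hd : ∀ i, 0 < d i) (hΛ : ∀ g, IsEigenvalueTuple (M g) (Λ g)) {T : Set G}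
    (hT : Subgroup.closure T = ⊤) (hrefl : ∀ s ∈ T, ActsAsReflection (M s)) (p : ℕ) :
    ∑ g, PowerSeries.C (compoundMatrix p (M g)).trace *
        ∏ i, (PowerSeries.mk fun m => Λ g i ^ m) =
      PowerSeries.C (Fintype.card G : ℂ) * ((∑ I : Set.powersetCard (Fin n) p,
        PowerSeries.X ^ (∑ i ∈ (I : Finset (Fin n)), (d i - 1))) * ∏ i, powGeomSeries (d i)) := by
  obtain ⟨f, hf⟩ := hM.exists_isMinimalInvariantSystem hd hΛ hT hrefl
  have hindep := fun a ha => hf.eq_zero_of_sum_mul_pderiv_eq_zero (a := a) hT hrefl ha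
  let J : Matrix (Fin n) (Fin n) (MvPolynomial (Fin n) ℂ) := Matrix.of fun i k => pderiv k (f i)
  have hJg : ∀ g, J.map (linSubst (M g⁻¹)) = J * (M g).map C := fun g => by
    ext1 i k
    have h := pderiv_linSubst (M g) k (f i)
    rw [hf.mem i g] at h
    have h' := congr_arg (linSubst (M g⁻¹)) h
    simp only [J, Matrix.map_apply, Matrix.of_apply, Matrix.mul_apply]
    rw [h', map_sum]
    refine Finset.sum_congr rfl fun m _ => ?_
    rw [map_mul, ← linSubst_map_mul, mul_inv_cancel, map_one, linSubst_one, mul_comm,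
      MvPolynomial.algHom_C, MvPolynomial.algebraMap_eq]
  have hdet : J.det ≠ 0 := fun h0 => by
    obtain ⟨v, hv, hvJ⟩ := Matrix.exists_vecMul_eq_zero_iff.mpr h0
    exact hv (hindep v fun k => by simpa [Matrix.vecMul, dotProduct, J] using congr_fun hvJ k)
  have hH := finrank_homogInvariants hf (algebraicIndependent_of_pderiv hindep)
  refine (sum_trace_mul_prod_mk_eq_iff hΛ (compoundRep M p) _).mpr fun k => ?_
  rw [finrank_equivariantTuples_compoundRep M hH (J := J) (t := fun i => d i - 1)
    (fun i k => (hf.homog i).pderiv) hJg hdet ?_ p k, Finset.sum_mul, map_sum]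
  refine (sum_trace_mul_prod_mk_eq_iff hΛ (detRep M) _).mp ?_
  simp only [trace_detRep]
  exact hM.sum_det_mul_prod_mk hd hΛ

/-- Solomon's identity. -/
theorem HasMolienDegrees.solomon_identity (hM : HasMolienDegrees M d)
    (hd : ∀ i, 0 < d i) (hΛ : ∀ g, IsEigenvalueTuple (M g) (Λ g)) {T : Set G}
    (hT : Subgroup.closure T = ⊤) (hrefl : ∀ s ∈ T, ActsAsReflection (M s)) (y : ℂ) {t : ℂ}
    (ht : ∀ g i, 1 - t * Λ g i ≠ 0) (ht' : ∀ i, 1 - t ^ d i ≠ 0) :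
    ∑ g, (∏ i, (1 + y * Λ g i)) * (∏ i, (1 - t * Λ g i))⁻¹ =
      Fintype.card G * ((∏ i, (1 + y * t ^ (d i - 1))) * (∏ i, (1 - t ^ d i))⁻¹) := by
  classical
  have h : ∀ p, ∑ g, (∑ I : Set.powersetCard (Fin n) p, ∏ i ∈ (I : Finset (Fin n)), Λ g i) *
        (∏ i, (1 - t * Λ g i))⁻¹ =
      Fintype.card G * (∑ I : Set.powersetCard (Fin n) p,
        ∏ i ∈ (I : Finset (Fin n)), t ^ (d i - 1)) * (∏ i, (1 - t ^ d i))⁻¹ := fun p => by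
    have h := sum_div_eq_of_sum_mul_eq (t := t)
      (a := fun g : G => Polynomial.C (compoundMatrix p (M g)).trace)
      (b := Polynomial.C (Fintype.card G : ℂ) * ∑ I : Set.powersetCard (Fin n) p,
        Polynomial.X ^ (∑ i ∈ (I : Finset (Fin n)), (d i - 1)))
      (fun g => eigenPoly_mul_prod_mk (Λ g)) (prod_one_sub_X_pow_mul_prod_powGeomSeries hd) ?_
      (fun g => ?_) ?_
    · simpa only [eval_eigenPoly, eval_prod_one_sub_X_pow, Polynomial.eval_C, Polynomial.eval_mul,
        Polynomial.eval_finsetSum, Polynomial.eval_pow, Polynomial.eval_X,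
        (hΛ _).trace_compoundMatrix, Finset.prod_pow_eq_pow_sum] using h
    · have := hM.sum_trace_compoundMatrix_mul_prod_mk hd hΛ hT hrefl p
      simp only [Polynomial.coe_C, Polynomial.coe_mul, this, ← mul_assoc]
      congr 2
      simp only [← Polynomial.coeToPowerSeries.ringHom_apply, map_sum, map_pow]
      simp
    · rw [eval_eigenPoly]
      exact Finset.prod_ne_zero_iff.mpr fun i _ => ht g i
    · rw [eval_prod_one_sub_X_pow]
      exact Finset.prod_ne_zero_iff.mpr fun i _ => ht' i
  simp only [prod_one_add_mul_eq_sum_powersetCard, Finset.sum_mul, Finset.mul_sum (Finset.range _)]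
  rw [Finset.sum_comm]
  refine Finset.sum_congr rfl fun p _ => ?_
  simp only [mul_assoc, ← Finset.mul_sum]
  rw [h]
  ring

end SolomonIdentity

section Limits
open Filter Topology

theorem eventually_one_sub_mul_ne_zero (c : ℂ) : ∀ᶠ t : ℂ in 𝓝[≠] 1, 1 - t * c ≠ 0 := by
  by_cases hc : c = 1
  · filter_upwards [self_mem_nhdsWithin] with t ht
    rw [hc, mul_one]
    exact sub_ne_zero.mpr (Ne.symm ht)
  · have hcont : Continuous fun t : ℂ => 1 - t * c := by fun_prop
    refine hcont.continuousAt.eventually_ne ?_ |>.filter_mono nhdsWithin_le_nhds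
    rw [one_mul]
    exact sub_ne_zero.mpr (Ne.symm hc)

theorem tendsto_one_sub_pow_div (m : ℕ) :
    Tendsto (fun t : ℂ => (1 - t ^ m) / (1 - t)) (𝓝[≠] 1) (𝓝 m) := by
  have hcont : Continuous fun t : ℂ => ∑ i ∈ Finset.range m, t ^ i := by fun_prop
  have h := (hcont.tendsto 1).mono_left (nhdsWithin_le_nhds (s := {1}ᶜ))
  simp only [one_pow, Finset.sum_const, Finset.card_range, nsmul_eq_mul, mul_one] at h
  refine h.congr' ?_
  filter_upwards [self_mem_nhdsWithin] with t ht
  rw [geom_sum_eq ht, ← neg_div_neg_eq, neg_sub, neg_sub]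

theorem eventually_one_sub_pow_ne_zero {m : ℕ} (hm : 0 < m) :
    ∀ᶠ t : ℂ in 𝓝[≠] 1, 1 - t ^ m ≠ 0 := by
  have hm' : (m : ℂ) ≠ 0 := by exact_mod_cast hm.ne'
  filter_upwards [(tendsto_one_sub_pow_div m).eventually_ne hm'] with t ht h0
  simp [h0] at ht

theorem tendsto_one_sub_pow_mul_div (r : ℕ) (c : ℂ) :
    Tendsto (fun t : ℂ => (1 - t ^ r * c) / (1 - t * c)) (𝓝[≠] 1)
      (𝓝 (if c = 1 then (r : ℂ) else 1)) := by
  split_ifs with hc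
  · simpa [hc] using tendsto_one_sub_pow_div r
  · have hc' : 1 - c ≠ 0 := sub_ne_zero.mpr (Ne.symm hc)
    have h : ContinuousAt (fun t : ℂ => (1 - t ^ r * c) / (1 - t * c)) 1 :=
      ContinuousAt.div (by fun_prop) (by fun_prop) (by simpa using hc')
    simpa [hc'] using h.tendsto.mono_left (nhdsWithin_le_nhds (s := {1}ᶜ))

theorem tendsto_one_sub_div_one_sub_mul (c : ℂ) :
    Tendsto (fun t : ℂ => (1 - t) / (1 - t * c)) (𝓝[≠] 1) (𝓝 (if c = 1 then 1 else 0)) := by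
  split_ifs with hc
  · refine tendsto_const_nhds.congr' ?_
    filter_upwards [self_mem_nhdsWithin] with t ht
    rw [hc, mul_one, div_self (sub_ne_zero.mpr (Ne.symm ht))]
  · have h : ContinuousAt (fun t : ℂ => (1 - t) / (1 - t * c)) 1 :=
      ContinuousAt.div (by fun_prop) (by fun_prop) (by simpa using sub_ne_zero.mpr (Ne.symm hc))
    simpa using h.tendsto.mono_left (nhdsWithin_le_nhds (s := {1}ᶜ))

theorem tendsto_one_sub_pow_div_one_sub_pow (m : ℕ) {k : ℕ} (hk : 0 < k) :
    Tendsto (fun t : ℂ => (1 - t ^ m) / (1 - t ^ k)) (𝓝[≠] 1) (𝓝 (m / k)) := by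
  refine ((tendsto_one_sub_pow_div m).div (tendsto_one_sub_pow_div k)
    (by exact_mod_cast hk.ne')).congr' ?_
  filter_upwards [self_mem_nhdsWithin] with t ht
  exact div_div_div_cancel_right₀ (sub_ne_zero.mpr (Ne.symm ht)) _ _

end Limits

section ShephardTodd
open Filter Topology

variable {n : ℕ} {G : Type*} [Group G] [Fintype G] {M : G →* Matrix (Fin n) (Fin n) ℂ}
  {Λ : G → Fin n → ℂ} {d : Fin n → ℕ}

theorem HasMolienDegrees.card_eq_prod (hM : HasMolienDegrees M d) (hd : ∀ i, 0 < d i)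
    (hΛ : ∀ g, IsEigenvalueTuple (M g) (Λ g)) (hinj : Function.Injective M) :
    (Fintype.card G : ℂ) = ∏ i, (d i : ℂ) := by
  classical
  have hL : Tendsto (fun t : ℂ => ∑ g, ∏ i, (1 - t) / (1 - t * Λ g i)) (𝓝[≠] 1)
      (𝓝 (∑ g, ∏ i, if Λ g i = 1 then 1 else 0)) :=
    tendsto_finsetSum _ fun g _ => tendsto_finsetProd _ fun i _ =>
      tendsto_one_sub_div_one_sub_mul _
  have hR : Tendsto (fun t : ℂ => Fintype.card G * ∏ i, (1 - t) / (1 - t ^ d i)) (𝓝[≠] 1)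
      (𝓝 (Fintype.card G * ∏ i, ((d i : ℂ))⁻¹)) := by
    refine (tendsto_finsetProd _ fun i _ => ?_).const_mul _
    simpa using tendsto_one_sub_pow_div_one_sub_pow 1 (hd i)
  have heq : ∀ᶠ t : ℂ in 𝓝[≠] 1, ∑ g, ∏ i, (1 - t) / (1 - t * Λ g i) =
      Fintype.card G * ∏ i, (1 - t) / (1 - t ^ d i) := by
    filter_upwards [eventually_all.mpr fun g => eventually_all.mpr fun i =>
      eventually_one_sub_mul_ne_zero (Λ g i), eventually_all.mpr fun i =>
      eventually_one_sub_pow_ne_zero (hd i)] with t ht ht'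
    have hdet : ∀ g, (1 - t • M g).det = ∏ i, (1 - t * Λ g i) := fun g =>
      ((hΛ g).one_sub_smul t).det_eq
    have := hM t (fun g => by rw [hdet]; exact Finset.prod_ne_zero_iff.mpr fun i _ => ht g i) ht'
    simp only [hdet] at this
    simp only [Finset.prod_div_distrib, div_eq_mul_inv _ (∏ i, _), ← Finset.mul_sum]
    rw [this]
    ring
  have hlim := tendsto_nhds_unique (hL.congr' heq) hR
  have hone : ∀ g, (∏ i, if Λ g i = 1 then (1 : ℂ) else 0) = if g = 1 then 1 else 0 := fun g => by
    simp only [Finset.prod_boole, Finset.mem_univ, true_imp_iff]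
    have hiff : (∀ i, Λ g i = 1) ↔ g = 1 := by
      refine ⟨fun h => hinj (by rw [map_one, (hΛ g).eq_one h]), ?_⟩
      rintro rfl i
      have h1 := (hΛ 1).one_sub_smul 1
      rw [map_one, one_smul, sub_self] at h1
      have := h1.rank_eq
      rw [Matrix.rank_zero, eq_comm, Fintype.card_eq_zero_iff] at this
      by_contra hne
      exact this.false ⟨i, by rw [one_mul]; exact sub_ne_zero.mpr (Ne.symm hne)⟩
    simp only [hiff]
  simp only [hone, Finset.sum_ite_eq', Finset.mem_univ, if_true] at hlim
  rw [Finset.prod_inv_distrib] at hlim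
  exact eq_of_div_eq_one hlim.symm

theorem HasMolienDegrees.sum_pow_card_eq_one (hM : HasMolienDegrees M d) (hd : ∀ i, 0 < d i)
    (hΛ : ∀ g, IsEigenvalueTuple (M g) (Λ g)) (hinj : Function.Injective M) {T : Set G}
    (hT : Subgroup.closure T = ⊤) (hrefl : ∀ s ∈ T, ActsAsReflection (M s)) (r : ℕ) :
    ∑ g, (r : ℂ) ^ Fintype.card {i // Λ g i = 1} = ∏ i, ((r : ℂ) + d i - 1) := by
  classical
  have hL : Tendsto (fun t : ℂ => ∑ g, ∏ i, (1 - t ^ r * Λ g i) / (1 - t * Λ g i)) (𝓝[≠] 1)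
      (𝓝 (∑ g, ∏ i, if Λ g i = 1 then (r : ℂ) else 1)) :=
    tendsto_finsetSum _ fun g _ => tendsto_finsetProd _ fun i _ =>
      tendsto_one_sub_pow_mul_div r _
  have hR : Tendsto (fun t : ℂ => Fintype.card G * ∏ i, (1 - t ^ (r + (d i - 1))) / (1 - t ^ d i))
      (𝓝[≠] 1) (𝓝 (Fintype.card G * ∏ i, ((r + (d i - 1) : ℕ) / d i : ℂ))) :=
    (tendsto_finsetProd _ fun i _ => tendsto_one_sub_pow_div_one_sub_pow _ (hd i)).const_mul _
  have heq : ∀ᶠ t : ℂ in 𝓝[≠] 1, ∑ g, ∏ i, (1 - t ^ r * Λ g i) / (1 - t * Λ g i) =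
      Fintype.card G * ∏ i, (1 - t ^ (r + (d i - 1))) / (1 - t ^ d i) := by
    filter_upwards [eventually_all.mpr fun g => eventually_all.mpr fun i =>
      eventually_one_sub_mul_ne_zero (Λ g i), eventually_all.mpr fun i =>
      eventually_one_sub_pow_ne_zero (hd i)] with t ht ht'
    have := hM.solomon_identity hd hΛ hT hrefl (-t ^ r) ht ht'
    simpa only [Finset.prod_div_distrib, div_eq_mul_inv (∏ i, _), neg_mul, ← sub_eq_add_neg,
      pow_add] using this
  have hlim := tendsto_nhds_unique (hL.congr' heq) hR
  rw [hM.card_eq_prod hd hΛ hinj, ← Finset.prod_mul_distrib] at hlim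
  convert hlim using 2 with g _ i _
  · rw [Finset.prod_ite, Finset.prod_const, Finset.prod_const_one, mul_one, Fintype.card_subtype]
  · have : (d i : ℂ) ≠ 0 := by exact_mod_cast (hd i).ne'
    rw [mul_div_cancel₀ _ this, Nat.cast_add, Nat.cast_sub (hd i)]
    push_cast
    ring

end ShephardTodd

/-- Shephard–Todd formula: let `W` be a finite complex reflection
group of rank `ℓ` acting on `h`, with degrees `d_1,…,d_ℓ` (characterized by
Molien's formula), and `fix(w) = dim ker(w − 1)`.  Then for any `r`,
`Σ_{w∈W} r^{fix(w)} = Π_{i=1}^ℓ (r + d_i − 1)`. -/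
theorem stmt5 {V : Type*} [AddCommGroup V] [Module ℂ V] [FiniteDimensional ℂ V]
    {G : Type*} [Group G] [Fintype G] (ρ : Representation ℂ G V)
    (hfaith : Function.Injective ρ)
    (hgen : Subgroup.closure {g : G | g ≠ 1 ∧
        finrank ℂ (LinearMap.ker ((ρ g : Module.End ℂ V) - 1)) = finrank ℂ V - 1} = ⊤)
    (d : Fin (finrank ℂ V) → ℕ) (hd : ∀ i, 0 < d i)
    (hMolien : ∀ t : ℂ,
      (∀ g : G, LinearMap.det ((1 : Module.End ℂ V) - t • ρ g) ≠ 0) →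
      (∀ i, (1 : ℂ) - t ^ d i ≠ 0) →
      (∑ g : G, (LinearMap.det ((1 : Module.End ℂ V) - t • ρ g))⁻¹) /
          (Fintype.card G : ℂ) = ∏ i, ((1 : ℂ) - t ^ d i)⁻¹)
    (r : ℕ) :
    ∑ g : G, (r : ℂ) ^ (finrank ℂ (LinearMap.ker ((ρ g : Module.End ℂ V) - 1))) =
      ∏ i, ((r : ℂ) + (d i : ℂ) - 1) := by
  classical
  let b := finBasis ℂ V
  let Φ := LinearMap.toMatrixAlgEquiv b
  let M : G →* Matrix (Fin (finrank ℂ V)) (Fin (finrank ℂ V)) ℂ :=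
    (Φ : (V →ₗ[ℂ] V) →* Matrix (Fin (finrank ℂ V)) (Fin (finrank ℂ V)) ℂ).comp ρ
  have hMΦ : ∀ g, M g = Φ (ρ g) := fun g => rfl
  have hinj : Function.Injective M := Φ.injective.comp hfaith
  have hdet : ∀ (t : ℂ) g,
      LinearMap.det ((1 : Module.End ℂ V) - t • ρ g) = (1 - t • M g).det := fun t g => by
    rw [hMΦ, ← map_one Φ, ← map_smul Φ, ← map_sub]
    exact (LinearMap.det_toMatrix b _).symm
  have hM : HasMolienDegrees M d := fun t ht ht' => by
    have h := hMolien t (fun g => by rw [hdet]; exact ht g) ht'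
    simp only [hdet] at h
    rw [div_eq_iff (by exact_mod_cast Fintype.card_ne_zero), mul_comm, Finset.prod_inv_distrib] at h
    exact h
  have hex : ∀ g, ∃ c, IsEigenvalueTuple (M g) c := fun g =>
    exists_isEigenvalueTuple_of_pow_eq_one (Fintype.card_ne_zero (α := G))
      (by rw [← map_pow, pow_card_eq_one, map_one])
  choose Λ hΛ using hex
  have hfix : ∀ g, finrank ℂ (LinearMap.ker ((ρ g : Module.End ℂ V) - 1)) =
      Fintype.card {i // Λ g i = 1} := fun g => by
    have h1 : (1 - M g).rank = finrank ℂ (LinearMap.range ((1 : Module.End ℂ V) - ρ g)) := by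
      rw [Matrix.rank_eq_finrank_range_toLin _ b b, hMΦ, ← map_one Φ, ← map_sub]
      have : Matrix.toLin b b (Φ (1 - ρ g)) = 1 - ρ g := Matrix.toLin_toMatrix b b _
      rw [this]
    have h2 := ((hΛ g).one_sub_smul 1).rank_eq
    rw [one_smul, h1] at h2
    have h3 := LinearMap.finrank_range_add_finrank_ker ((1 : Module.End ℂ V) - ρ g)
    have h4 := Fintype.card_subtype_compl fun i => Λ g i = 1
    have h5 := Fintype.card_subtype_le fun i => Λ g i = 1
    have h6 : Fintype.card {i // 1 - 1 * Λ g i ≠ 0} = Fintype.card {i // ¬ Λ g i = 1} :=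
      Fintype.card_congr (Equiv.subtypeEquivRight fun i => by
        rw [one_mul, Ne, sub_eq_zero, eq_comm])
    rw [← LinearMap.ker_neg, neg_sub]
    rw [Fintype.card_fin] at h4 h5
    omega
  simp only [hfix]
  refine hM.sum_pow_card_eq_one hd hΛ hinj hgen (fun s hs => ?_) r
  obtain ⟨hs1, hs2⟩ := hs
  have hex : ∃ i, Λ s i ≠ 1 := by
    by_contra! hall
    exact hs1 (hinj (by rw [(hΛ s).eq_one hall, map_one]))
  obtain ⟨i, hi⟩ := hex
  refine (hΛ s).actsAsReflection (i := i) fun j hj => ?_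
  by_contra hj1
  rw [hfix] at hs2
  have h1 := Fintype.card_subtype_compl fun i => Λ s i = 1
  have h2 : 1 < Fintype.card {i // ¬ Λ s i = 1} :=
    Fintype.one_lt_card_iff.mpr ⟨⟨i, hi⟩, ⟨j, hj1⟩, fun h => hj (congr_arg Subtype.val h).symm⟩
  rw [Fintype.card_fin] at h1
  omega
end

section
/- Let W be the Weyl group of an irreducible root system of rank ℓ with root lattice Q, and let r be a positive integer coprime to the Coxeter number h. Then for every w ∈ W, the number of fixed points of w acting on Q/rQ equals r^{fix(w)}, where fix(w) is the dimension of the fixed space of w on h = Q ⊗ ℂ. -/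
open Module

/-- The data of an irreducible reduced crystallographic root system `Φ` in its root lattice `Q`,
with coroots `α` and Weyl group `W` acting through `ρ`. -/
structure IsIrreducibleRootSystem {Q W : Type*} [AddCommGroup Q] [Group W]
    (ρ : Representation ℤ W Q) (Φ : Finset Q) (α : Q → Dual ℤ Q) : Prop where
  injective : Function.Injective ρ
  span_eq_top : Submodule.span ℤ (Φ : Set Q) = ⊤
  coroot_self : ∀ a ∈ Φ, α a a = 2
  map_mem : ∀ a ∈ Φ, ∀ w : W, ρ w a ∈ Φ
  exists_reflection : ∀ a ∈ Φ, ∃ s : W, ∀ x : Q, ρ s x = x - α a x • a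
  closure_eq_top : Subgroup.closure {s : W | ∃ a ∈ Φ, ∀ x : Q, ρ s x = x - α a x • a} = ⊤
  two_smul_notMem : ∀ a ∈ Φ, (2 : ℤ) • a ∉ Φ
  irreducible : ∀ p : Submodule ℤ Q, (∀ w : W, ∀ x ∈ p, ρ w x ∈ p) →
    p = ⊥ ∨ finrank ℤ p = finrank ℤ Q

theorem representation_apply_injective {Q W : Type*} [AddCommGroup Q] [Group W]
    (ρ : Representation ℤ W Q) (w : W) : Function.Injective (ρ w) := by
  intro x y hxy
  simpa [← Module.End.mul_apply, ← map_mul] using congrArg (ρ w⁻¹) hxy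

theorem Finset.sum_comp_of_mapsTo {A B : Type*} [AddCommMonoid B] (S : Finset A) {g : A → A}
    (hg : Function.Injective g) (hS : ∀ a ∈ S, g a ∈ S) (f : A → B) :
    ∑ a ∈ S, f (g a) = ∑ a ∈ S, f a :=
  Finset.sum_nbij g hS hg.injOn
    (Finset.surjOn_of_injOn_of_card_le g hS hg.injOn le_rfl) fun _ _ ↦ rfl

/-- A sum of a function invariant under an involution without fixed points is twice the sum over
half of the elements. -/
theorem Finset.sum_eq_two_nsmul_sum_filter_lt {A B L : Type*} [AddCommMonoid B]
    [LinearOrder L] (S : Finset A) {σ : A → A} (hσ : Function.Involutive σ)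
    (hS : ∀ a ∈ S, σ a ∈ S) (κ : A → L) (hκ : ∀ a ∈ S, κ (σ a) ≠ κ a) (f : A → B)
    (hf : ∀ a ∈ S, f (σ a) = f a) :
    ∑ a ∈ S, f a = 2 • ∑ a ∈ S with κ a < κ (σ a), f a := by
  rw [← Finset.sum_filter_add_sum_filter_not S (fun a ↦ κ a < κ (σ a)), two_nsmul]
  congr 1
  refine Finset.sum_nbij' σ σ ?_ ?_ (fun a _ ↦ hσ a) (fun a _ ↦ hσ a) ?_
  · intro a ha
    simp only [Finset.mem_filter, not_lt] at ha ⊢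
    exact ⟨hS a ha.1, by rw [hσ a]; exact lt_of_le_of_ne ha.2 (hκ a ha.1)⟩
  · intro a ha
    simp only [Finset.mem_filter, not_lt] at ha ⊢
    exact ⟨hS a ha.1, by rw [hσ a]; exact ha.2.le⟩
  · intro a ha
    exact (hf a (Finset.mem_filter.mp ha).1).symm

namespace IsIrreducibleRootSystem

variable {Q W : Type*} [AddCommGroup Q] [Group W]
  {ρ : Representation ℤ W Q} {Φ : Finset Q} {α : Q → Dual ℤ Q}

section Basic

variable (H : IsIrreducibleRootSystem ρ Φ α)
include H

theorem ne_zero {a : Q} (ha : a ∈ Φ) : a ≠ 0 := by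
  rintro rfl
  simpa using H.coroot_self 0 ha

theorem sub_smul_mem {a b : Q} (ha : a ∈ Φ) (hb : b ∈ Φ) : b - α a b • a ∈ Φ := by
  obtain ⟨s, hs⟩ := H.exists_reflection a ha
  exact hs b ▸ H.map_mem b hb s

theorem neg_mem {a : Q} (ha : a ∈ Φ) : -a ∈ Φ := by
  have := H.sub_smul_mem ha ha
  rwa [H.coroot_self a ha, two_smul, sub_add_cancel_left] at this

variable [Module.Free ℤ Q]

/-- Coroots are equivariant under the Weyl group. -/
theorem coroot_map {a : Q} (ha : a ∈ Φ) (w : W) (x : Q) : α (ρ w a) (ρ w x) = α a x := by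
  have key : (α (ρ w a)) ∘ₗ (ρ w) = α a := by
    refine Dual.eq_of_preReflection_mapsTo (x := a) Φ.finite_toSet H.span_eq_top ?_ ?_
      (H.coroot_self a ha) ?_
    · simpa using H.coroot_self _ (H.map_mem a ha w)
    · intro b hb
      have := H.map_mem _ (H.sub_smul_mem (H.map_mem a ha w) (H.map_mem b hb w)) w⁻¹
      simpa [Module.preReflection_apply, ← Module.End.mul_apply, ← map_mul] using this
    · intro b hb
      simpa [Module.preReflection_apply] using H.sub_smul_mem ha hb
  exact LinearMap.congr_fun key x

theorem coroot_sub_smul {a b : Q} (ha : a ∈ Φ) (hb : b ∈ Φ) (x : Q) :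
    α (b - α a b • a) x = α b (x - α a x • a) := by
  obtain ⟨s, hs⟩ := H.exists_reflection a ha
  have h1 := H.coroot_map hb s (x - α a x • a)
  rw [hs b, hs] at h1
  rw [← h1]
  congr 1
  simp [H.coroot_self a ha]
  module

theorem coroot_neg {a : Q} (ha : a ∈ Φ) (x : Q) : α (-a) x = -α a x := by
  have := H.coroot_sub_smul ha ha x
  rw [H.coroot_self a ha, two_smul, sub_add_cancel_left] at this
  rw [this]
  simp [H.coroot_self a ha]
  ring

/-- Schur's lemma for the operator attached to a Weyl-stable set of roots. -/
theorem finrank_smul_sum [Module.Finite ℤ Q] {S : Finset Q} (hS : S ⊆ Φ)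
    (hSW : ∀ a ∈ S, ∀ w, ρ w a ∈ S) (x : Q) :
    (finrank ℤ Q : ℤ) • ∑ a ∈ S, α a x • a = (2 * S.card : ℤ) • x := by
  classical
  set T : Q →ₗ[ℤ] Q := ∑ a ∈ S, (α a).smulRight a with hT
  have hTx (x : Q) : T x = ∑ a ∈ S, α a x • a := by simp [hT]
  have htr : LinearMap.trace ℤ Q T = 2 * S.card := by
    simp only [hT, map_sum, LinearMap.trace_smulRight]
    rw [Finset.sum_congr rfl fun a ha ↦ H.coroot_self a (hS ha)]
    simp [mul_comm]
  have hcomm (w : W) (x : Q) : T (ρ w x) = ρ w (T x) := by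
    rw [hTx, hTx, map_sum,
      ← Finset.sum_comp_of_mapsTo S (representation_apply_injective ρ w) (fun a ha ↦ hSW a ha w)]
    refine Finset.sum_congr rfl fun a ha ↦ ?_
    rw [H.coroot_map (hS ha), map_smul]
  rw [← hTx]
  rcases S.eq_empty_or_nonempty with rfl | ⟨a, haS⟩
  · simp [hT]
  have ha := hS haS
  have hTa : (2 : ℤ) • T a = α a (T a) • a := by
    obtain ⟨s, hs⟩ := H.exists_reflection a ha
    have := hcomm s a
    rw [hs, hs, H.coroot_self a ha, map_sub, map_smul] at this
    have h2 : α a (T a) • a = T a - (T a - α a (T a) • a) := by abel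
    rw [h2, ← this]
    abel
  set D : Q →ₗ[ℤ] Q := (2 : ℤ) • T - α a (T a) • LinearMap.id with hD
  have hker : finrank ℤ (LinearMap.ker D) = finrank ℤ Q := by
    refine (H.irreducible (LinearMap.ker D) ?_).resolve_left ?_
    · intro w x hx
      rw [LinearMap.mem_ker] at hx ⊢
      have : D (ρ w x) = ρ w (D x) := by simp [hD, hcomm]
      rw [this, hx, map_zero]
    · intro h
      have : a ∈ LinearMap.ker D := LinearMap.mem_ker.mpr (sub_eq_zero.mpr hTa)
      rw [h] at this
      exact H.ne_zero ha (by simpa using this)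
  have hrange : LinearMap.range D = ⊥ := by
    have := Submodule.finrank_quotient_add_finrank (LinearMap.ker D)
    rw [D.quotKerEquivRange.finrank_eq] at this
    exact Submodule.finrank_eq_zero.mp (by omega)
  have hD0 : D = 0 := LinearMap.range_eq_bot.mp hrange
  have h2T : (2 : ℤ) • T = α a (T a) • LinearMap.id := sub_eq_zero.mp hD0
  have htr2 := congrArg (LinearMap.trace ℤ Q) h2T
  rw [map_smul, map_smul, htr, LinearMap.trace_id] at htr2
  have h2 : (2 : ℤ) • ((finrank ℤ Q : ℤ) • T x) = (2 : ℤ) • ((2 * S.card : ℤ) • x) := by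
    rw [smul_comm, ← LinearMap.smul_apply, h2T, LinearMap.smul_apply, LinearMap.id_apply,
      smul_smul, smul_smul, ← smul_eq_mul (2 : ℤ) (2 * _), htr2]
    simp [mul_comm]
  exact smul_right_injective Q (two_ne_zero (α := ℤ)) h2

theorem sum_coroot_smul [Module.Finite ℤ Q] {h : ℕ} (hl : 0 < finrank ℤ Q)
    (hcox : Φ.card = h * finrank ℤ Q) (x : Q) :
    ∑ a ∈ Φ, α a x • a = (2 * h : ℤ) • x := by
  have := H.finrank_smul_sum subset_rfl H.map_mem x
  have h2 : (2 * Φ.card : ℤ) = finrank ℤ Q * (2 * h) := by rw [hcox]; push_cast; ring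
  rw [h2, mul_smul] at this
  exact smul_right_injective Q (by exact_mod_cast hl.ne' : (finrank ℤ Q : ℤ) ≠ 0) this

end Basic

/-- The canonical Weyl-invariant bilinear form. -/
def form (Φ : Finset Q) (α : Q → Dual ℤ Q) (x y : Q) : ℤ := ∑ b ∈ Φ, α b x * α b y

theorem form_comm (x y : Q) : form Φ α x y = form Φ α y x := by
  simp only [form, mul_comm]

theorem form_sub_left (x y z : Q) :
    form Φ α (x - y) z = form Φ α x z - form Φ α y z := by
  simp [form, sub_mul, Finset.sum_sub_distrib]

theorem form_smul_left (n : ℤ) (x z : Q) : form Φ α (n • x) z = n * form Φ α x z := by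
  simp [form, Finset.mul_sum, mul_assoc]

theorem form_neg_left (x z : Q) : form Φ α (-x) z = -form Φ α x z := by
  simp [form]

section Form

variable (H : IsIrreducibleRootSystem ρ Φ α)
include H

theorem form_self_pos {a : Q} (ha : a ∈ Φ) : 0 < form Φ α a a := by
  refine Finset.sum_pos' (fun b _ ↦ mul_self_nonneg _) ⟨a, ha, ?_⟩
  rw [H.coroot_self a ha]
  norm_num

theorem exists_coroot_map_ne_zero [Module.Finite ℤ Q] {a b : Q} (ha : a ∈ Φ) (hb : b ∈ Φ) :
    ∃ w : W, α b (ρ w a) ≠ 0 := by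
  by_contra! hcon
  set p : Submodule ℤ Q := Submodule.span ℤ (Set.range fun w : W ↦ ρ w a) with hp
  have hfin : finrank ℤ p = finrank ℤ Q := by
    refine (H.irreducible p ?_).resolve_left ?_
    · intro w x hx
      induction hx using Submodule.span_induction with
      | mem x hx =>
        obtain ⟨v, rfl⟩ := hx
        refine Submodule.subset_span ⟨w * v, ?_⟩
        simp
      | zero => simp
      | add x y _ _ hx hy => rw [map_add]; exact add_mem hx hy
      | smul n x _ hx => rw [map_smul]; exact Submodule.smul_mem _ _ hx
    · intro h
      have : a ∈ p := Submodule.subset_span ⟨1, by simp⟩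
      rw [h] at this
      exact H.ne_zero ha (by simpa using this)
  have hle : p ≤ LinearMap.ker (α b) := by
    rw [hp, Submodule.span_le]
    rintro _ ⟨w, rfl⟩
    exact hcon w
  have h1 := Submodule.finrank_mono hle
  have h2 := Submodule.finrank_quotient_add_finrank (LinearMap.ker (α b))
  rw [(α b).quotKerEquivRange.finrank_eq] at h2
  have h3 : LinearMap.range (α b) = ⊥ := Submodule.finrank_eq_zero.mp (by omega)
  have h4 := H.coroot_self b hb
  rw [LinearMap.range_eq_bot.mp h3] at h4
  norm_num at h4

variable [Module.Free ℤ Q]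

theorem form_map (w : W) (x y : Q) : form Φ α (ρ w x) (ρ w y) = form Φ α x y := by
  unfold form
  rw [← Finset.sum_comp_of_mapsTo Φ (representation_apply_injective ρ w)
    (fun a ha ↦ H.map_mem a ha w)]
  refine Finset.sum_congr rfl fun a ha ↦ ?_
  rw [H.coroot_map ha, H.coroot_map ha]

theorem coroot_mul_form {a : Q} (ha : a ∈ Φ) (y : Q) :
    α a y * form Φ α a a = 2 * form Φ α a y := by
  obtain ⟨s, hs⟩ := H.exists_reflection a ha
  have h1 := H.form_map s y a
  rw [hs, hs, H.coroot_self a ha, form_sub_left, form_smul_left, two_smul, sub_add_cancel_left,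
    form_comm y, form_comm a, form_neg_left, form_neg_left, form_comm a y] at h1
  rw [form_comm a y]
  linarith

theorem coroot_mul_form_comm {a b : Q} (ha : a ∈ Φ) (hb : b ∈ Φ) :
    α a b * form Φ α a a = α b a * form Φ α b b := by
  rw [H.coroot_mul_form ha, H.coroot_mul_form hb, form_comm]

theorem coroot_mul_coroot_mul {a b : Q} (ha : a ∈ Φ) (hb : b ∈ Φ) :
    α a b * α b a * (form Φ α a a * form Φ α b b) = 4 * form Φ α a b ^ 2 := by
  have h1 := H.coroot_mul_form ha b
  have h2 := H.coroot_mul_form hb a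
  rw [form_comm b a] at h2
  linear_combination (α b a * form Φ α b b) * h1 + (2 * form Φ α a b) * h2

theorem coroot_mul_coroot_nonneg {a b : Q} (ha : a ∈ Φ) (hb : b ∈ Φ) : 0 ≤ α a b * α b a := by
  have h1 := H.coroot_mul_coroot_mul ha hb
  have h2 := mul_pos (H.form_self_pos ha) (H.form_self_pos hb)
  by_contra! hlt
  nlinarith [sq_nonneg (form Φ α a b)]

theorem coroot_mul_coroot_le {a b : Q} (ha : a ∈ Φ) (hb : b ∈ Φ) : α a b * α b a ≤ 4 := by
  have h1 := H.coroot_mul_coroot_mul ha hb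
  have h2 := mul_pos (H.form_self_pos ha) (H.form_self_pos hb)
  have h3 : form Φ α a b ^ 2 ≤ form Φ α a a * form Φ α b b := by
    simpa only [form, sq] using Finset.sum_mul_sq_le_sq_mul_sq Φ (fun c ↦ α c a) fun c ↦ α c b
  by_contra! hlt
  nlinarith

theorem coroot_eq_zero_iff {a b : Q} (ha : a ∈ Φ) (hb : b ∈ Φ) : α a b = 0 ↔ α b a = 0 := by
  have h := H.coroot_mul_form_comm ha hb
  have h1 := (H.form_self_pos ha).ne'
  have h2 := (H.form_self_pos hb).ne'
  constructor <;> intro h0 <;> simp_all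

theorem coroot_comm_of_form_eq {a b : Q} (ha : a ∈ Φ) (hb : b ∈ Φ)
    (hab : form Φ α a a = form Φ α b b) : α a b = α b a := by
  have h := H.coroot_mul_form_comm ha hb
  rw [hab] at h
  exact mul_right_cancel₀ (H.form_self_pos hb).ne' h

theorem coroot_mem_Icc_of_form_eq {a b : Q} (ha : a ∈ Φ) (hb : b ∈ Φ)
    (hab : form Φ α a a = form Φ α b b) : -2 ≤ α a b ∧ α a b ≤ 2 := by
  have h := H.coroot_mul_coroot_le ha hb
  rw [← H.coroot_comm_of_form_eq ha hb hab] at h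
  constructor <;> nlinarith

variable [Module.Finite ℤ Q]

theorem eq_zero_of_forall_coroot {z : Q} (hz : ∀ b ∈ Φ, α b z = 0) : z = 0 := by
  have h := H.finrank_smul_sum subset_rfl H.map_mem z
  rw [Finset.sum_eq_zero fun b hb ↦ by rw [hz b hb, zero_smul], smul_zero] at h
  rcases smul_eq_zero.mp h.symm with h | h
  · have hΦ : Φ = ∅ := by simpa using h
    have := H.span_eq_top
    rw [hΦ, Finset.coe_empty, Submodule.span_empty] at this
    exact (Submodule.mem_bot ℤ).mp (this ▸ Submodule.mem_top)
  · exact h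

theorem eq_or_eq_neg_of_coroot_mul {a b : Q} (ha : a ∈ Φ) (hb : b ∈ Φ)
    (h4 : α a b * α b a = 4) : b = a ∨ b = -a := by
  have hform : form Φ α ((2 : ℤ) • b - α a b • a) ((2 : ℤ) • b - α a b • a) = 0 := by
    have h1 := H.coroot_mul_form ha b
    have h2 := H.coroot_mul_form_comm ha hb
    rw [form_sub_left, form_smul_left, form_smul_left, form_comm b, form_comm a, form_sub_left,
      form_sub_left, form_smul_left, form_smul_left, form_smul_left, form_smul_left, form_comm b a]
    linear_combination (2 * α a b) * h1 - α a b * h2 - form Φ α b b * h4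
  have hz : (2 : ℤ) • b - α a b • a = 0 := by
    refine H.eq_zero_of_forall_coroot fun c hc ↦ ?_
    have := (Finset.sum_eq_zero_iff_of_nonneg fun c _ ↦ mul_self_nonneg _).mp hform c hc
    exact mul_self_eq_zero.mp this
  have h2b : (2 : ℤ) • b = α a b • a := sub_eq_zero.mp hz
  have hle : (α a b).natAbs ≤ 4 :=
    Nat.le_of_dvd (by norm_num) (Int.natAbs_dvd_natAbs.mpr (Dvd.intro _ h4))
  have hinj := smul_right_injective Q (two_ne_zero (α := ℤ))
  have hcases : α a b = 1 ∨ α a b = -1 ∨ α a b = 2 ∨ α a b = -2 ∨ α a b = 4 ∨ α a b = -4 := by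
    have hb1 : -4 ≤ α a b := by omega
    have hb2 : α a b ≤ 4 := by omega
    generalize α a b = m at *
    interval_cases m <;> omega
  rcases hcases with h | h | h | h | h | h <;> rw [h] at h2b
  · exact absurd (by rwa [h2b, one_smul]) (H.two_smul_notMem b hb)
  · exact absurd (by rw [h2b, neg_one_smul]; exact H.neg_mem ha) (H.two_smul_notMem b hb)
  · exact Or.inl (hinj h2b)
  · exact Or.inr (hinj (by simpa using h2b))
  · have : b = (2 : ℤ) • a := hinj (by simp only [h2b, smul_smul]; norm_num)
    exact absurd (this ▸ hb) (H.two_smul_notMem a ha)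
  · have : -b = (2 : ℤ) • a := hinj (by simp only [smul_neg, h2b, smul_smul]; simp)
    exact absurd (this ▸ H.neg_mem hb) (H.two_smul_notMem a ha)

theorem coroot_mul_coroot_le_three {a b : Q} (ha : a ∈ Φ) (hb : b ∈ Φ) (h1 : b ≠ a)
    (h2 : b ≠ -a) : α a b * α b a ≤ 3 := by
  have := H.coroot_mul_coroot_le ha hb
  have h4 : α a b * α b a ≠ 4 := fun h ↦ (H.eq_or_eq_neg_of_coroot_mul ha hb h).elim h1 h2
  omega

theorem eq_of_coroot_eq_two {a b : Q} (ha : a ∈ Φ) (hb : b ∈ Φ)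
    (hab : form Φ α a a = form Φ α b b) (h2 : α a b = 2) : b = a := by
  have h4 : α a b * α b a = 4 := by
    rw [← H.coroot_comm_of_form_eq ha hb hab, h2]; norm_num
  refine (H.eq_or_eq_neg_of_coroot_mul ha hb h4).resolve_right ?_
  rintro rfl
  rw [map_neg, H.coroot_self a ha] at h2
  norm_num at h2

theorem form_ratio_of_coroot_ne_zero {b c : Q} (hb : b ∈ Φ) (hc : c ∈ Φ) (h0 : α b c ≠ 0) :
    form Φ α b b = form Φ α c c ∨ form Φ α b b = 2 * form Φ α c c ∨
      form Φ α b b = 3 * form Φ α c c ∨ 2 * form Φ α b b = form Φ α c c ∨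
      3 * form Φ α b b = form Φ α c c := by
  have h0' : α c b ≠ 0 := fun h ↦ h0 ((H.coroot_eq_zero_iff hb hc).mpr h)
  have hcomm := H.coroot_mul_form_comm hb hc
  have hnn := H.coroot_mul_coroot_nonneg hb hc
  by_cases h1 : c = b
  · exact Or.inl (by rw [h1])
  by_cases h2 : c = -b
  · left
    rw [h2, form_neg_left, form_comm b (-b), form_neg_left, neg_neg]
  have h3 := H.coroot_mul_coroot_le_three hb hc h1 h2
  have hbc : -3 ≤ α b c ∧ α b c ≤ 3 := by
    rcases lt_or_gt_of_ne h0 with h | h <;> rcases lt_or_gt_of_ne h0' with h' | h' <;>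
      constructor <;> nlinarith
  have hcb : -3 ≤ α c b ∧ α c b ≤ 3 := by
    rcases lt_or_gt_of_ne h0 with h | h <;> rcases lt_or_gt_of_ne h0' with h' | h' <;>
      constructor <;> nlinarith
  obtain ⟨l1, u1⟩ := hbc
  obtain ⟨l2, u2⟩ := hcb
  generalize α b c = m at *
  generalize α c b = n at *
  interval_cases m <;> interval_cases n <;> omega

theorem form_eq_or_form_eq {a e : Q} (ha : a ∈ Φ) (he : e ∈ Φ)
    (hk : form Φ α a a = 2 * form Φ α e e ∨ form Φ α a a = 3 * form Φ α e e) {b : Q}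
    (hb : b ∈ Φ) : form Φ α b b = form Φ α e e ∨ form Φ α b b = form Φ α a a := by
  obtain ⟨v, hv⟩ := H.exists_coroot_map_ne_zero ha hb
  obtain ⟨w, hw⟩ := H.exists_coroot_map_ne_zero he hb
  have h1 := H.form_ratio_of_coroot_ne_zero hb (H.map_mem a ha v) hv
  have h2 := H.form_ratio_of_coroot_ne_zero hb (H.map_mem e he w) hw
  rw [H.form_map] at h1 h2
  have := H.form_self_pos he
  omega

end Form

section Parity

variable (H : IsIrreducibleRootSystem ρ Φ α) [Module.Free ℤ Q]
include H

theorem form_sub_smul {a : Q} (ha : a ∈ Φ) (x : Q) :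
    form Φ α (x - α a x • a) (x - α a x • a) = form Φ α x x := by
  obtain ⟨s, hs⟩ := H.exists_reflection a ha
  rw [← hs, H.form_map]

theorem map_mem_filter_form (n : ℤ) : ∀ b ∈ {b ∈ Φ | form Φ α b b = n}, ∀ w : W,
    ρ w b ∈ {b ∈ Φ | form Φ α b b = n} := by
  intro b hb w
  rw [Finset.mem_filter] at hb ⊢
  exact ⟨H.map_mem b hb.1 w, by rw [H.form_map, hb.2]⟩

theorem sum_filter_pos_coroot {S : Finset Q} (hS : S ⊆ Φ) (hneg : ∀ b ∈ S, -b ∈ S) (a : Q) :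
    ∑ b ∈ S, α b a * α a b = 2 * ∑ b ∈ S with 0 < α a b, α b a * α a b := by
  have h0 : ∑ b ∈ S, α b a * α a b = ∑ b ∈ S with α a b ≠ 0, α b a * α a b := by
    refine (Finset.sum_filter_of_ne fun b _ h ↦ ?_).symm
    exact right_ne_zero_of_mul h
  rw [h0, Finset.sum_eq_two_nsmul_sum_filter_lt _ neg_involutive ?_ (fun b ↦ -α a b) ?_ _ ?_,
    Finset.filter_filter, nsmul_eq_mul, Nat.cast_ofNat]
  · congr 2
    ext b
    simp only [Finset.mem_filter, map_neg]
    refine and_congr_right fun _ ↦ ?_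
    omega
  · intro b hb
    simp only [Finset.mem_filter, map_neg] at hb ⊢
    exact ⟨hneg b hb.1, by simpa using hb.2⟩
  · intro b hb
    simp only [Finset.mem_filter, map_neg] at hb ⊢
    omega
  · intro b hb
    rw [H.coroot_neg (hS (Finset.mem_filter.mp hb).1), map_neg, neg_mul_neg]

theorem finrank_mul_sum [Module.Finite ℤ Q] {S : Finset Q} (hS : S ⊆ Φ)
    (hSW : ∀ a ∈ S, ∀ w : W, ρ w a ∈ S) {a : Q} (ha : a ∈ Φ) :
    finrank ℤ Q * ∑ b ∈ S, α b a * α a b = 4 * (S.card : ℤ) := by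
  have := congrArg (α a) (H.finrank_smul_sum hS hSW a)
  simp only [map_smul, map_sum, smul_eq_mul, H.coroot_self a ha] at this
  rw [this]
  ring

variable [Module.Finite ℤ Q]

theorem four_mul_dvd_sum {S : Finset Q} (hS : S ⊆ Φ) (hSW : ∀ a ∈ S, ∀ w : W, ρ w a ∈ S) {a : Q}
    (ha : a ∈ Φ) (haS : a ∉ S) {d : ℤ} (hd : ∀ b ∈ S, d ∣ α b a * α a b) :
    4 * d ∣ ∑ b ∈ S, α b a * α a b := by
  have hsub : ∀ c ∈ Φ, ∀ b ∈ S, b - α c b • c ∈ S := fun c hc b hb ↦ by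
    obtain ⟨s, hs⟩ := H.exists_reflection c hc
    exact hs b ▸ hSW b hb s
  have hneg : ∀ b ∈ S, -b ∈ S := fun b hb ↦ by
    have := hsub b (hS hb) b hb
    rwa [H.coroot_self b (hS hb), two_smul, sub_add_cancel_left] at this
  classical
  let : LinearOrder Q := linearOrderOfSTO WellOrderingRel
  have hσ : Function.Involutive fun b : Q ↦ α a b • a - b := fun b ↦ by
    simp only [map_sub, map_smul, smul_eq_mul, H.coroot_self a ha]
    module
  rw [H.sum_filter_pos_coroot hS hneg a,
    Finset.sum_eq_two_nsmul_sum_filter_lt _ hσ ?_ id ?_ _ ?_, nsmul_eq_mul, Nat.cast_ofNat,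
    ← mul_assoc]
  · exact mul_dvd_mul (by norm_num) (Finset.dvd_sum fun b hb ↦
      hd b (Finset.mem_filter.mp (Finset.mem_filter.mp hb).1).1)
  · intro b hb
    simp only [Finset.mem_filter, map_sub, map_smul, smul_eq_mul, H.coroot_self a ha] at hb ⊢
    refine ⟨?_, by linarith [hb.2]⟩
    rw [← neg_sub]
    exact hneg _ (hsub a ha b hb.1)
  · intro b hb h
    have hbS := (Finset.mem_filter.mp hb).1
    have h4 := congrArg (α b) h
    simp only [map_sub, map_smul, smul_eq_mul, id, H.coroot_self b (hS hbS)] at h4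
    rcases H.eq_or_eq_neg_of_coroot_mul ha (hS hbS) (by linarith) with h | h
    · exact haS (h ▸ hbS)
    · exact haS (by simpa [h] using hneg b hbS)
  · intro b hb
    have hbS := (Finset.mem_filter.mp hb).1
    rw [← neg_sub, H.coroot_neg (hS (hsub a ha b hbS)), H.coroot_sub_smul ha (hS hbS),
      map_neg]
    simp only [map_sub, map_smul, smul_eq_mul, H.coroot_self a ha]
    ring

theorem sum_eq_twelve_of_short {a e : Q} (ha : a ∈ Φ) (he : e ∈ Φ)
    (hk : form Φ α a a = 3 * form Φ α e e) (h1 : α a e = 1) :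
    ∑ b ∈ Φ with form Φ α b b = form Φ α e e, α b a * α a b = 12 := by
  classical
  have hpos := H.form_self_pos he
  have h3 : α e a = 3 := by
    have := H.coroot_mul_form_comm ha he
    rw [h1, hk] at this
    nlinarith
  have hd : e - a ∈ Φ := by simpa [h1] using H.sub_smul_mem ha he
  have hdf : form Φ α (e - a) (e - a) = form Φ α e e := by simpa [h1] using H.form_sub_smul ha e
  have hda (x : Q) : α (e - a) x = α e x - 3 * α a x := by
    have := H.coroot_sub_smul ha he x
    rw [h1, one_smul] at this
    simp only [this, map_sub, map_smul, smul_eq_mul, h3]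
    ring
  have hc := H.sub_smul_mem he hd
  have hcf := H.form_sub_smul he (e - a)
  have hca (x : Q) : α (e - a - α e (e - a) • e) x = 2 * α e x - 3 * α a x := by
    rw [H.coroot_sub_smul he hd x, hda]
    simp only [map_sub, map_smul, smul_eq_mul, H.coroot_self e he, h1]
    ring
  rw [H.sum_filter_pos_coroot (Finset.filter_subset _ _) ?_ a]
  · have : {b ∈ {b ∈ Φ | form Φ α b b = form Φ α e e} | 0 < α a b} = {e, a - e} := by
      ext b
      simp only [Finset.mem_filter, Finset.mem_insert, Finset.mem_singleton]
      constructor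
      · rintro ⟨⟨hb, hbf⟩, hab⟩
        have hba : α b a = 3 * α a b := by
          have := H.coroot_mul_form_comm ha hb
          rw [hbf, hk] at this
          nlinarith
        have hle := H.coroot_mul_coroot_le ha hb
        have hab1 : α a b = 1 := by rw [hba] at hle; nlinarith
        have hle := H.coroot_mem_Icc_of_form_eq hc hb (by rw [hcf, hdf, hbf])
        rw [hca, hab1] at hle
        obtain h | h : α e b = 2 ∨ α e b = 1 := by omega
        · exact Or.inl (H.eq_of_coroot_eq_two he hb hbf.symm h)
        · right
          rw [← neg_sub e a]
          refine H.eq_of_coroot_eq_two (H.neg_mem hd) hb ?_ ?_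
          · rw [form_neg_left, form_comm _ (-_), form_neg_left, neg_neg, hdf, hbf]
          · rw [H.coroot_neg hd, hda, h, hab1]
            norm_num
      · rintro (rfl | rfl)
        · exact ⟨⟨he, rfl⟩, by omega⟩
        · refine ⟨⟨neg_sub e a ▸ H.neg_mem hd, ?_⟩, ?_⟩
          · rw [← neg_sub e a, form_neg_left, form_comm _ (-_), form_neg_left, neg_neg, hdf]
          · rw [map_sub, H.coroot_self a ha, h1]
            norm_num
    rw [this, Finset.sum_pair, ← neg_sub e a, H.coroot_neg hd, hda, h3, h1, map_neg, map_sub, h1,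
      H.coroot_self a ha]
    · norm_num
    · intro h
      refine H.two_smul_notMem e he ?_
      rw [two_smul]
      nth_rw 2 [h]
      simpa using ha
  · intro b hb
    simp only [Finset.mem_filter] at hb ⊢
    exact ⟨H.neg_mem hb.1, by rw [form_neg_left, form_comm, form_neg_left, neg_neg, hb.2]⟩

theorem sum_eq_twelve_of_long {a e : Q} (ha : a ∈ Φ) (he : e ∈ Φ)
    (hk : form Φ α a a = 3 * form Φ α e e) (h1 : α a e = 1) :
    ∑ b ∈ Φ with form Φ α b b = form Φ α a a, α b e * α e b = 12 := by
  classical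
  have hpos := H.form_self_pos he
  have h3 : α e a = 3 := by
    have := H.coroot_mul_form_comm ha he
    rw [h1, hk] at this
    nlinarith
  have hd : a - (3 : ℤ) • e ∈ Φ := by simpa [h3] using H.sub_smul_mem he ha
  have hdf : form Φ α (a - (3 : ℤ) • e) (a - (3 : ℤ) • e) = form Φ α a a := by
    simpa [h3] using H.form_sub_smul he a
  have hda (x : Q) : α (a - (3 : ℤ) • e) x = α a x - α e x := by
    have := H.coroot_sub_smul he ha x
    rw [h3] at this
    simp only [this, map_sub, map_smul, smul_eq_mul, h1, mul_one]
  rw [H.sum_filter_pos_coroot (Finset.filter_subset _ _) ?_ e]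
  · have : {b ∈ {b ∈ Φ | form Φ α b b = form Φ α a a} | 0 < α e b} = {a, (3 : ℤ) • e - a} := by
      ext b
      simp only [Finset.mem_filter, Finset.mem_insert, Finset.mem_singleton]
      constructor
      · rintro ⟨⟨hb, hbf⟩, hab⟩
        have hba : α e b = 3 * α b e := by
          have := H.coroot_mul_form_comm he hb
          rw [hbf, hk] at this
          nlinarith
        have hle := H.coroot_mul_coroot_le he hb
        have hab1 : α e b = 3 := by
          have h0 : 0 < α b e := by omega
          have : α b e = 1 := by rw [hba] at hle; nlinarith
          rw [hba, this, mul_one]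
        have hle := H.coroot_mem_Icc_of_form_eq hd hb (by rw [hdf, hbf])
        have hle' := H.coroot_mem_Icc_of_form_eq ha hb hbf.symm
        rw [hda, hab1] at hle
        obtain h | h : α a b = 2 ∨ α a b = 1 := by omega
        · exact Or.inl (H.eq_of_coroot_eq_two ha hb hbf.symm h)
        · right
          rw [← neg_sub a]
          refine H.eq_of_coroot_eq_two (H.neg_mem hd) hb ?_ ?_
          · rw [form_neg_left, form_comm _ (-_), form_neg_left, neg_neg, hdf, hbf]
          · rw [H.coroot_neg hd, hda, h, hab1]
            norm_num
      · rintro (rfl | rfl)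
        · exact ⟨⟨ha, rfl⟩, by omega⟩
        · refine ⟨⟨neg_sub a ((3 : ℤ) • e) ▸ H.neg_mem hd, ?_⟩, ?_⟩
          · rw [← neg_sub a, form_neg_left, form_comm _ (-_), form_neg_left, neg_neg, hdf]
          · rw [map_sub, map_smul, H.coroot_self e he, h3]
            norm_num
    rw [this, Finset.sum_pair, ← neg_sub a, H.coroot_neg hd, hda, h3, h1, map_neg, map_sub,
      map_smul, h3, H.coroot_self e he]
    · norm_num
    · intro h
      have := congrArg (α a) h
      rw [map_sub, map_smul, h1, H.coroot_self a ha] at this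
      norm_num at this
  · intro b hb
    simp only [Finset.mem_filter] at hb ⊢
    exact ⟨H.neg_mem hb.1, by rw [form_neg_left, form_comm, form_neg_left, neg_neg, hb.2]⟩

theorem sum_short_add_sum_long {h : ℕ} (hcox : Φ.card = h * finrank ℤ Q) {a e : Q} (ha : a ∈ Φ)
    (he : e ∈ Φ)
    (hk : form Φ α a a = 2 * form Φ α e e ∨ form Φ α a a = 3 * form Φ α e e) :
    ∑ b ∈ Φ with form Φ α b b = form Φ α e e, α b a * α a b +
      ∑ b ∈ Φ with form Φ α b b = form Φ α a a, α b e * α e b = 4 * (h : ℤ) := by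
  classical
  have hpos := H.form_self_pos he
  have h1 := H.finrank_mul_sum (Finset.filter_subset _ _) (H.map_mem_filter_form (form Φ α e e)) ha
  have h2 := H.finrank_mul_sum (Finset.filter_subset _ _) (H.map_mem_filter_form (form Φ α a a)) he
  have hcard : ({b ∈ Φ | form Φ α b b = form Φ α e e}.card : ℤ) +
      {b ∈ Φ | form Φ α b b = form Φ α a a}.card = h * finrank ℤ Q := by
    rw [← Nat.cast_add, ← Finset.card_union_of_disjoint, ← Nat.cast_mul, ← hcox]
    · congr 2
      ext b
      simp only [Finset.mem_union, Finset.mem_filter, ← and_or_left]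
      exact ⟨fun hb ↦ hb.1, fun hb ↦ ⟨hb, H.form_eq_or_form_eq ha he hk hb⟩⟩
    · rw [Finset.disjoint_filter]
      intro b _ h1 h2
      omega
  have hl : (finrank ℤ Q : ℤ) ≠ 0 := by
    intro h0
    have : Φ.card = 0 := by rw [hcox]; exact mul_eq_zero_of_right _ (by exact_mod_cast h0)
    rw [Finset.card_eq_zero.mp this] at ha
    exact Finset.notMem_empty _ ha
  refine mul_left_cancel₀ hl ?_
  linear_combination h1 + h2 + 4 * hcard

theorem even_of_form_ne {h : ℕ} (hcox : Φ.card = h * finrank ℤ Q) {a e : Q} (ha : a ∈ Φ)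
    (he : e ∈ Φ) (hae : α a e ≠ 0)
    (hk : form Φ α a a = 2 * form Φ α e e ∨ form Φ α a a = 3 * form Φ α e e) : Even h := by
  have hsum := H.sum_short_add_sum_long hcox ha he hk
  have hpos := H.form_self_pos he
  rcases hk with hk | hk
  · have h1 := H.four_mul_dvd_sum (d := 2) (Finset.filter_subset _ _)
      (H.map_mem_filter_form (form Φ α e e)) ha (by rw [Finset.mem_filter]; omega)
      (fun b hb ↦ by
        obtain ⟨hb, hbf⟩ := Finset.mem_filter.mp hb
        have := H.coroot_mul_form_comm ha hb
        rw [hbf, hk] at this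
        have : α b a = 2 * α a b := by nlinarith
        rw [this, mul_assoc]
        exact dvd_mul_right _ _)
    have h2 := H.four_mul_dvd_sum (d := 2) (Finset.filter_subset _ _)
      (H.map_mem_filter_form (form Φ α a a)) he (by rw [Finset.mem_filter]; omega)
      (fun b hb ↦ by
        obtain ⟨hb, hbf⟩ := Finset.mem_filter.mp hb
        have := H.coroot_mul_form_comm he hb
        rw [hbf, hk] at this
        have : α e b = 2 * α b e := by nlinarith
        rw [this, mul_left_comm]
        exact dvd_mul_right _ _)
    have := dvd_add h1 h2
    rw [hsum] at this
    rw [Nat.even_iff]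
    omega
  · wlog h1 : 0 < α a e generalizing a
    · have hf : form Φ α (-a) (-a) = form Φ α a a := by
        rw [form_neg_left, form_comm, form_neg_left, neg_neg]
      refine this (H.neg_mem ha) ?_ ?_ (by rw [hf, hk]) ?_
      · rwa [H.coroot_neg ha, neg_ne_zero]
      · exact H.sum_short_add_sum_long hcox (H.neg_mem ha) he (Or.inr (by rw [hf, hk]))
      · rw [H.coroot_neg ha]
        omega
    have h3 : α e a = 3 * α a e := by
      have := H.coroot_mul_form_comm ha he
      rw [hk] at this
      nlinarith
    have hle := H.coroot_mul_coroot_le ha he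
    have h1 : α a e = 1 := by rw [h3] at hle; nlinarith
    rw [H.sum_eq_twelve_of_short ha he hk h1, H.sum_eq_twelve_of_long ha he hk h1] at hsum
    rw [Nat.even_iff]
    omega

/-- If the Coxeter number is odd then all roots have the same length. -/
theorem form_eq_of_odd {h : ℕ} (hcox : Φ.card = h * finrank ℤ Q) (hodd : Odd h) {a b : Q}
    (ha : a ∈ Φ) (hb : b ∈ Φ) : form Φ α a a = form Φ α b b := by
  have hne := Nat.not_even_iff_odd.mpr hodd
  obtain ⟨w, hw⟩ := H.exists_coroot_map_ne_zero ha hb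
  have hwa := H.map_mem a ha w
  have hw' : α (ρ w a) b ≠ 0 := fun h ↦ hw ((H.coroot_eq_zero_iff hb hwa).mpr h)
  rw [← H.form_map w a a]
  rcases H.form_ratio_of_coroot_ne_zero hb hwa hw with h | h | h | h | h
  · exact h.symm
  · exact absurd (H.even_of_form_ne hcox hb hwa hw (Or.inl h)) hne
  · exact absurd (H.even_of_form_ne hcox hb hwa hw (Or.inr h)) hne
  · exact absurd (H.even_of_form_ne hcox hwa hb hw' (Or.inl h.symm)) hne
  · exact absurd (H.even_of_form_ne hcox hwa hb hw' (Or.inr h.symm)) hne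

end Parity

theorem exists_smul_add_sign {A : Type*} (S : Finset A) (g e : A → ℤ) :
    ∃ M : ℤ, ∀ b ∈ S, g b ≠ 0 → 0 < (M * g b + e b) * g b := by
  refine ⟨∑ b ∈ S, |e b| + 1, fun b hb hg ↦ ?_⟩
  have h1 : |e b| ≤ ∑ b ∈ S, |e b| :=
    Finset.single_le_sum (f := fun b ↦ |e b|) (fun _ _ ↦ abs_nonneg _) hb
  have h2 := abs_le.mp h1
  rcases lt_or_gt_of_ne hg with h | h
  · exact mul_pos_of_neg_of_neg (by nlinarith) h
  · exact mul_pos (by nlinarith) h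

theorem exists_dual_ne_zero [Module.Free ℤ Q] (S : Finset Q) (hS : ∀ b ∈ S, b ≠ 0) :
    ∃ f : Dual ℤ Q, ∀ b ∈ S, f b ≠ 0 := by
  classical
  induction S using Finset.induction_on with
  | empty => exact ⟨0, by simp⟩
  | insert v S _ ih =>
    obtain ⟨g, hg⟩ := ih fun b hb ↦ hS b (Finset.mem_insert_of_mem hb)
    obtain ⟨e, he⟩ : ∃ e : Dual ℤ Q, e v ≠ 0 := by
      by_contra! h
      exact hS v (Finset.mem_insert_self v S) ((Module.forall_dual_apply_eq_zero_iff ℤ v).mp h)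
    by_cases hv : g v = 0
    · obtain ⟨M, hM⟩ := exists_smul_add_sign S g e
      refine ⟨M • g + e, fun b hb ↦ ?_⟩
      rcases Finset.mem_insert.mp hb with rfl | hb
      · simpa [hv] using he
      · exact left_ne_zero_of_mul (hM b hb (hg b hb)).ne'
    · refine ⟨g, fun b hb ↦ ?_⟩
      rcases Finset.mem_insert.mp hb with rfl | hb
      exacts [hv, hg b hb]

/-- The product of the reflections in a list of roots. -/
def reflectionProd (α : Q → Dual ℤ Q) (L : List Q) : Module.End ℤ Q :=
  (L.map fun c ↦ preReflection c (α c)).prod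

@[simp]
theorem reflectionProd_nil : reflectionProd α [] = 1 := rfl

@[simp]
theorem reflectionProd_cons (c : Q) (L : List Q) :
    reflectionProd α (c :: L) = preReflection c (α c) * reflectionProd α L := by
  simp [reflectionProd]

@[simp]
theorem reflectionProd_append (L₁ L₂ : List Q) :
    reflectionProd α (L₁ ++ L₂) = reflectionProd α L₁ * reflectionProd α L₂ := by
  simp [reflectionProd]

/-- The indecomposable roots among those on which the functional `f` is positive. -/
def simpleRoots (Φ : Finset Q) (f : Dual ℤ Q) : Set Q :=
  {c | c ∈ Φ ∧ 0 < f c ∧ ∀ p ∈ Φ, ∀ q ∈ Φ, 0 < f p → 0 < f q → c ≠ p + q}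

theorem exists_mem_simpleRoots {f g : Dual ℤ Q} {b : Q} (hb : b ∈ Φ) (hf : 0 < f b)
    (hg : 0 < g b) : ∃ c ∈ simpleRoots Φ f, 0 < g c := by
  induction hn : (f b).toNat using Nat.strong_induction_on generalizing b with
  | _ n ih =>
    by_cases hΔ : b ∈ simpleRoots Φ f
    · exact ⟨b, hΔ, hg⟩
    simp only [simpleRoots, Set.mem_ofPred_eq, not_and, not_forall] at hΔ
    obtain ⟨p, hp, q, hq, hfp, hfq, hbpq⟩ := hΔ hb hf
    rw [not_ne_iff] at hbpq
    subst hbpq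
    rw [map_add] at hf hg hn
    by_cases hgp : 0 < g p
    · exact ih _ (by omega) hp hfp hgp rfl
    · exact ih _ (by omega) hq hfq (by omega) rfl

section Reflection

variable (H : IsIrreducibleRootSystem ρ Φ α)
include H

theorem preReflection_mul_self {c : Q} (hc : c ∈ Φ) :
    preReflection c (α c) * preReflection c (α c) = 1 :=
  LinearMap.ext (involutive_preReflection (H.coroot_self c hc))

theorem exists_eq_reflectionProd {L : List Q} (hL : ∀ c ∈ L, c ∈ Φ) :
    ∃ w : W, ρ w = reflectionProd α L := by
  induction L with
  | nil => exact ⟨1, by simp⟩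
  | cons c L ih =>
    obtain ⟨w, hw⟩ := ih fun d hd ↦ hL d (List.mem_cons_of_mem c hd)
    obtain ⟨s, hs⟩ := H.exists_reflection c (hL c List.mem_cons_self)
    refine ⟨s * w, ?_⟩
    rw [map_mul, hw, reflectionProd_cons]
    congr 1
    ext x
    rw [hs, preReflection_apply]

theorem reflectionProd_reverse_mul {L : List Q} (hL : ∀ c ∈ L, c ∈ Φ) :
    reflectionProd α L.reverse * reflectionProd α L = 1 := by
  induction L with
  | nil => simp
  | cons c L ih =>
    rw [List.reverse_cons, reflectionProd_append, reflectionProd_cons, reflectionProd_cons,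
      reflectionProd_nil, mul_one, mul_assoc, ← mul_assoc (preReflection _ _),
      H.preReflection_mul_self (hL c List.mem_cons_self), one_mul]
    exact ih fun d hd ↦ hL d (List.mem_cons_of_mem c hd)

variable [Module.Free ℤ Q]

theorem map_mul_preReflection {c : Q} (hc : c ∈ Φ) (w : W) :
    ρ w * preReflection c (α c) = preReflection (ρ w c) (α (ρ w c)) * ρ w := by
  ext x
  simp [preReflection_apply, H.coroot_map hc]

theorem preReflection_neg {c : Q} (hc : c ∈ Φ) :
    preReflection (-c) (α (-c)) = preReflection c (α c) := by
  ext x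
  simp [preReflection_apply, H.coroot_neg hc]

/-- A functional that is generic on roots and whose positive roots pair nonnegatively with `a`. -/
theorem exists_generic_dual (a : Q) :
    ∃ f : Dual ℤ Q, (∀ b ∈ Φ, f b ≠ 0) ∧ ∀ b ∈ Φ, 0 < f b → 0 ≤ α a b := by
  obtain ⟨g, hg⟩ := exists_dual_ne_zero Φ fun b hb ↦ H.ne_zero hb
  obtain ⟨M, hM⟩ := exists_smul_add_sign Φ (α a) g
  refine ⟨M • α a + g, fun b hb ↦ ?_, fun b hb hf ↦ ?_⟩
  · by_cases h0 : α a b = 0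
    · simpa [h0] using hg b hb
    · exact left_ne_zero_of_mul (hM b hb h0).ne'
  · by_contra! h
    have := hM b hb h.ne
    exact (mul_neg_of_pos_of_neg hf h).not_gt this

end Reflection

section SimplyLaced

variable (H : IsIrreducibleRootSystem ρ Φ α) [Module.Free ℤ Q]
  (hlen : ∀ a ∈ Φ, ∀ b ∈ Φ, form Φ α a a = form Φ α b b)
include H hlen

theorem coroot_comm {a b : Q} (ha : a ∈ Φ) (hb : b ∈ Φ) : α a b = α b a :=
  H.coroot_comm_of_form_eq ha hb (hlen a ha b hb)

variable [Module.Finite ℤ Q]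

theorem coroot_cases {a b : Q} (ha : a ∈ Φ) (hb : b ∈ Φ) :
    b = a ∨ b = -a ∨ α a b = 0 ∨ α a b = 1 ∨ α a b = -1 := by
  have hle := H.coroot_mem_Icc_of_form_eq ha hb (hlen a ha b hb)
  by_cases h2 : α a b = 2
  · exact Or.inl (H.eq_of_coroot_eq_two ha hb (hlen a ha b hb) h2)
  by_cases h2' : α a b = -2
  · refine Or.inr (Or.inl ?_)
    refine H.eq_of_coroot_eq_two (H.neg_mem ha) hb (hlen _ (H.neg_mem ha) b hb) ?_
    rw [H.coroot_neg ha, h2', neg_neg]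
  omega

theorem preReflection_pos {f : Dual ℤ Q} (hf : ∀ b ∈ Φ, f b ≠ 0) {c b : Q}
    (hc : c ∈ simpleRoots Φ f) (hb : b ∈ Φ) (hbc : b ≠ c) (hfb : 0 < f b) :
    0 < f (preReflection c (α c) b) := by
  obtain ⟨hcΦ, hfc, hcd⟩ := hc
  rw [preReflection_apply]
  rcases H.coroot_cases hlen hcΦ hb with h | h | h | h | h
  · exact absurd h hbc
  · rw [h, map_neg] at hfb
    omega
  · simpa [h] using hfb
  · have hmem := H.sub_smul_mem hcΦ hb
    rw [h, one_smul] at hmem ⊢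
    refine lt_of_le_of_ne (not_lt.mp fun hlt ↦ ?_) (hf _ hmem).symm
    have := hcd b hb (c - b) (neg_sub b c ▸ H.neg_mem hmem) hfb
      (by rw [map_sub] at hlt ⊢; omega)
    exact this (by abel)
  · simp [h]
    omega

/-- Every reflection is a product of reflections in simple roots. -/
theorem exists_preReflection_eq_reflectionProd {f : Dual ℤ Q} (hf : ∀ b ∈ Φ, f b ≠ 0) {a : Q}
    (ha : a ∈ Φ) : ∃ L : List Q, (∀ c ∈ L, c ∈ simpleRoots Φ f) ∧
      preReflection a (α a) = reflectionProd α L := by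
  wlog hfa : 0 < f a generalizing a
  · rw [← H.preReflection_neg ha]
    refine this (H.neg_mem ha) ?_
    have := hf a ha
    rw [map_neg]
    omega
  induction hn : (f a).toNat using Nat.strong_induction_on generalizing a with
  | _ n ih =>
    by_cases hΔ : a ∈ simpleRoots Φ f
    · exact ⟨[a], by simpa using hΔ, by simp⟩
    obtain ⟨c, hc, hac⟩ := exists_mem_simpleRoots (g := α a) ha hfa
      (by rw [H.coroot_self a ha]; norm_num)
    have hne : a ≠ c := fun h ↦ hΔ (h ▸ hc)
    have hcΦ := hc.1
    obtain ⟨s, hs⟩ := H.exists_reflection c hcΦ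
    have hs : ρ s = preReflection c (α c) := by ext x; rw [hs, preReflection_apply]
    have hpos := H.preReflection_pos hlen hf hc ha hne hfa
    have hmem : preReflection c (α c) a ∈ Φ := hs ▸ H.map_mem a ha s
    have hlt : f (preReflection c (α c) a) < f a := by
      rw [preReflection_apply, ← H.coroot_comm hlen ha hcΦ, map_sub, map_smul, smul_eq_mul]
      nlinarith [hc.2.1]
    obtain ⟨L, hL, hLa⟩ := ih _ (by omega) hmem hpos rfl
    refine ⟨c :: (L ++ [c]), ?_, ?_⟩
    · simp only [List.mem_cons, List.mem_append, List.not_mem_nil, or_false]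
      rintro d (rfl | hd | rfl)
      exacts [hc, hL d hd, hc]
    · have := H.map_mul_preReflection ha s
      rw [hs] at this
      rw [reflectionProd_cons, reflectionProd_append, ← hLa, reflectionProd_cons,
        reflectionProd_nil, mul_one, ← this, ← mul_assoc, H.preReflection_mul_self hcΦ, one_mul]

/-- Every element of the Weyl group is a product of reflections in simple roots. -/
theorem exists_simple_reflectionProd {f : Dual ℤ Q} (hf : ∀ b ∈ Φ, f b ≠ 0) (w : W) :
    ∃ L : List Q, (∀ c ∈ L, c ∈ simpleRoots Φ f) ∧ ρ w = reflectionProd α L := by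
  have hw : w ∈ Subgroup.closure {s : W | ∃ a ∈ Φ, ∀ x : Q, ρ s x = x - α a x • a} :=
    H.closure_eq_top ▸ Subgroup.mem_top w
  induction hw using Subgroup.closure_induction with
  | mem s hs =>
    obtain ⟨a, ha, hs⟩ := hs
    obtain ⟨L, hL, hLa⟩ := H.exists_preReflection_eq_reflectionProd hlen hf ha
    refine ⟨L, hL, ?_⟩
    rw [← hLa]
    ext x
    rw [hs, preReflection_apply]
  | one => exact ⟨[], by simp, by simp⟩
  | mul v w _ _ hv hw =>
    obtain ⟨L, hL, hv⟩ := hv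
    obtain ⟨L', hL', hw⟩ := hw
    refine ⟨L ++ L', fun c hc ↦ ?_, by rw [map_mul, hv, hw, reflectionProd_append]⟩
    exact (List.mem_append.mp hc).elim (hL c) (hL' c)
  | inv v _ hv =>
    obtain ⟨L, hL, hv⟩ := hv
    refine ⟨L.reverse, fun c hc ↦ hL c (List.mem_reverse.mp hc), ?_⟩
    have h1 := H.reflectionProd_reverse_mul fun c hc ↦ (hL c hc).1
    calc ρ v⁻¹ = reflectionProd α L.reverse * reflectionProd α L * ρ v⁻¹ := by rw [h1, one_mul]
      _ = reflectionProd α L.reverse := by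
        rw [mul_assoc, ← hv, ← map_mul, mul_inv_cancel, map_one, mul_one]

/-- The deletion property. -/
theorem exists_deletion {f : Dual ℤ Q} (hf : ∀ b ∈ Φ, f b ≠ 0) {L : List Q}
    (hL : ∀ c ∈ L, c ∈ simpleRoots Φ f) {c : Q} (hc : c ∈ simpleRoots Φ f)
    (hneg : f (reflectionProd α L c) < 0) :
    ∃ L' : List Q, (∀ d ∈ L', d ∈ simpleRoots Φ f) ∧ L'.length + 1 = L.length ∧
      reflectionProd α L * preReflection c (α c) = reflectionProd α L' := by
  induction L with
  | nil =>
    have := hc.2.1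
    simp at hneg
    omega
  | cons d L ih =>
    have hd := hL d List.mem_cons_self
    have hL : ∀ c ∈ L, c ∈ simpleRoots Φ f := fun b hb ↦ hL b (List.mem_cons_of_mem d hb)
    by_cases hlt : f (reflectionProd α L c) < 0
    · obtain ⟨L', hL', hlen', hprod⟩ := ih hL hlt
      refine ⟨d :: L', ?_, by simp [hlen'], by simp [mul_assoc, hprod]⟩
      rintro b hb
      rcases List.mem_cons.mp hb with rfl | hb
      exacts [hd, hL' b hb]
    · obtain ⟨w, hw⟩ := H.exists_eq_reflectionProd fun c hc ↦ (hL c hc).1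
      have hmem := H.map_mem c hc.1 w
      have heq : ρ w c = d := by
        by_contra hne
        have := hf _ hmem
        rw [← hw] at hlt
        have := H.preReflection_pos hlen hf hd hmem hne (by omega)
        rw [reflectionProd_cons, ← hw, Module.End.mul_apply] at hneg
        omega
      refine ⟨L, hL, rfl, ?_⟩
      rw [reflectionProd_cons, ← hw, mul_assoc, H.map_mul_preReflection hc.1, heq, ← mul_assoc,
        H.preReflection_mul_self hd.1, one_mul]

/-- An element of the Weyl group that fixes a root acts through the orthogonal roots. -/
theorem map_sub_mem_span {a : Q} (ha : a ∈ Φ) {w : W} (hw : ρ w a = a) (x : Q) :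
    ρ w x - x ∈ Submodule.span ℤ {c | c ∈ Φ ∧ α a c = 0} := by
  obtain ⟨f, hf, hfa⟩ := H.exists_generic_dual a
  obtain ⟨L, hL, hwL⟩ := H.exists_simple_reflectionProd hlen hf w
  rw [hwL] at hw ⊢
  clear hwL
  induction hn : L.length using Nat.strong_induction_on generalizing L x with
  | _ n ih =>
    rcases List.eq_nil_or_concat L with rfl | ⟨L, c, rfl⟩
    · simp
    simp only [List.concat_eq_append] at hL hw hn ⊢
    have hc := hL c (by simp)
    have hL₁ : ∀ d ∈ L, d ∈ simpleRoots Φ f := fun d hd ↦ hL d (by simp [hd])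
    rw [List.length_append, List.length_singleton] at hn
    simp only [reflectionProd_append, reflectionProd_cons, reflectionProd_nil, mul_one] at hw ⊢
    rcases (hfa c hc.1 hc.2.1).eq_or_lt with h0 | hpos
    · have hca : preReflection c (α c) a = a := by
        rw [preReflection_apply, H.coroot_comm hlen hc.1 ha, ← h0, zero_smul, sub_zero]
      rw [Module.End.mul_apply, hca] at hw
      have := ih L.length (by omega) (preReflection c (α c) x) L hw hL₁ rfl
      rw [Module.End.mul_apply, ← sub_add_sub_cancel _ (preReflection c (α c) x)]
      refine add_mem this ?_
      rw [preReflection_apply, sub_sub_cancel_left]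
      exact Submodule.neg_mem _ (Submodule.smul_mem _ _ (Submodule.subset_span ⟨hc.1, h0.symm⟩))
    · obtain ⟨v, hv⟩ := H.exists_eq_reflectionProd fun d hd ↦ (hL₁ d hd).1
      obtain ⟨s, hs⟩ := H.exists_reflection c hc.1
      have hs : ρ s = preReflection c (α c) := by ext x; rw [hs, preReflection_apply]
      have hneg : f (reflectionProd α L c) < 0 := by
        have hmem : ρ v c ∈ Φ := H.map_mem c hc.1 v
        have h1 := H.coroot_map ha (v * s) c
        rw [map_mul, hs, hv, hw, Module.End.mul_apply,
          preReflection_apply_self (H.coroot_self c hc.1), map_neg, map_neg] at h1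
        rw [hv] at hmem
        have h2 := hfa _ hmem
        have h3 := hf _ hmem
        omega
      obtain ⟨L', hL', hlen', hprod⟩ := H.exists_deletion hlen hf hL₁ hc hneg
      rw [hprod] at hw ⊢
      exact ih L'.length (by omega) x L' hw hL' rfl

end SimplyLaced

section OddCoxeterNumber

variable (H : IsIrreducibleRootSystem ρ Φ α) [Module.Free ℤ Q] [Module.Finite ℤ Q]
include H

theorem card_filter_coroot_eq_one (hlen : ∀ a ∈ Φ, ∀ b ∈ Φ, form Φ α a a = form Φ α b b) {h : ℕ}
    (hl : 0 < finrank ℤ Q) (hcox : Φ.card = h * finrank ℤ Q) {a : Q} (ha : a ∈ Φ) :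
    {b ∈ Φ | α a b = 1}.card + 4 = 2 * h := by
  classical
  have h1 := congrArg (α a) (H.sum_coroot_smul hl hcox a)
  simp only [map_sum, map_smul, smul_eq_mul, H.coroot_self a ha] at h1
  rw [H.sum_filter_pos_coroot subset_rfl (fun b hb ↦ H.neg_mem hb)] at h1
  have h2 : {b ∈ Φ | 0 < α a b} = insert a {b ∈ Φ | α a b = 1} := by
    ext b
    simp only [Finset.mem_filter, Finset.mem_insert]
    constructor
    · rintro ⟨hb, hpos⟩
      rcases H.coroot_cases hlen ha hb with h | h | h | h | h
      · exact Or.inl h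
      · rw [h, map_neg, H.coroot_self a ha] at hpos
        omega
      · omega
      · exact Or.inr ⟨hb, h⟩
      · omega
    · rintro (rfl | ⟨hb, h⟩)
      · exact ⟨ha, by rw [H.coroot_self b ha]; norm_num⟩
      · exact ⟨hb, by omega⟩
  rw [h2, Finset.sum_insert (by simp [H.coroot_self a ha]), H.coroot_self a ha,
    Finset.sum_congr rfl (g := fun _ ↦ (1 : ℤ)) fun b hb ↦ by
      obtain ⟨hb, hab⟩ := Finset.mem_filter.mp hb
      rw [H.coroot_comm hlen hb ha, hab, mul_one],
    Finset.sum_const, nsmul_eq_mul, mul_one] at h1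
  omega

/-- If the Coxeter number is odd, then modulo `2` no root is in the span of the roots orthogonal
to it. -/
theorem exists_hom_zmod_two (hlen : ∀ a ∈ Φ, ∀ b ∈ Φ, form Φ α a a = form Φ α b b) {h : ℕ}
    (hl : 0 < finrank ℤ Q) (hcox : Φ.card = h * finrank ℤ Q) (hodd : Odd h) {a : Q}
    (ha : a ∈ Φ) :
    ∃ φ : Q →ₗ[ℤ] ZMod 2, φ a = 1 ∧ ∀ c ∈ Φ, α a c = 0 → φ c = 0 := by
  classical
  let : LinearOrder Q := linearOrderOfSTO WellOrderingRel
  have hσ : Function.Involutive fun b : Q ↦ a - b := fun b ↦ sub_sub_cancel a b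
  have hsub : ∀ b ∈ {b ∈ Φ | α a b = 1}, a - b ∈ {b ∈ Φ | α a b = 1} := by
    intro b hb
    obtain ⟨hb, hab⟩ := Finset.mem_filter.mp hb
    have := H.neg_mem (H.sub_smul_mem ha hb)
    rw [hab, one_smul, neg_sub] at this
    exact Finset.mem_filter.mpr ⟨this, by rw [map_sub, H.coroot_self a ha, hab]; norm_num⟩
  have hne : ∀ b ∈ {b ∈ Φ | α a b = 1}, a - b ≠ b := by
    intro b hb h
    obtain ⟨hb, hab⟩ := Finset.mem_filter.mp hb
    have := congrArg (α b) h
    rw [map_sub, H.coroot_comm hlen hb ha, hab, H.coroot_self b hb] at this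
    norm_num at this
  set S : Finset Q := {b ∈ {b ∈ Φ | α a b = 1} | b < a - b} with hS
  have hcard : {b ∈ Φ | α a b = 1}.card = 2 * S.card := by
    simpa using Finset.sum_eq_two_nsmul_sum_filter_lt _ hσ hsub id hne (fun _ ↦ (1 : ℕ))
      fun _ _ ↦ rfl
  have hSmem {b : Q} : b ∈ S ↔ (b ∈ Φ ∧ α a b = 1) ∧ b < a - b := by
    rw [hS, Finset.mem_filter, Finset.mem_filter]
  refine ⟨∑ b ∈ S, (Int.castAddHom (ZMod 2)).toIntLinearMap ∘ₗ α b, ?_, fun c hc hac ↦ ?_⟩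
  · have h1 := H.card_filter_coroot_eq_one hlen hl hcox ha
    have h2 : Odd S.card := by
      obtain ⟨k, rfl⟩ := hodd
      exact ⟨k - 1, by omega⟩
    rw [LinearMap.sum_apply, Finset.sum_congr rfl (g := fun _ ↦ (1 : ZMod 2)) fun b hb ↦ ?_]
    · rw [Finset.sum_const, nsmul_eq_mul, mul_one]
      exact ZMod.natCast_eq_one_iff_odd.mpr h2
    · obtain ⟨⟨hb, hab⟩, -⟩ := hSmem.mp hb
      simp [H.coroot_comm hlen hb ha, hab]
  · have hca : α c a = 0 := by rw [H.coroot_comm hlen hc ha, hac]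
    have hcs (b : Q) : α c (b - α c b • c) = -α c b := by
      rw [map_sub, map_smul, smul_eq_mul, H.coroot_self c hc]
      ring
    have hrefl : ∀ b ∈ {b ∈ Φ | α a b = 1}, b - α c b • c ∈ {b ∈ Φ | α a b = 1} := by
      intro b hb
      obtain ⟨hb, hab⟩ := Finset.mem_filter.mp hb
      exact Finset.mem_filter.mpr ⟨H.sub_smul_mem hc hb, by simp [hac, hab]⟩
    rw [LinearMap.sum_apply, Finset.sum_congr rfl (g := fun b ↦ (α c b : ZMod 2)) fun b hb ↦ by
      simp [H.coroot_comm hlen (hSmem.mp hb).1.1 hc]]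
    refine Finset.sum_involution (fun b _ ↦ if b - α c b • c < a - (b - α c b • c) then
      b - α c b • c else a - (b - α c b • c)) ?_ ?_ ?_ ?_
    · intro b _
      split_ifs
      · rw [hcs, Int.cast_neg, add_neg_cancel]
      · rw [map_sub, hca, hcs, zero_sub, neg_neg]
        exact CharTwo.add_self_eq_zero _
    · intro b hb h0 heq
      obtain ⟨⟨hb, hab⟩, -⟩ := hSmem.mp hb
      have heq := congrArg (α b) heq
      split_ifs at heq
      · rw [map_sub, map_smul, H.coroot_comm hlen hb hc, smul_eq_mul, sub_eq_self,
          mul_self_eq_zero] at heq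
        exact h0 (by rw [heq, Int.cast_zero])
      · rw [map_sub, map_sub, map_smul, H.coroot_comm hlen hb hc, H.coroot_comm hlen hb ha, hab,
          smul_eq_mul, H.coroot_self b hb] at heq
        have hsq : α c b * α c b = 3 := by linarith
        have hle := H.coroot_mem_Icc_of_form_eq hc hb (hlen c hc b hb)
        obtain ⟨hl, hu⟩ := hle
        generalize α c b = n at *
        interval_cases n <;> omega
    · intro b hb
      have hb := hrefl b (Finset.mem_filter.mp hb).1
      split_ifs with hlt
      · exact Finset.mem_filter.mpr ⟨hb, hlt⟩
      · refine Finset.mem_filter.mpr ⟨hsub _ hb, ?_⟩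
        rw [sub_sub_cancel]
        exact lt_of_le_of_ne (not_lt.mp hlt) (hne _ hb)
    · intro b hb
      have hlt := (hSmem.mp hb).2
      by_cases h1 : b - α c b • c < a - (b - α c b • c)
      · simp only [if_pos h1]
        rw [hcs, neg_smul, sub_neg_eq_add, sub_add_cancel, if_pos hlt]
      · have : a - (b - α c b • c) - α c (a - (b - α c b • c)) • c = a - b := by
          rw [map_sub, hca, hcs]
          module
        simp only [if_neg h1]
        rw [this, sub_sub_cancel, if_neg hlt.not_gt]

theorem even_coroot {h : ℕ} (hl : 0 < finrank ℤ Q) (hcox : Φ.card = h * finrank ℤ Q)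
    (hodd : Odd h) {a : Q} (ha : a ∈ Φ) {w : W} (hw : ρ w a = -a) {x y : Q}
    (hxy : ρ w x - x = (2 : ℤ) • y) : Even (α a x) := by
  have hlen : ∀ a ∈ Φ, ∀ b ∈ Φ, form Φ α a a = form Φ α b b := fun a ha b hb ↦
    H.form_eq_of_odd hcox hodd ha hb
  obtain ⟨φ, hφa, hφ⟩ := H.exists_hom_zmod_two hlen hl hcox hodd ha
  obtain ⟨s, hs⟩ := H.exists_reflection a ha
  have hmem := H.map_sub_mem_span hlen ha (w := s * w)
    (by rw [map_mul, Module.End.mul_apply, hw, hs, map_neg, H.coroot_self a ha]; module) x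
  have hle : Submodule.span ℤ {c | c ∈ Φ ∧ α a c = 0} ≤ LinearMap.ker φ :=
    Submodule.span_le.mpr fun c hc ↦ hφ c hc.1 hc.2
  have h0 : φ (ρ (s * w) x - x) = 0 := hle hmem
  rw [map_mul, Module.End.mul_apply, hs, sub_eq_iff_eq_add.mp hxy] at h0
  simp only [map_sub, map_add, map_smul, hφa, zsmul_eq_mul, Int.cast_add, Int.cast_mul,
    smul_eq_mul, mul_one] at h0
  have h2 : ((2 : ℤ) : ZMod 2) = 0 := rfl
  rw [h2, zero_mul, zero_mul] at h0
  rw [← ZMod.intCast_eq_zero_iff_even]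
  linear_combination -h0

end OddCoxeterNumber

/-- Every fixed point of `w` on `Q / rQ` lifts to a fixed point of `w` on `Q`. -/
def LiftsFixedPoints (ρ : Representation ℤ W Q) (w : W) (r : ℤ) : Prop :=
  ∀ x y : Q, ρ w x - x = r • y → ∃ u z : Q, ρ w u = u ∧ x = u + r • z

theorem LiftsFixedPoints.mul [Module.Free ℤ Q] {w : W} {r s : ℤ} (hr0 : r ≠ 0)
    (hr : LiftsFixedPoints ρ w r) (hs : LiftsFixedPoints ρ w s) :
    LiftsFixedPoints ρ w (r * s) := by
  intro x y hxy
  rw [mul_smul] at hxy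
  obtain ⟨u, z, hu, rfl⟩ := hr x _ hxy
  have hz : ρ w z - z = s • y := by
    refine smul_right_injective Q hr0 ?_
    dsimp only
    rw [← hxy, map_add, map_smul, hu]
    module
  obtain ⟨u', z', hu', rfl⟩ := hs z y hz
  refine ⟨u + r • u', z', by rw [map_add, map_smul, hu, hu'], ?_⟩
  module

theorem exists_fixed_of_isCoprime {w : W} {r n : ℤ} (hnr : IsCoprime n r) {x u z : Q}
    (hu : ρ w u = u) (h : n • x = u + r • z) : ∃ u z : Q, ρ w u = u ∧ x = u + r • z := by
  obtain ⟨p, q, hpq⟩ := hnr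
  refine ⟨p • u, p • z + q • x, by rw [map_smul, hu], ?_⟩
  calc x = p • n • x + (q * r) • x := by rw [smul_smul, ← add_smul, hpq, one_smul]
    _ = p • u + r • (p • z + q • x) := by rw [h]; module

theorem exists_pow_sub_eq_smul {w : W} {r : ℤ} {x y : Q} (hxy : ρ w x - x = r • y) (k : ℕ) :
    ∃ y : Q, ρ (w ^ k) x - x = r • y := by
  induction k with
  | zero => exact ⟨0, by simp⟩
  | succ k ih =>
    obtain ⟨z, hz⟩ := ih
    refine ⟨ρ w z + y, ?_⟩
    rw [pow_succ', map_mul, Module.End.mul_apply, sub_eq_iff_eq_add.mp hz, map_add, map_smul,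
      smul_add, ← hxy]
    abel

/-- The set of images of `a` under the powers of `w`. -/
def powOrbit (ρ : Representation ℤ W Q) (w : W) (a : Q) : Set Q :=
  Set.range fun k : ℕ ↦ ρ (w ^ k) a

theorem powOrbit_map [Finite W] (w : W) (a : Q) : powOrbit ρ w (ρ w a) = powOrbit ρ w a := by
  refine Set.Subset.antisymm ?_ ?_
  · rintro _ ⟨k, rfl⟩
    exact ⟨k + 1, by simp [pow_succ]⟩
  · rintro _ ⟨k, rfl⟩
    refine ⟨k + (orderOf w - 1), ?_⟩
    dsimp only
    rw [← Module.End.mul_apply, ← map_mul, ← pow_succ, add_assoc,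
      Nat.sub_add_cancel (orderOf_pos w), pow_add, pow_orderOf_eq_one, mul_one]

section Lifting

variable (H : IsIrreducibleRootSystem ρ Φ α) [Module.Free ℤ Q]
include H

theorem coroot_map_eq_sub {w : W} {r : ℤ} {x y : Q} (hxy : ρ w x - x = r • y) {a : Q}
    (ha : a ∈ Φ) : α (ρ w a) x = α a x - r * α (ρ w a) y := by
  have := H.coroot_map ha w x
  rw [sub_eq_iff_eq_add.mp hxy, map_add, map_smul, smul_eq_mul] at this
  linarith

theorem sum_coroot_smul_eq_two_smul {L : Type*} [LinearOrder L] {S : Finset Q} (hS : S ⊆ Φ)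
    (hneg : ∀ a ∈ S, -a ∈ S) (κ : Q → L) (hκ : ∀ a ∈ S, κ (-a) ≠ κ a) (x : Q) :
    ∑ a ∈ S, α a x • a = (2 : ℤ) • ∑ a ∈ S with κ a < κ (-a), α a x • a := by
  rw [Finset.sum_eq_two_nsmul_sum_filter_lt S neg_involutive hneg κ hκ, ofNat_zsmul]
  intro a ha
  rw [H.coroot_neg (hS ha), neg_smul_neg]

variable [Module.Finite ℤ Q] {h : ℕ} (hl : 0 < finrank ℤ Q) (hcox : Φ.card = h * finrank ℤ Q)
include hl hcox

theorem liftsFixedPoints_of_isCoprime (w : W) {r : ℤ} (hr : IsCoprime (2 * h : ℤ) r) :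
    LiftsFixedPoints ρ w r := by
  intro x y hxy
  refine exists_fixed_of_isCoprime hr (u := ∑ a ∈ Φ, (α a x % r) • a)
    (z := ∑ a ∈ Φ, (α a x / r) • a) ?_ ?_
  · rw [map_sum, ← Finset.sum_comp_of_mapsTo Φ (representation_apply_injective ρ w)
      (fun a ha ↦ H.map_mem a ha w) (fun a ↦ (α a x % r) • a)]
    refine Finset.sum_congr rfl fun a ha ↦ ?_
    rw [map_smul, H.coroot_map_eq_sub hxy ha, Int.sub_mul_emod_self_left]
  · rw [← H.sum_coroot_smul hl hcox, Finset.smul_sum, ← Finset.sum_add_distrib]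
    refine Finset.sum_congr rfl fun a _ ↦ ?_
    rw [smul_smul, ← add_smul, Int.emod_add_mul_ediv]

theorem liftsFixedPoints_two [Finite W] (hodd : Odd h) (w : W) : LiftsFixedPoints ρ w 2 := by
  intro x y hxy
  classical
  let : LinearOrder Q := linearOrderOfSTO WellOrderingRel
  obtain ⟨L, _, κ, hκ⟩ : ∃ (L : Type _) (_ : LinearOrder L) (κ : Q → L), ∀ a b,
      κ a = κ b ↔ powOrbit ρ w a = powOrbit ρ w b :=
    ⟨Set Q, linearOrderOfSTO WellOrderingRel, powOrbit ρ w, fun _ _ ↦ Iff.rfl⟩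
  have hneg {a : Q} (ha : a ∈ Φ) : Odd (α (-a) x) ↔ Odd (α a x) := by
    rw [H.coroot_neg ha, odd_neg]
  have horb : ∀ a ∈ {a ∈ Φ | Odd (α a x)}, κ (-a) ≠ κ a := by
    intro a ha heq
    rw [hκ] at heq
    obtain ⟨ha, hax⟩ := Finset.mem_filter.mp ha
    obtain ⟨k, hk⟩ : -a ∈ powOrbit ρ w a := heq ▸ ⟨0, by simp⟩
    obtain ⟨z, hz⟩ := exists_pow_sub_eq_smul hxy k
    exact Int.not_even_iff_odd.mpr hax (H.even_coroot hl hcox hodd ha hk hz)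
  have h1 := H.sum_coroot_smul_eq_two_smul (Finset.filter_subset (fun a ↦ Odd (α a x)) Φ)
    (fun a ha ↦ by
      obtain ⟨ha, hax⟩ := Finset.mem_filter.mp ha
      exact Finset.mem_filter.mpr ⟨H.neg_mem ha, (hneg ha).mpr hax⟩)
    κ horb x
  have h0 := H.sum_coroot_smul_eq_two_smul (Finset.filter_subset (fun a ↦ ¬Odd (α a x)) Φ)
    (fun a ha ↦ by
      obtain ⟨ha, hax⟩ := Finset.mem_filter.mp ha
      exact Finset.mem_filter.mpr ⟨H.neg_mem ha, (hneg ha).not.mpr hax⟩)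
    id (fun a ha heq ↦ by
      have := congrArg (α a) heq
      rw [id, id, map_neg, H.coroot_self a (Finset.mem_filter.mp ha).1] at this
      norm_num at this) x
  have hx := H.sum_coroot_smul hl hcox x
  rw [← Finset.sum_filter_add_sum_filter_not Φ (fun a ↦ Odd (α a x)), h1, h0, ← smul_add,
    mul_smul] at hx
  have hx := (smul_right_injective Q (two_ne_zero (α := ℤ)) hx).symm
  set S : Finset Q := {a ∈ {a ∈ Φ | Odd (α a x)} | κ a < κ (-a)} with hS
  set T : Finset Q := {a ∈ {a ∈ Φ | ¬Odd (α a x)} | id a < id (-a)} with hT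
  have hSw : ∀ a ∈ S, ρ w a ∈ S := by
    intro a ha
    simp only [hS, Finset.mem_filter] at ha ⊢
    obtain ⟨⟨ha, hax⟩, hlt⟩ := ha
    refine ⟨⟨H.map_mem a ha w, ?_⟩, ?_⟩
    · rw [H.coroot_map_eq_sub hxy ha]
      exact hax.sub_even (even_two_mul _)
    · rwa [← map_neg, (hκ _ _).mpr (powOrbit_map w a), (hκ _ _).mpr (powOrbit_map w (-a))]
  refine exists_fixed_of_isCoprime (n := h) (r := 2) ?_ (u := ∑ a ∈ S, a)
    (z := ∑ a ∈ S, (α a x / 2) • a + ∑ a ∈ T, (α a x / 2) • a) ?_ ?_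
  · exact Nat.isCoprime_iff_coprime.mpr hodd.coprime_two_right
  · rw [map_sum]
    exact Finset.sum_comp_of_mapsTo S (representation_apply_injective ρ w) hSw id
  · rw [hx, smul_add, ← add_assoc, Finset.smul_sum, Finset.smul_sum, ← Finset.sum_add_distrib]
    congr 1
    · refine Finset.sum_congr rfl fun a ha ↦ ?_
      have := (Finset.mem_filter.mp (Finset.mem_filter.mp ha).1).2
      have := Int.two_mul_ediv_two_add_one_of_odd this
      conv_lhs => rw [← this]
      module
    · refine Finset.sum_congr rfl fun a ha ↦ ?_
      have := Int.not_odd_iff_even.mp (Finset.mem_filter.mp (Finset.mem_filter.mp ha).1).2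
      rw [smul_smul, Int.two_mul_ediv_two_of_even this]

theorem liftsFixedPoints [Finite W] (w : W) {r : ℕ} (hr : 0 < r) (hrh : Nat.Coprime r h) :
    LiftsFixedPoints ρ w r := by
  induction r using Nat.strong_induction_on with
  | _ r ih =>
    rcases Nat.even_or_odd' r with ⟨s, rfl | rfl⟩
    · have hodd : Odd h := Nat.coprime_two_left.mp hrh.coprime_mul_right
      rw [Nat.cast_mul]
      exact LiftsFixedPoints.mul two_ne_zero (H.liftsFixedPoints_two hl hcox hodd w)
        (ih s (by omega) (by omega) hrh.coprime_mul_left)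
    · refine H.liftsFixedPoints_of_isCoprime hl hcox w ?_
      have h2 : Nat.Coprime 2 (2 * s + 1) := Nat.coprime_two_left.mpr ⟨s, rfl⟩
      exact_mod_cast Nat.isCoprime_iff_coprime.mpr (h2.mul_left hrh.symm)

end Lifting

theorem card_quotient_range_smul {K : Type*} [AddCommGroup K] [Module.Free ℤ K]
    [Module.Finite ℤ K] {r : ℕ} (hr : 0 < r) :
    Nat.card (K ⧸ LinearMap.range ((r : ℤ) • (LinearMap.id : K →ₗ[ℤ] K))) =
      r ^ finrank ℤ K := by
  have : NeZero r := ⟨hr.ne'⟩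
  let b := Module.finBasis ℤ K
  let ψ : K →ₗ[ℤ] (Fin (finrank ℤ K) → ZMod r) :=
    LinearMap.pi fun i ↦ (Int.castAddHom (ZMod r)).toIntLinearMap ∘ₗ b.coord i
  have hψ (k : K) (i) : ψ k i = (b.repr k i : ZMod r) := rfl
  have hsurj : LinearMap.range ψ = ⊤ := by
    rw [LinearMap.range_eq_top]
    intro v
    refine ⟨b.equivFun.symm fun i ↦ ((v i).val : ℤ), ?_⟩
    ext i
    rw [hψ, ← b.equivFun_apply, LinearEquiv.apply_symm_apply]
    simp
  have hker : LinearMap.ker ψ = LinearMap.range ((r : ℤ) • (LinearMap.id : K →ₗ[ℤ] K)) := by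
    ext k
    rw [LinearMap.mem_ker, LinearMap.mem_range]
    constructor
    · intro hk
      refine ⟨b.equivFun.symm fun i ↦ b.repr k i / r, ?_⟩
      refine b.equivFun.injective (funext fun i ↦ ?_)
      have : (r : ℤ) ∣ b.repr k i :=
        (ZMod.intCast_zmod_eq_zero_iff_dvd _ _).mp (congrFun hk i)
      simp only [LinearMap.smul_apply, LinearMap.id_apply, map_smul, LinearEquiv.apply_symm_apply,
        Pi.smul_apply, smul_eq_mul, Module.Basis.equivFun_apply]
      exact Int.mul_ediv_cancel' this
    · rintro ⟨q, rfl⟩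
      ext i
      rw [hψ]
      simp
  rw [← hker, Nat.card_congr ψ.quotKerEquivRange.toEquiv, hsurj,
    Nat.card_congr Submodule.topEquiv.toEquiv]
  simp

theorem LiftsFixedPoints.card_eq [Module.Free ℤ Q] [Module.Finite ℤ Q] {w : W} {r : ℕ}
    (hr : 0 < r) (hw : LiftsFixedPoints ρ w r) :
    Nat.card {y : Q ⧸ LinearMap.range ((r : ℤ) • (LinearMap.id : Q →ₗ[ℤ] Q)) //
      ∃ x : Q, Submodule.Quotient.mk x = y ∧
        ρ w x - x ∈ LinearMap.range ((r : ℤ) • (LinearMap.id : Q →ₗ[ℤ] Q))} =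
      r ^ finrank ℤ (LinearMap.ker ((ρ w : Module.End ℤ Q) - 1)) := by
  set N := LinearMap.range ((r : ℤ) • (LinearMap.id : Q →ₗ[ℤ] Q)) with hN
  set K := LinearMap.ker ((ρ w : Module.End ℤ Q) - 1) with hK
  have hNmem {x : Q} : x ∈ N ↔ ∃ y, (r : ℤ) • y = x := Iff.rfl
  have hKmem {x : Q} : x ∈ K ↔ ρ w x = x := by simp [hK, sub_eq_zero]
  have hr0 : (r : ℤ) ≠ 0 := by exact_mod_cast hr.ne'
  let g : K →ₗ[ℤ] Q ⧸ N := N.mkQ ∘ₗ K.subtype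
  have hker : LinearMap.ker g = LinearMap.range ((r : ℤ) • (LinearMap.id : K →ₗ[ℤ] K)) := by
    ext k
    rw [LinearMap.mem_ker, LinearMap.comp_apply, Submodule.mkQ_apply,
      Submodule.Quotient.mk_eq_zero, Submodule.subtype_apply, hNmem, LinearMap.mem_range]
    constructor
    · rintro ⟨q, hq⟩
      have hqK : q ∈ K := hKmem.mpr <| smul_right_injective Q hr0 <| by
        dsimp only
        rw [← map_smul, hq, hKmem.mp k.2]
      exact ⟨⟨q, hqK⟩, Subtype.ext hq⟩
    · rintro ⟨q, rfl⟩
      exact ⟨q, rfl⟩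
  have hrange (y : Q ⧸ N) :
      (∃ x : Q, Submodule.Quotient.mk x = y ∧ ρ w x - x ∈ N) ↔ y ∈ LinearMap.range g := by
    constructor
    · rintro ⟨x, rfl, y, hy⟩
      obtain ⟨u, z, hu, rfl⟩ := hw x y hy.symm
      refine ⟨⟨u, hKmem.mpr hu⟩, (Submodule.Quotient.eq N).mpr ⟨-z, ?_⟩⟩
      simp
    · rintro ⟨k, rfl⟩
      exact ⟨k, rfl, by rw [hKmem.mp k.2, sub_self]; exact N.zero_mem⟩
  rw [Nat.card_congr (Equiv.subtypeEquivRight hrange),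
    ← Nat.card_congr g.quotKerEquivRange.toEquiv, hker, card_quotient_range_smul hr]

end IsIrreducibleRootSystem

/-- Sommers: let `W` be the Weyl group of an irreducible
(reduced, crystallographic) root system of rank `ℓ` with root lattice `Q`,
Coxeter number `h = |Φ|/ℓ`, and `r` a positive integer coprime to `h`.  Then
for every `w ∈ W`, the number of fixed points of `w` acting on `Q/rQ` equals
`r^{fix(w)}`, where `fix(w)` is the rank of the fixed sublattice of `w`. -/
theorem stmt10 {Q : Type*} [AddCommGroup Q] [Module ℤ Q]
    [Module.Free ℤ Q] [Module.Finite ℤ Q]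
    {W : Type*} [Group W] [Finite W] (ρ : Representation ℤ W Q)
    (hfaith : Function.Injective ρ)
    (ℓ : ℕ) (hl : Module.finrank ℤ Q = ℓ) (hl0 : 0 < ℓ)
    (Φ : Finset Q) (α : Q → Module.Dual ℤ Q)
    (hspan : Submodule.span ℤ (Φ : Set Q) = ⊤)
    (hpair : ∀ a ∈ Φ, α a a = 2)
    (hstab : ∀ a ∈ Φ, ∀ w : W, ρ w a ∈ Φ)
    (hrefl : ∀ a ∈ Φ, ∃ s : W, ∀ x : Q, ρ s x = x - α a x • a)
    (hgen : Subgroup.closure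
        {s : W | ∃ a ∈ Φ, ∀ x : Q, ρ s x = x - α a x • a} = ⊤)
    (hred : ∀ a ∈ Φ, (2 : ℤ) • a ∉ Φ)
    (hirr : ∀ p : Submodule ℤ Q, (∀ w : W, ∀ x ∈ p, ρ w x ∈ p) →
        p = ⊥ ∨ Module.finrank ℤ p = ℓ)
    (h : ℕ) (hcox : Φ.card = h * ℓ)
    (r : ℕ) (hr : 0 < r) (hcop : Nat.Coprime r h)
    (w : W) :
    Nat.card {y : Q ⧸ LinearMap.range ((r : ℤ) • (LinearMap.id : Q →ₗ[ℤ] Q)) //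
        ∃ x : Q, Submodule.Quotient.mk x = y ∧
          ρ w x - x ∈ LinearMap.range ((r : ℤ) • (LinearMap.id : Q →ₗ[ℤ] Q))} =
      r ^ (Module.finrank ℤ (LinearMap.ker ((ρ w : Module.End ℤ Q) - 1))) := by
  obtain rfl : ‹Module ℤ Q› = AddCommGroup.toIntModule Q := Subsingleton.elim _ _
  subst hl
  have H : IsIrreducibleRootSystem ρ Φ α :=
    ⟨hfaith, hspan, hpair, hstab, hrefl, hgen, hred, hirr⟩
  exact (H.liftsFixedPoints hl0 hcox w hr hcop).card_eq hr
end
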